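/- Let 1 ≤ q ≤ 2 ≤ p < ∞ with p* = p/(p−1), and let ε₀ = 0.00863. For every real m×n matrix A there exist diagonal matrices D₁ ∈ ℝ^{m×m}, D₂ ∈ ℝ^{n×n} and a matrix B ∈ ℝ^{m×n} such that A = D₁·B·D₂ and ‖D₂‖_{p→2} · ‖B‖_{2→2} · ‖D₁‖_{2→q} ≤ ((1+ε₀)/arsinh(1)) · (1/(γ_{p*}·γ_q)) · ‖A‖_{p→q}. (In particular, every operator from ℓ_p^n to ℓ_q^m factorizes through a Hilbert space with factorization constant at most (1+ε₀)/(arsinh(1)·γ_{p*}·γ_q).) -/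

import Mathlib

noncomputable section

open MeasureTheory Real Set

/-- The `r`-th Gaussian norm: `γ_r = (∫ |x|^r (2π)^{-1/2} e^{-x²/2} dx)^{1/r}`. -/
def gaussNorm (r : ℝ) : ℝ :=
  (∫ x : ℝ, |x| ^ r * ((Real.sqrt (2 * Real.pi))⁻¹ * Real.exp (-x ^ 2 / 2))) ^ (1 / r)

/-- The `ℓ_r` norm of a vector in `ℝ^d`. -/
def lpnorm (r : ℝ) {d : ℕ} (x : Fin d → ℝ) : ℝ :=
  (∑ i, |x i| ^ r) ^ (1 / r)

/-- The `p → q` operator norm of a real `m × n` matrix. -/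
def opNorm (p q : ℝ) {m n : ℕ} (A : Matrix (Fin m) (Fin n) ℝ) : ℝ :=
  sSup {t : ℝ | ∃ x : Fin n → ℝ, x ≠ 0 ∧ t = lpnorm q (A.mulVec x) / lpnorm p x}




/-- coefficients -/
def pc (a b : ℝ) : ℕ → ℝ
  | 0 => 1
  | (k+1) => pc a b k * ((2*(k:ℝ)+1-a)*(2*(k:ℝ)+1-b)/((2*(k:ℝ)+1)*(2*(k:ℝ)+2)))

lemma pc_nonneg {a b : ℝ} (ha1 : a ≤ 1) (hb1 : b ≤ 1) (k : ℕ) :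
    0 ≤ pc a b k := by
  induction k with
  | zero => simp [pc]
  | succ k ih =>
    rw [pc]
    have hk : (0:ℝ) ≤ k := Nat.cast_nonneg k
    have h1 : 0 ≤ 2*(k:ℝ)+1-a := by linarith
    have h2 : 0 ≤ 2*(k:ℝ)+1-b := by linarith
    positivity

lemma pc_le_one {a b : ℝ} (ha0 : 0 ≤ a) (ha1 : a ≤ 1) (hb0 : 0 ≤ b) (hb1 : b ≤ 1) (k : ℕ) :
    pc a b k ≤ 1 := by
  induction k with
  | zero => simp [pc]
  | succ k ih =>
    rw [pc]
    have hk : (0:ℝ) ≤ k := Nat.cast_nonneg k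
    have h1 : 0 ≤ 2*(k:ℝ)+1-a := by linarith
    have h2 : 0 ≤ 2*(k:ℝ)+1-b := by linarith
    have h3 : (2*(k:ℝ)+1-a)*(2*(k:ℝ)+1-b)/((2*(k:ℝ)+1)*(2*(k:ℝ)+2)) ≤ 1 := by
      rw [div_le_one (by positivity)]
      apply mul_le_mul <;> linarith
    calc _ ≤ 1 * (1:ℝ) := mul_le_mul ih h3 (by positivity) (by norm_num)
      _ = 1 := by norm_num

lemma ratio_ineq {a b : ℝ} (ha0 : 0 ≤ a) (ha1 : a ≤ 1) (hb0 : 0 ≤ b) (hb1 : b ≤ 1) (n m : ℕ)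
    (hmn : m < n) :
    (n:ℝ) * (n+m+2) * ((2*(m:ℝ)+1-a)*(2*(m:ℝ)+1-b)/((2*(m:ℝ)+1)*(2*(m:ℝ)+2))) ≤
    ((n:ℝ)+1)*(n+m)*((2*(n:ℝ)+1-a)*(2*(n:ℝ)+1-b)/((2*(n:ℝ)+1)*(2*(n:ℝ)+2))) := by
  have hm : (0:ℝ) ≤ m := Nat.cast_nonneg m
  have hn : (m:ℝ) + 1 ≤ n := by exact_mod_cast hmn
  have e1 : (2*(m:ℝ)+1-a)*(2*(m:ℝ)+1-b)/((2*(m:ℝ)+1)*(2*(m:ℝ)+2)) =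
      ((1 - a/(2*m+1)) * (1-b/(2*m+1))) * ((2*m+1)/(2*m+2)) := by
    field_simp
  have e2 : (2*(n:ℝ)+1-a)*(2*(n:ℝ)+1-b)/((2*(n:ℝ)+1)*(2*(n:ℝ)+2)) =
      ((1 - a/(2*n+1)) * (1-b/(2*n+1))) * ((2*n+1)/(2*n+2)) := by
    have : (0:ℝ) ≤ n := by linarith
    field_simp
  rw [e1, e2]
  have h0 : ∀ c : ℝ, 0 ≤ c → c ≤ 1 → 0 ≤ 1 - c/(2*m+1) := by
    intro c h0 h1
    have : c/(2*m+1) ≤ 1 := by rw [div_le_one (by positivity)]; linarith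
    linarith
  have h1 : ∀ c : ℝ, 0 ≤ c → 1 - c/(2*m+1) ≤ 1 - c/(2*n+1) := by
    intro c h0
    have : c/(2*n+1) ≤ c/(2*m+1) := by gcongr
    linarith
  have hb : (1 - a/(2*m+1)) * (1-b/(2*m+1)) ≤ (1 - a/(2*n+1)) * (1-b/(2*n+1)) :=
    mul_le_mul (h1 a ha0) (h1 b hb0) (h0 b hb0 hb1) ((h0 a ha0 ha1).trans (h1 a ha0))
  have hB : 0 ≤ (1 - a/(2*m+1)) * (1-b/(2*m+1)) := mul_nonneg (h0 a ha0 ha1) (h0 b hb0 hb1)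
  have hr : (n:ℝ) * (n+m+2) * ((2*m+1)/(2*m+2)) ≤ ((n:ℝ)+1)*(n+m)*((2*n+1)/(2*n+2)) := by
    have h2 : (0:ℝ) < 2*n+2 := by linarith
    have : (0:ℝ) ≤ (n-m)*(n-m-1) := mul_nonneg (by linarith) (by linarith)
    have e : ((n:ℝ)+1)*(n+m)*((2*n+1)/(2*n+2)) = (n+m)*(2*n+1)/2 := by
      field_simp
    rw [e, ← mul_div_assoc, div_le_div_iff₀ (by positivity) (by norm_num)]
    nlinarith
  have hr0 : 0 ≤ (n:ℝ) * (n+m+2) * ((2*m+1)/(2*m+2)) := by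
    have : (0:ℝ) ≤ n := by linarith
    positivity
  calc _ = ((1 - a/(2*m+1)) * (1-b/(2*m+1))) * ((n:ℝ) * (n+m+2) * ((2*m+1)/(2*m+2))) := by ring
    _ ≤ ((1 - a/(2*n+1)) * (1-b/(2*n+1))) * (((n:ℝ)+1)*(n+m)*((2*n+1)/(2*n+2))) :=
      mul_le_mul hb hr hr0 (hB.trans hb)
    _ = _ := by ring

lemma pc_ratio {a b : ℝ} (ha0 : 0 ≤ a) (ha1 : a ≤ 1) (hb0 : 0 ≤ b) (hb1 : b ≤ 1) (n m : ℕ)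
    (hmn : m < n) :
    (n:ℝ) * (n+m+2) * pc a b (m+1) * pc a b n ≤ ((n:ℝ)+1)*(n+m) * pc a b (n+1) * pc a b m := by
  have h := mul_le_mul_of_nonneg_left (ratio_ineq ha0 ha1 hb0 hb1 n m hmn)
    (mul_nonneg (pc_nonneg ha1 hb1 m) (pc_nonneg ha1 hb1 n))
  rw [pc, pc]
  linarith

open PowerSeries in
lemma formal_id (P g : PowerSeries ℝ) (hP : P ≠ 0) (h : g * P^2 = 1) (n : ℕ) :
    ∑ x ∈ Finset.HasAntidiagonal.antidiagonal (n+1), ((x.1:ℝ) + 2*x.2) * (coeff x.1 g * coeff x.2 P) = 0 := by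
  have h1 : derivative ℝ (g * P^2) = 0 := by rw [h]; simp
  have h2 : derivative ℝ g * P + 2 * (g * derivative ℝ P) = 0 := by
    have : P * (derivative ℝ g * P + 2 * (g * derivative ℝ P)) = 0 := by
      rw [← h1]
      simp only [Derivation.leibniz, Derivation.leibniz_pow]
      simp
      ring
    exact (mul_eq_zero.mp this).resolve_left hP
  have h3 := congrArg (coeff (n+1)) (congrArg (fun z => X * z) h2)
  have e : X * (derivative ℝ g * P + 2 * (g * derivative ℝ P)) =
     (X * derivative ℝ g) * P + (g * (X * derivative ℝ P)) + (g * (X * derivative ℝ P)) := by ring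
  have hX : ∀ (F : PowerSeries ℝ) (k : ℕ), coeff k (X * derivative ℝ F) = k * coeff k F := by
    intro F k
    cases k with
    | zero => simp
    | succ k => 
      rw [coeff_succ_X_mul, coeff_derivative]; push_cast; ring
  simp only [e] at h3
  simp only [map_add, coeff_mul, hX, mul_zero, map_zero] at h3
  rw [← h3, ← Finset.sum_add_distrib, ← Finset.sum_add_distrib]
  apply Finset.sum_congr rfl
  intros; ring

lemma antidiag_succ_split (f : ℕ → ℕ → ℝ) (n : ℕ) :
    ∑ x ∈ Finset.HasAntidiagonal.antidiagonal (n+1), f x.1 x.2 =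
      f 0 (n+1) + (∑ k ∈ Finset.range n, f (k+1) (n-k)) + f (n+1) 0 := by
  rw [Finset.Nat.sum_antidiagonal_eq_sum_range_succ_mk, Finset.sum_range_succ,
    Finset.sum_range_succ']
  simp
  ring

open PowerSeries in
lemma gamma_nonpos {a b : ℝ} (ha0 : 0 ≤ a) (ha1 : a ≤ 1) (hb0 : 0 ≤ b) (hb1 : b ≤ 1)
    (g : PowerSeries ℝ) (h : g * (PowerSeries.mk (pc a b))^2 = 1) (n : ℕ) :
    coeff (n+1) g ≤ 0 := by
  have hP0 : PowerSeries.mk (pc a b) ≠ 0 := by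
    intro h0; rw [h0] at h; simp at h
  have hid := formal_id _ g hP0 h
  simp only [coeff_mk] at hid
  have hg0 : coeff 0 g = 1 := by
    have := congrArg (coeff 0) h
    simpa [coeff_mul, pow_two, pc] using this
  have hnn := fun k => pc_nonneg ha1 hb1 k
  induction n using Nat.strong_induction_on with
  | _ n ih =>
  have h1 := hid n
  rw [antidiag_succ_split (fun i j => ((i:ℝ) + 2*j) * (coeff i g * pc a b j))] at h1
  simp only [hg0] at h1
  have hp0 : pc a b 0 = 1 := by simp [pc]
  rw [hp0] at h1
  rcases n with _ | n
  · simp at h1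
    have := hnn 1
    simp; linarith
  rcases eq_or_lt_of_le (hnn (n+1)) with hz | hpos
  · -- degenerate
    have hz1 : ∀ k, pc a b (k+1) = 0 := by
      have key : ∃ k:ℕ, (2*(k:ℝ)+1-a)*(2*(k:ℝ)+1-b) = 0 := by
        by_contra! hc
        have : ∀ k, pc a b k ≠ 0 := by
          intro k
          induction k with
          | zero => simp [pc]
          | succ k ihk =>
            rw [pc]
            apply mul_ne_zero ihk
            apply div_ne_zero (hc k)
            positivity
        exact this _ hz.symm
      obtain ⟨k, hk⟩ := key
      have hk0 : (0:ℝ) ≤ k := Nat.cast_nonneg k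
      have h11 : (1-a)*(1-b) = 0 := by
        rcases mul_eq_zero.mp hk with h | h
        · have : a = 1 := by linarith
          rw [this]; ring
        · have : b = 1 := by linarith
          rw [this]; ring
      intro k
      induction k with
      | zero => simp [pc, h11]
      | succ k ihk => rw [pc, ihk, zero_mul]
    have hs : ∑ k ∈ Finset.range (n+1), ((((k+1:ℕ):ℝ)) + 2*((n+1-k:ℕ):ℝ)) * (coeff (k+1) g * pc a b (n+1-k)) = 0 := by
      apply Finset.sum_eq_zero
      intro k hk
      have : n + 1 - k = (n - k) + 1 := by have := Finset.mem_range.mp hk; omega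
      rw [this, hz1]; ring
    rw [hs, hz1] at h1
    simp at h1
    rcases h1 with h1 | h1
    · exfalso; have : (0:ℝ) ≤ n := Nat.cast_nonneg n
      linarith
    · exact h1.le
  · have h2 := hid n
    rw [antidiag_succ_split (fun i j => ((i:ℝ) + 2*j) * (coeff i g * pc a b j))] at h2
    simp only [hg0, hp0] at h2
    rw [Finset.sum_range_succ] at h1
    set N : ℝ := (n:ℝ)+1 with hN
    have hNpos : 0 < N := by positivity
    -- multiply h1 by N p_{n+1}, h2 by (N+1) p_{n+2}
    have hs : 0 ≤ N * pc a b (n+1) * (∑ k ∈ Finset.range n, ((((k+1:ℕ):ℝ)) + 2*((n+1-k:ℕ):ℝ)) * (coeff (k+1) g * pc a b (n+1-k)))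
       - (N+1) * pc a b (n+2) * (∑ k ∈ Finset.range n, ((((k+1:ℕ):ℝ)) + 2*((n-k:ℕ):ℝ)) * (coeff (k+1) g * pc a b (n-k))) := by
      rw [Finset.mul_sum, Finset.mul_sum, ← Finset.sum_sub_distrib]
      apply Finset.sum_nonneg
      intro k hk
      have hk := Finset.mem_range.mp hk
      obtain ⟨m, rfl⟩ : ∃ m, n = k + m := ⟨n-k, by omega⟩
      have e1 : k + m + 1 - k = m + 1 := by omega
      have e2 : k + m - k = m := by omega
      rw [e1, e2]
      have hr := pc_ratio ha0 ha1 hb0 hb1 (k+m+1) m (by omega)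
      have hγ := ih k (by omega)
      have := mul_le_mul_of_nonneg_left hr (neg_nonneg.mpr hγ)
      simp only [hN]
      push_cast at this ⊢
      nlinarith
    have hl : 0 ≤ N * pc a b (n+1) * (((((n+1:ℕ):ℝ)) + 2*((n+1-n:ℕ):ℝ)) * (coeff (n+1) g * pc a b (n+1-n))) - (N+1) * pc a b (n+2) * (((n+1:ℕ):ℝ) + 2 * ((0:ℕ):ℝ)) * (coeff (n+1) g * 1) := by
      have e1 : n + 1 - n = 1 := by omega
      rw [e1]
      have hr := pc_ratio ha0 ha1 hb0 hb1 (n+1) 0 (by omega)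
      have hγ := ih n (by omega)
      have := mul_le_mul_of_nonneg_left hr (neg_nonneg.mpr hγ)
      rw [hp0] at this
      simp only [hN]
      push_cast at this ⊢
      nlinarith
    have hfin : N * pc a b (n+1) * (((n+1+1:ℕ):ℝ) + 2 * ((0:ℕ):ℝ)) * (coeff (n+1+1) g * 1) ≤ 0 := by
      have a1 := congrArg (fun z => N * pc a b (n+1) * z) h1
      have a2 := congrArg (fun z => (N+1) * pc a b (n+2) * z) h2
      simp only [hN] at a1 a2 hs hl ⊢
      push_cast at a1 a2 hs hl ⊢
      nlinarith
    push_cast at hfin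
    by_contra! hc
    have : 0 < N * pc a b (n+1) * ((n:ℝ)+1+1 + 2 * 0) * (coeff (n+1+1) g * 1) := by positivity
    linarith

open PowerSeries ENNReal in
lemma ennreal_cauchy (u v : ℕ → ℝ≥0∞) :
    (∑' n, u n) * (∑' n, v n) = ∑' n, ∑ x ∈ Finset.HasAntidiagonal.antidiagonal n, u x.1 * v x.2 := by
  calc (∑' n, u n) * (∑' n, v n) = ∑' (x : ℕ × ℕ), u x.1 * v x.2 := by
        rw [ENNReal.tsum_prod', ← ENNReal.tsum_mul_right]
        congr 1; ext i
        exact ENNReal.tsum_mul_left.symm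
    _ = ∑' (y : Σ n : ℕ, Finset.HasAntidiagonal.antidiagonal n), u (y.2 : ℕ × ℕ).1 * v (y.2 : ℕ × ℕ).2 := by
        rw [← (Finset.HasAntidiagonal.sigmaAntidiagonalEquivProd (A := ℕ)).tsum_eq]
        rfl
    _ = _ := by
        rw [ENNReal.tsum_sigma']
        congr 1; ext n
        rw [tsum_fintype, ← Finset.sum_coe_sort (Finset.HasAntidiagonal.antidiagonal n) (fun x => u x.1 * v x.2)]

open PowerSeries in
lemma kaluza {a b : ℝ} (ha0 : 0 ≤ a) (ha1 : a ≤ 1) (hb0 : 0 ≤ b) (hb1 : b ≤ 1) :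
    ∃ c : ℕ → ℝ, (∀ k, 0 ≤ c k) ∧ (∀ N, ∑ k ∈ Finset.range N, c k ≤ 1) ∧
      ∀ x : ℝ, 0 ≤ x → x < 1 →
        (1 - ∑' k, c k * x^(k+1)) * (∑' k, pc a b k * x^k)^2 = 1 := by
  set P : PowerSeries ℝ := PowerSeries.mk (pc a b) with hP
  have hP0 : constantCoeff (P^2) ≠ 0 := by
    simp [hP, pc]
  set g := (P^2)⁻¹ with hg
  have h : g * P^2 = 1 := PowerSeries.inv_mul_cancel _ hP0
  have hneg := gamma_nonpos ha0 ha1 hb0 hb1 g h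
  have hg0 : coeff 0 g = 1 := by
    have := congrArg (coeff 0) h
    simpa [coeff_mul, pow_two, pc, hP] using this
  have hpn := fun k => pc_nonneg ha1 hb1 k
  have hπ : ∀ n, 0 ≤ coeff n (P^2) := by
    intro n
    rw [pow_two, coeff_mul]
    apply Finset.sum_nonneg
    intro x _
    simp only [hP, coeff_mk]
    exact mul_nonneg (hpn _) (hpn _)
  have key : ∀ x : ℝ, 0 ≤ x → x < 1 → Summable (fun k => -coeff (k+1) g * x^(k+1)) ∧ 
     (1 - ∑' k, -coeff (k+1) g * x^(k+1)) * (∑' k, pc a b k * x^k)^2 = 1 := by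
    intro x hx0 hx1
    have hsP : Summable (fun k => pc a b k * x^k) := by
      apply Summable.of_nonneg_of_le _ _ (summable_geometric_of_lt_one hx0 hx1)
      · intro k; have := hpn k; positivity
      · intro k
        have := pc_le_one ha0 ha1 hb0 hb1 k
        have hxk : 0 ≤ x^k := by positivity
        nlinarith
    set U := ∑' n, ENNReal.ofReal (coeff n (P^2) * x^n) with hU
    set V := ∑' k, ENNReal.ofReal (-coeff (k+1) g * x^(k+1)) with hV
    set S := ∑' k, ENNReal.ofReal (pc a b k * x^k) with hS
    have hS' : S = ENNReal.ofReal (∑' k, pc a b k * x^k) := by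
      rw [hS, ENNReal.ofReal_tsum_of_nonneg _ hsP]
      intro k; have := hpn k; positivity
    have hUS : U = S * S := by
      rw [hU, hS, ennreal_cauchy]
      congr 1; ext n
      rw [pow_two, coeff_mul, Finset.sum_mul, ENNReal.ofReal_sum_of_nonneg]
      · apply Finset.sum_congr rfl
        intro y hy
        rw [← ENNReal.ofReal_mul (by have := hpn y.1; positivity)]
        congr 1
        rw [← Finset.HasAntidiagonal.mem_antidiagonal.mp hy, hP, coeff_mk, coeff_mk, pow_add]; ring
      · intro y _
        rw [hP, coeff_mk, coeff_mk]
        have := hpn y.1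
        have := hpn y.2
        positivity
    have hVU : V * U + 1 = U := by
      have hU1 : U = 1 + ∑' n, ENNReal.ofReal (coeff (n+1) (P^2) * x^(n+1)) := by
        rw [hU, tsum_eq_zero_add' ENNReal.summable]
        congr 1
        simp [hP, pc]
      refine Eq.trans ?_ hU1.symm
      rw [add_comm, hV, hU, ennreal_cauchy]
      congr 2; funext n
      have hrec : coeff (n+1) (P^2) = ∑ y ∈ Finset.HasAntidiagonal.antidiagonal n, -coeff (y.1+1) g * coeff y.2 (P^2) := by
        have := congrArg (coeff (n+1)) h
        rw [coeff_mul, Finset.Nat.antidiagonal_succ, Finset.sum_cons, Finset.sum_map] at this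
        simp [hg0, coeff_one] at this
        simp only [neg_mul, Finset.sum_neg_distrib]
        linarith
      rw [hrec, Finset.sum_mul, ENNReal.ofReal_sum_of_nonneg]
      · apply Finset.sum_congr rfl
        intro y hy
        rw [← ENNReal.ofReal_mul (by have := hneg y.1; have : 0 ≤ -coeff (y.1+1) g := by linarith
                                     positivity)]
        congr 1
        rw [← Finset.HasAntidiagonal.mem_antidiagonal.mp hy, pow_add, pow_add, pow_add]; ring
      · intro y _
        have := hneg y.1
        have h1 : 0 ≤ -coeff (y.1+1) g := by linarith
        have := hπ y.2
        positivity
    have hUfin : U ≠ ⊤ := by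
      rw [hUS, hS']; exact ENNReal.mul_ne_top ENNReal.ofReal_ne_top ENNReal.ofReal_ne_top
    have hU1 : 1 ≤ U := by rw [← hVU]; exact le_add_self
    have hVfin : V ≠ ⊤ := by
      intro ht
      rw [ht, ENNReal.top_mul (by intro h0; rw [h0] at hU1; simp at hU1)] at hVU
      exact hUfin (by rw [← hVU]; simp)
    have hvn : ∀ k, 0 ≤ -coeff (k+1) g * x^(k+1) := by
      intro k
      have := hneg k
      have h1 : 0 ≤ -coeff (k+1) g := by linarith
      positivity
    have hsum : Summable (fun k => -coeff (k+1) g * x^(k+1)) := by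
      have := ENNReal.summable_toReal hVfin
      simpa only [ENNReal.toReal_ofReal (hvn _)] using this
    refine ⟨hsum, ?_⟩
    have hV' : V = ENNReal.ofReal (∑' k, -coeff (k+1) g * x^(k+1)) := by
      rw [hV, ENNReal.ofReal_tsum_of_nonneg hvn hsum]
    have hP1 : 0 ≤ ∑' k, pc a b k * x^k := tsum_nonneg (fun k => by have := hpn k; positivity)
    have hV1 : 0 ≤ ∑' k, -coeff (k+1) g * x^(k+1) := tsum_nonneg hvn
    have := congrArg ENNReal.toReal hVU
    rw [ENNReal.toReal_add (ENNReal.mul_ne_top hVfin hUfin) (by simp), ENNReal.toReal_mul, hUS,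
      ENNReal.toReal_mul, hV', hS', ENNReal.toReal_ofReal hV1, ENNReal.toReal_ofReal hP1] at this
    simp at this ⊢
    linarith
  refine ⟨fun k => -coeff (k+1) g, fun k => by have := hneg k; simpa using this, ?_, fun x h0 h1 => (key x h0 h1).2⟩
  intro N
  have hle : ∀ x : ℝ, x ∈ Ico (0:ℝ) 1 → ∑ k ∈ Finset.range N, -coeff (k+1) g * x^(k+1) ≤ 1 := by
    intro x hx
    obtain ⟨hs, he⟩ := key x hx.1 hx.2
    have h1 : ∑ k ∈ Finset.range N, -coeff (k+1) g * x^(k+1) ≤ ∑' k, -coeff (k+1) g * x^(k+1) := by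
      apply hs.sum_le_tsum
      intro k _
      have := hneg k
      have h1 : 0 ≤ -coeff (k+1) g := by linarith
      have := hx.1
      positivity
    by_contra! hc
    nlinarith [sq_nonneg (∑' k, pc a b k * x^k)]
  have hcont : Continuous (fun x : ℝ => ∑ k ∈ Finset.range N, -coeff (k+1) g * x^(k+1)) := by
    fun_prop
  have hmem : (1:ℝ) ∈ closure (Ico (0:ℝ) 1) := by
    rw [closure_Ico (by norm_num)]; simp
  have := closure_minimal (s := Ico (0:ℝ) 1) (t := {x | ∑ k ∈ Finset.range N, -coeff (k+1) g * x^(k+1) ≤ 1}) hle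
    (isClosed_le hcont continuous_const) hmem
  simpa using this




lemma summable_poly_geom (C r : ℝ) (hr0 : 0 ≤ r) (hr1 : r < 1) :
    Summable (fun k : ℕ => C * (k+1) * (2*k+2) * r^k) := by
  have hn : ‖r‖ < 1 := by rw [Real.norm_eq_abs, abs_of_nonneg hr0]; exact hr1
  have h0 := summable_pow_mul_geometric_of_norm_lt_one 0 hn
  have h1 := summable_pow_mul_geometric_of_norm_lt_one 1 hn
  have h2 := summable_pow_mul_geometric_of_norm_lt_one 2 hn
  have := ((h2.mul_left (2*C)).add (h1.mul_left (4*C))).add (h0.mul_left (2*C))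
  refine this.congr ?_
  intro k; ring

lemma summable_series (c : ℕ → ℝ) (C : ℝ) (e : ℕ → ℕ) (he1 : ∀ k, k ≤ e k)
    (hc : ∀ k, |c k| ≤ C*(k+1)*(2*k+2)) (x : ℝ) (hx : |x| < 1) : Summable (fun k => c k * x^(e k)) := by
  apply Summable.of_norm_bounded (summable_poly_geom C |x| (abs_nonneg x) hx)
  intro k
  rw [norm_mul, norm_pow, Real.norm_eq_abs, Real.norm_eq_abs]
  have h1 : |x|^(e k) ≤ |x|^k := pow_le_pow_of_le_one (abs_nonneg x) hx.le (he1 k)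
  exact mul_le_mul (hc k) h1 (by positivity) ((abs_nonneg _).trans (hc k))

lemma hasDerivAt_series (c : ℕ → ℝ) (C : ℝ) (e : ℕ → ℕ) (he1 : ∀ k, k ≤ e k)
    (he2 : ∀ k, e k ≤ 2*k+2) (hc : ∀ k, |c k| ≤ C*(k+1)) (x : ℝ) (hx : |x| < 1) :
    HasDerivAt (fun x => ∑' k, c k * x^(e k)) (∑' k, c k * ((e k : ℝ) * x^(e k - 1))) x := by
  obtain ⟨r, hr1, hr2⟩ := exists_between hx
  have hr0 : 0 < r := (abs_nonneg x).trans_lt hr1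
  have hC0 : 0 ≤ C := by have := (abs_nonneg _).trans (hc 0); simpa using this
  have hxr : x ∈ Metric.ball (0:ℝ) r := by simpa using hr1
  have hs : Summable (fun k : ℕ => (C * (k+1) * (2*k+2) * r^k) / r) :=
    (summable_poly_geom C r hr0.le hr2).div_const r
  refine hasDerivAt_tsum_of_isPreconnected (g := fun k x => c k * x^(e k))
    (g' := fun k x => c k * ((e k : ℝ) * x^(e k - 1))) hs Metric.isOpen_ball
    (convex_ball (0:ℝ) r).isPreconnected ?_ ?_ (Metric.mem_ball_self hr0) ?_ hxr
  · intro k y hy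
    exact (hasDerivAt_pow (e k) y).const_mul (c k)
  · intro k y hy
    have hy' : |y| ≤ r := by simpa using (Metric.mem_ball.mp hy).le
    rw [norm_mul, norm_mul, norm_pow, Real.norm_eq_abs, Real.norm_eq_abs, Real.norm_eq_abs]
    rcases Nat.eq_zero_or_pos (e k) with h0 | hpos
    · rw [h0]; simp; positivity
    · have h1 : |y|^(e k - 1) ≤ r^k / r := by
        calc |y|^(e k - 1) ≤ r^(e k - 1) := pow_le_pow_left₀ (abs_nonneg y) hy' _
          _ = r^(e k) / r := by
            obtain ⟨j, hj⟩ : ∃ j, e k = j+1 := ⟨e k - 1, by omega⟩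
            rw [hj]; simp [pow_succ]; field_simp
          _ ≤ r^k / r := by
            gcongr ?_ / r
            exact pow_le_pow_of_le_one hr0.le hr2.le (he1 k)
      have h2 : |(e k : ℝ)| ≤ 2*k+2 := by
        rw [abs_of_nonneg (Nat.cast_nonneg _)]; exact_mod_cast he2 k
      calc |c k| * (|(e k : ℝ)| * |y|^(e k - 1)) ≤ (C*(k+1)) * ((2*k+2) * (r^k/r)) := by
            apply mul_le_mul (hc k) _ (by positivity) (by positivity)
            apply mul_le_mul h2 h1 (by positivity) (by positivity)
        _ = _ := by ring
  · apply summable_series c C e he1 _ 0 (by simp)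
    intro k
    have h1 := hc k
    have : (0:ℝ) ≤ k := Nat.cast_nonneg k
    nlinarith [mul_nonneg hC0 (by positivity : (0:ℝ) ≤ k+1)]

/-- the scalar function f -/
def ff (a b : ℝ) (x : ℝ) : ℝ := ∑' k, pc a b k / (2*k+1) * x^(2*k+1)

def Psi (c : ℕ → ℝ) (v : ℝ) : ℝ := ∑' k : ℕ, ((k:ℝ)+1) * c k * v^(2*k+1)
def WW (c : ℕ → ℝ) (v : ℝ) : ℝ := ∑' k : ℕ, c k * v^(2*k+2)

lemma ff_coef_bound {a b : ℝ} (ha0 : 0 ≤ a) (ha1 : a ≤ 1) (hb0 : 0 ≤ b) (hb1 : b ≤ 1) (k : ℕ) : |pc a b k / (2*k+1)| ≤ 1 * (k+1) := by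
  have h1 := pc_le_one ha0 ha1 hb0 hb1 k
  have h0 := pc_nonneg ha1 hb1 k
  have hk : (0:ℝ) ≤ k := Nat.cast_nonneg k
  rw [abs_of_nonneg (by positivity), div_le_iff₀ (by positivity)]
  nlinarith

lemma ff_summable {a b : ℝ} (ha0 : 0 ≤ a) (ha1 : a ≤ 1) (hb0 : 0 ≤ b) (hb1 : b ≤ 1) (x : ℝ) (hx : |x| < 1) : Summable (fun k => pc a b k / (2*k+1) * x^(2*k+1)) := by
  apply summable_series _ 1 (fun k => 2*k+1) (fun k => by omega) _ x hx
  intro k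
  have := ff_coef_bound ha0 ha1 hb0 hb1 k
  have hk : (0:ℝ) ≤ k := Nat.cast_nonneg k
  nlinarith

lemma pc_coef_bound {a b : ℝ} (ha0 : 0 ≤ a) (ha1 : a ≤ 1) (hb0 : 0 ≤ b) (hb1 : b ≤ 1) (k : ℕ) : |pc a b k| ≤ 1 * (k+1) := by
  have h1 := pc_le_one ha0 ha1 hb0 hb1 k
  have h0 := pc_nonneg ha1 hb1 k
  have hk : (0:ℝ) ≤ k := Nat.cast_nonneg k
  rw [abs_of_nonneg (by positivity)]
  linarith

lemma ff_hasDerivAt {a b : ℝ} (ha0 : 0 ≤ a) (ha1 : a ≤ 1) (hb0 : 0 ≤ b) (hb1 : b ≤ 1) (x : ℝ) (hx : |x| < 1) :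
    HasDerivAt (ff a b) (∑' k, pc a b k * x^(2*k)) x := by
  have := hasDerivAt_series (fun k => pc a b k / (2*k+1)) 1 (fun k => 2*k+1) (fun k => by omega)
    (fun k => by omega) (ff_coef_bound ha0 ha1 hb0 hb1) x hx
  refine HasDerivAt.congr_deriv (f := ff a b) this ?_
  refine tsum_congr fun k => ?_
  simp
  field_simp

lemma ff_expand {a b : ℝ} (ha0 : 0 ≤ a) (ha1 : a ≤ 1) (hb0 : 0 ≤ b) (hb1 : b ≤ 1) (x y : ℝ) (hx : |x| < 1) (hy : |y| < 1) (hxy : x ≤ y) :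
    y - x ≤ ff a b y - ff a b x := by
  have h1 := ff_summable ha0 ha1 hb0 hb1 x hx
  have h2 := ff_summable ha0 ha1 hb0 hb1 y hy
  rw [ff, ff, ← h2.tsum_sub h1]
  have := (h2.sub h1).sum_le_tsum (s := {0}) (by
    intro k _
    rw [← mul_sub]
    have h0 := pc_nonneg ha1 hb1 k
    have : x^(2*k+1) ≤ y^(2*k+1) := (Odd.strictMono_pow ⟨k, rfl⟩).monotone hxy
    have h3 : 0 ≤ y^(2*k+1) - x^(2*k+1) := by linarith
    positivity)
  simpa [pc] using this

lemma ff_zero (a b : ℝ) : ff a b 0 = 0 := by simp [ff]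

lemma ff_inv_exists {a b : ℝ} (ha0 : 0 ≤ a) (ha1 : a ≤ 1) (hb0 : 0 ≤ b) (hb1 : b ≤ 1) (x : ℝ) (hx : |x| < 1) : ∃ y, |y| ≤ |x| ∧ ff a b y = x := by
  have hz := ff_zero a b
  have hax : |(|x|)| < 1 := by simpa using hx
  have hnx : |(-|x|)| < 1 := by simpa using hx
  have hcont : ContinuousOn (ff a b) (Icc (-|x|) |x|) := by
    intro y hy
    have : |y| < 1 := (abs_le.mpr ⟨by linarith [hy.1], hy.2⟩).trans_lt hx
    exact (ff_hasDerivAt ha0 ha1 hb0 hb1 y this).continuousAt.continuousWithinAt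
  have hle : -|x| ≤ |x| := by have := abs_nonneg x; linarith
  have hivt := intermediate_value_Icc hle hcont
  have h1 := ff_expand ha0 ha1 hb0 hb1 0 |x| (by simp) hax (abs_nonneg x)
  have h2 := ff_expand ha0 ha1 hb0 hb1 (-|x|) 0 hnx (by simp) (by have := abs_nonneg x; linarith)
  rw [hz] at h1 h2
  have hmem : x ∈ Icc (ff a b (-|x|)) (ff a b |x|) :=
    ⟨by have := neg_abs_le x; linarith, by have := le_abs_self x; linarith⟩
  obtain ⟨y, hy, hy2⟩ := hivt hmem
  exact ⟨y, abs_le.mpr ⟨hy.1, hy.2⟩, hy2⟩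

lemma WW_hasDerivAt {c : ℕ → ℝ} (hc0 : ∀ k, 0 ≤ c k) (hc1 : ∀ N, ∑ k ∈ Finset.range N, c k ≤ 1)
   (x : ℝ) (hx : |x| < 1) : HasDerivAt (WW c) (2 * Psi c x) x := by
  have hck : ∀ k, c k ≤ 1 := fun k => by
    have := hc1 (k+1)
    rw [Finset.sum_range_succ] at this
    have h := Finset.sum_nonneg (s := Finset.range k) (fun i _ => hc0 i)
    linarith
  have := hasDerivAt_series c 1 (fun k => 2*k+2) (fun k => by omega)
    (fun k => by omega) (fun k => by
      have hk : (0:ℝ) ≤ k := Nat.cast_nonneg k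
      rw [abs_of_nonneg (hc0 k)]; have := hck k; linarith) x hx
  refine HasDerivAt.congr_deriv (f := WW c) this ?_
  rw [Psi, ← tsum_mul_left]
  refine tsum_congr fun k => ?_
  simp
  ring

lemma scalar_inverse {a b : ℝ} (ha0 : 0 ≤ a) (ha1 : a ≤ 1) (hb0 : 0 ≤ b) (hb1 : b ≤ 1) {c : ℕ → ℝ} (hc0 : ∀ k, 0 ≤ c k) (hc1 : ∀ N, ∑ k ∈ Finset.range N, c k ≤ 1)
   (hc : ∀ x : ℝ, 0 ≤ x → x < 1 →
        (1 - ∑' k, c k * x^(k+1)) * (∑' k, pc a b k * x^k)^2 = 1) :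
   ∃ h d : ℝ → ℝ, h 0 = 0 ∧ d 0 = 1 ∧ ∀ x, |x| < 1 → |h x| ≤ |x| ∧ ff a b (h x) = x ∧
     HasDerivAt h (d x) x ∧ HasDerivAt d (- Psi c (h x)) x := by
  have hex : ∀ x : ℝ, ∃ y, |x| < 1 → |y| ≤ |x| ∧ ff a b y = x := by
    intro x
    by_cases hx : |x| < 1
    · obtain ⟨y, hy⟩ := ff_inv_exists ha0 ha1 hb0 hb1 x hx
      exact ⟨y, fun _ => hy⟩
    · exact ⟨0, fun h => absurd h hx⟩
  choose h hh using hex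
  have h0 : h 0 = 0 := by
    have := (hh 0 (by simp)).1
    simpa using this
  have hlt : ∀ x, |x| < 1 → |h x| < 1 := fun x hx => (hh x hx).1.trans_lt hx
  have hlip : ∀ x y, |x| < 1 → |y| < 1 → |h x - h y| ≤ |x - y| := by
    intro x y hx hy
    rcases le_total (h x) (h y) with hl | hl
    · have := ff_expand ha0 ha1 hb0 hb1 _ _ (hlt x hx) (hlt y hy) hl
      rw [(hh x hx).2, (hh y hy).2] at this
      rw [abs_sub_comm, abs_of_nonneg (by linarith), abs_sub_comm]
      exact this.trans (le_abs_self _)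
    · have := ff_expand ha0 ha1 hb0 hb1 _ _ (hlt y hy) (hlt x hx) hl
      rw [(hh x hx).2, (hh y hy).2] at this
      rw [abs_of_nonneg (by linarith)]
      exact this.trans (le_abs_self _)
  have hnhds : ∀ x : ℝ, |x| < 1 → ∀ᶠ y in nhds x, |y| < 1 := by
    intro x hx
    exact (continuous_abs.tendsto x).eventually (gt_mem_nhds hx)
  have hcont : ∀ x, |x| < 1 → ContinuousAt h x := by
    intro x hx
    rw [ContinuousAt, tendsto_iff_dist_tendsto_zero]
    have ht : Filter.Tendsto (fun y => |y - x|) (nhds x) (nhds 0) := by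
      have : ContinuousAt (fun y => |y - x|) x := by fun_prop
      simpa [ContinuousAt] using this
    apply squeeze_zero' (Filter.Eventually.of_forall fun y => dist_nonneg) _ ht
    filter_upwards [hnhds x hx] with y hy
    rw [Real.dist_eq]
    exact hlip y x hy hx
  have hWP : ∀ v : ℝ, |v| < 1 → (1 - WW c v) * (∑' k, pc a b k * v^(2*k))^2 = 1 := by
    intro v hv
    have := hc (v^2) (by positivity) (by rw [← sq_abs]; have := abs_nonneg v; nlinarith)
    convert this using 4
    · rw [WW]; congr 1; ext k; rw [← pow_mul]; ring_nf
    · ext k; rw [← pow_mul]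
  have hPpos : ∀ v : ℝ, |v| < 1 → 0 < ∑' k, pc a b k * v^(2*k) := by
    intro v hv
    have h1 : 0 ≤ ∑' k, pc a b k * v^(2*k) := tsum_nonneg (fun k => by
      have := pc_nonneg ha1 hb1 k
      have : 0 ≤ v^(2*k) := by rw [pow_mul]; positivity
      positivity)
    rcases h1.eq_or_lt with h | h
    · have := hWP v hv
      rw [← h] at this; simp at this
    · exact h
  have hinv : ∀ v : ℝ, |v| < 1 → 0 < 1 - WW c v ∧ (∑' k, pc a b k * v^(2*k))⁻¹ = √(1 - WW c v) := by
    intro v hv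
    have hp := hPpos v hv
    have hw := hWP v hv
    have e : 1 - WW c v = ((∑' k, pc a b k * v^(2*k))⁻¹)^2 := by
      field_simp; linarith
    rw [e]
    refine ⟨by positivity, ?_⟩
    rw [Real.sqrt_sq (by positivity)]
  have hder : ∀ x, |x| < 1 → HasDerivAt h (√(1 - WW c (h x))) x := by
    intro x hx
    rw [← (hinv _ (hlt x hx)).2]
    apply HasDerivAt.of_local_left_inverse (hcont x hx) (ff_hasDerivAt ha0 ha1 hb0 hb1 _ (hlt x hx))
      (hPpos _ (hlt x hx)).ne'
    filter_upwards [hnhds x hx] with y hy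
    exact (hh y hy).2
  refine ⟨h, fun x => √(1 - WW c (h x)), h0, ?_, ?_⟩
  · simp [h0, WW]
  · intro x hx
    refine ⟨(hh x hx).1, (hh x hx).2, hder x hx, ?_⟩
    have hpos := (hinv _ (hlt x hx)).1
    have hW := (WW_hasDerivAt hc0 hc1 (h x) (hlt x hx)).comp x (hder x hx)
    have := (hW.const_sub 1).sqrt hpos.ne'
    refine HasDerivAt.congr_deriv (f := fun x => √(1 - WW c (h x))) this ?_
    change _ / (2 * √(1 - WW c (h x))) = _
    have : √(1 - WW c (h x)) ≠ 0 := (Real.sqrt_pos.mpr hpos).ne'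
    field_simp




lemma c_le_one {c : ℕ → ℝ} (hc0 : ∀ k, 0 ≤ c k) (hc1 : ∀ N, ∑ k ∈ Finset.range N, c k ≤ 1) (k : ℕ) :
    c k ≤ 1 := by
  have := hc1 (k+1)
  rw [Finset.sum_range_succ] at this
  have h := Finset.sum_nonneg (s := Finset.range k) (fun i _ => hc0 i)
  linarith

lemma Psi_summable {c : ℕ → ℝ} (hc0 : ∀ k, 0 ≤ c k) (hc1 : ∀ N, ∑ k ∈ Finset.range N, c k ≤ 1)
    (x : ℝ) (hx : |x| < 1) : Summable (fun k : ℕ => ((k:ℝ)+1) * c k * x^(2*k+1)) := by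
  apply summable_series _ 1 (fun k => 2*k+1) (fun k => by omega) _ x hx
  intro k
  have := c_le_one hc0 hc1 k
  have := hc0 k
  have hk : (0:ℝ) ≤ k := Nat.cast_nonneg k
  rw [abs_of_nonneg (by positivity)]
  nlinarith

lemma Psi_continuousAt {c : ℕ → ℝ} (hc0 : ∀ k, 0 ≤ c k) (hc1 : ∀ N, ∑ k ∈ Finset.range N, c k ≤ 1)
    (x : ℝ) (hx : |x| < 1) : ContinuousAt (Psi c) x := by
  have := hasDerivAt_series (fun k => ((k:ℝ)+1) * c k) 1 (fun k => 2*k+1) (fun k => by omega)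
    (fun k => by omega) (fun k => by
      have := c_le_one hc0 hc1 k
      have := hc0 k
      have hk : (0:ℝ) ≤ k := Nat.cast_nonneg k
      rw [abs_of_nonneg (by positivity)]
      nlinarith) x hx
  exact this.continuousAt

lemma Psi_mono {c : ℕ → ℝ} (hc0 : ∀ k, 0 ≤ c k) (hc1 : ∀ N, ∑ k ∈ Finset.range N, c k ≤ 1)
    (x y : ℝ) (hx : 0 ≤ x) (hxy : x ≤ y) (hy : y < 1) : Psi c x ≤ Psi c y := by
  have hx1 : |x| < 1 := by rw [abs_of_nonneg hx]; linarith
  have hy1 : |y| < 1 := by rw [abs_of_nonneg (hx.trans hxy)]; linarith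
  apply (Psi_summable hc0 hc1 x hx1).tsum_le_tsum _ (Psi_summable hc0 hc1 y hy1)
  intro k
  have := hc0 k
  gcongr

lemma Psi_nonneg {c : ℕ → ℝ} (hc0 : ∀ k, 0 ≤ c k) 
    (x : ℝ) (hx : 0 ≤ x) : 0 ≤ Psi c x := by
  apply tsum_nonneg
  intro k
  have := hc0 k
  positivity

lemma WW_le {c : ℕ → ℝ} (hc0 : ∀ k, 0 ≤ c k) (hc1 : ∀ N, ∑ k ∈ Finset.range N, c k ≤ 1)
    (x : ℝ) (hx : |x| < 1) : WW c x ≤ x^2 := by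
  apply Real.tsum_le_of_sum_range_le
  · intro k
    have := hc0 k
    rw [show 2*k+2 = 2*(k+1) by ring, pow_mul]; positivity
  · intro N
    calc ∑ k ∈ Finset.range N, c k * x^(2*k+2) ≤ ∑ k ∈ Finset.range N, c k * x^2 := by
          apply Finset.sum_le_sum
          intro k _
          apply mul_le_mul_of_nonneg_left _ (hc0 k)
          rw [← sq_abs x, show 2*k+2 = 2*(k+1) by ring, pow_mul, ← sq_abs x, ← pow_mul]
          apply pow_le_pow_of_le_one (abs_nonneg _) hx.le; omega
      _ = (∑ k ∈ Finset.range N, c k) * x^2 := by rw [Finset.sum_mul]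
      _ ≤ 1 * x^2 := by apply mul_le_mul_of_nonneg_right (hc1 N); positivity
      _ = x^2 := one_mul _

lemma scalar_bound {c : ℕ → ℝ} (hc0 : ∀ k, 0 ≤ c k) (hc1 : ∀ N, ∑ k ∈ Finset.range N, c k ≤ 1)
    (T : ℝ) (hT1 : sinh T < 1) (n : ℝ → ℝ) (hn : Continuous n)
    (hn0 : ∀ t, 0 ≤ n t) (hn00 : n 0 = 0)
    (H : ∀ t ∈ Icc 0 T, ∀ R R1 : ℝ → ℝ, (∀ s ∈ Icc 0 t, n s < 1) → R 0 = 0 → R1 0 = 1 →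
      (∀ s ∈ Icc 0 t, HasDerivAt R (R1 s) s ∧ HasDerivAt R1 (Psi c (n s)) s) → n t ≤ R t) :
    ∀ t ∈ Icc 0 T, n t < 1 := by
  intro t0 ht0
  have hT0 : 0 ≤ T := ht0.1.trans ht0.2
  have hs0 : 0 ≤ sinh T := Real.sinh_nonneg_iff.mpr hT0
  set r1 : ℝ := (1 + sinh T)/2 with hr1
  have hr1a : sinh T < r1 := by linarith
  have hr1b : r1 < 1 := by linarith
  have hr1c : 0 < r1 := by linarith
  set ν : ℝ → ℝ := fun t => min (n t) r1 with hν
  have hν0 : ∀ t, 0 ≤ ν t := fun t => le_min (hn0 t) hr1c.le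
  have hν1 : ∀ t, ν t ≤ r1 := fun t => min_le_right _ _
  have hνc : Continuous ν := hn.min continuous_const
  have hG : Continuous (fun t => Psi c (ν t)) := by
    rw [continuous_iff_continuousAt]
    intro t
    have : |ν t| < 1 := by rw [abs_of_nonneg (hν0 t)]; linarith [hν1 t]
    exact ContinuousAt.comp (Psi_continuousAt hc0 hc1 (ν t) this) hνc.continuousAt
  set R1 : ℝ → ℝ := fun t => 1 + ∫ s in (0:ℝ)..t, Psi c (ν s) with hR1
  have hR1d : ∀ t, HasDerivAt R1 (Psi c (ν t)) t := by
    intro t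
    exact (hG.integral_hasStrictDerivAt 0 t).hasDerivAt.const_add 1
  have hR1c : Continuous R1 := continuous_iff_continuousAt.mpr fun t => (hR1d t).continuousAt
  set R : ℝ → ℝ := fun t => ∫ s in (0:ℝ)..t, R1 s with hR
  have hRd : ∀ t, HasDerivAt R (R1 t) t := by
    intro t
    exact (hR1c.integral_hasStrictDerivAt 0 t).hasDerivAt
  have hRc : Continuous R := continuous_iff_continuousAt.mpr fun t => (hRd t).continuousAt
  have hR0 : R 0 = 0 := by simp [hR]
  have hR10 : R1 0 = 1 := by simp [hR1]
  have hR1ge : ∀ t, 0 ≤ t → 1 ≤ R1 t := by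
    intro t ht
    have : 0 ≤ ∫ s in (0:ℝ)..t, Psi c (ν s) :=
      intervalIntegral.integral_nonneg ht (fun s _ => Psi_nonneg hc0 _ (hν0 s))
    simp only [hR1]; linarith
  have hRge : ∀ t, 0 ≤ t → 0 ≤ R t := by
    intro t ht
    exact intervalIntegral.integral_nonneg ht (fun s hs => by linarith [hR1ge s hs.1])
  set F : ℝ → ℝ := fun t => max (n t) (R t) with hF
  have hFc : Continuous F := hn.max hRc
  by_contra! hcon
  have hne : (Icc 0 T ∩ {t | r1 ≤ F t}).Nonempty :=
    ⟨t0, ht0, (hr1b.le.trans hcon).trans (le_max_left _ _)⟩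
  have hcomp : IsCompact (Icc 0 T ∩ {t | r1 ≤ F t}) :=
    isCompact_Icc.inter_right (isClosed_le continuous_const hFc)
  obtain ⟨t2, ⟨ht2, ht2F⟩, hleast⟩ := hcomp.exists_isLeast hne
  have hlt : ∀ t ∈ Ico 0 t2, F t < r1 := by
    intro t ht
    by_contra! hc
    have := hleast (a := t) ⟨⟨ht.1, ht.2.le.trans ht2.2⟩, hc⟩
    linarith [ht.2]
  have ht2pos : 0 ≠ t2 := by
    intro h0
    have : r1 ≤ F 0 := by rw [h0]; exact ht2F
    rw [hF] at this
    simp only [hn00, hR0, max_self] at this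
    linarith
  have hle : ∀ t ∈ Icc 0 t2, F t ≤ r1 := by
    have : closure (Ico 0 t2) ⊆ {t | F t ≤ r1} :=
      closure_minimal (fun t ht => (hlt t ht).le) (isClosed_le hFc continuous_const)
    rw [closure_Ico ht2pos] at this
    exact this
  have hnle : ∀ t ∈ Icc 0 t2, n t ≤ r1 := fun t ht => (le_max_left _ _).trans (hle t ht)
  have hRle : ∀ t ∈ Icc 0 t2, R t ≤ r1 := fun t ht => (le_max_right _ _).trans (hle t ht)
  have hνn : ∀ t ∈ Icc 0 t2, ν t = n t := fun t ht => min_eq_left (hnle t ht)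
  have hnR : ∀ t ∈ Icc 0 t2, n t ≤ R t := by
    intro t ht
    apply H t ⟨ht.1, ht.2.trans ht2.2⟩ R R1 _ hR0 hR10
    · intro s hs
      refine ⟨hRd s, ?_⟩
      rw [← hνn s ⟨hs.1, hs.2.trans ht.2⟩]
      exact hR1d s
    · intro s hs
      exact (hnle s ⟨hs.1, hs.2.trans ht.2⟩).trans_lt hr1b
  have hRabs : ∀ t ∈ Icc 0 t2, |R t| < 1 := fun t ht => by
    rw [abs_of_nonneg (hRge t ht.1)]; linarith [hRle t ht]
  have hEd : ∀ t ∈ Icc 0 t2, HasDerivAt (fun t => R1 t ^2 - WW c (R t))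
      (2 * R1 t * (Psi c (ν t) - Psi c (R t))) t := by
    intro t ht
    have := ((hR1d t).pow 2).sub ((WW_hasDerivAt hc0 hc1 (R t) (hRabs t ht)).comp t (hRd t))
    refine HasDerivAt.congr_deriv (f := (fun t => R1 t ^2 - WW c (R t))) this ?_
    simp; ring
  have hE : AntitoneOn (fun t => R1 t ^2 - WW c (R t)) (Icc 0 t2) := by
    apply antitoneOn_of_deriv_nonpos (convex_Icc 0 t2)
    · intro t ht
      exact (hEd t ht).continuousAt.continuousWithinAt
    · intro t ht
      have := interior_subset ht
      exact (hEd t this).differentiableAt.differentiableWithinAt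
    · intro t ht
      have ht := interior_subset ht
      rw [(hEd t ht).deriv]
      have h1 := hR1ge t ht.1
      have h2 := Psi_mono hc0 hc1 (ν t) (R t) (hν0 t) (by rw [hνn t ht]; exact hnR t ht)
        (by linarith [hRle t ht])
      nlinarith
  have hE2 : ∀ t ∈ Icc 0 t2, R1 t ^2 ≤ 1 + R t^2 := by
    intro t ht
    have h1 := hE (a := 0) ⟨le_refl _, ht2.1⟩ ht ht.1
    simp only [hR0, hR10] at h1
    have h2 := WW_le hc0 hc1 (R t) (hRabs t ht)
    have : WW c 0 = 0 := by simp [WW]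
    rw [this] at h1
    linarith
  have hAd : ∀ t, HasDerivAt (fun t => t - arsinh (R t)) (1 - (√(1 + R t^2))⁻¹ * R1 t) t := by
    intro t
    exact (hasDerivAt_id t).sub ((Real.hasDerivAt_arsinh (R t)).comp t (hRd t))
  have hA : MonotoneOn (fun t => t - arsinh (R t)) (Icc 0 t2) := by
    apply monotoneOn_of_deriv_nonneg (convex_Icc 0 t2)
    · intro t ht
      exact (hAd t).continuousAt.continuousWithinAt
    · intro t ht
      exact (hAd t).differentiableAt.differentiableWithinAt
    · intro t ht
      have ht := interior_subset ht
      rw [(hAd t).deriv]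
      have h1 : R1 t ≤ √(1 + R t^2) := Real.le_sqrt_of_sq_le (hE2 t ht)
      have h2 : 0 < √(1 + R t^2) := Real.sqrt_pos.mpr (by positivity)
      have : (√(1 + R t^2))⁻¹ * R1 t ≤ 1 := by
        rw [inv_mul_le_iff₀ h2]; linarith
      linarith
  have hfin := hA (a := 0) ⟨le_refl _, ht2.1⟩ (b := t2) ⟨ht2.1, le_refl _⟩ ht2.1
  simp only [hR0, arsinh_zero, sub_zero] at hfin
  have h3 : R t2 ≤ sinh T := by
    have : arsinh (R t2) ≤ T := by linarith [ht2.2]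
    rw [← Real.sinh_arsinh (R t2)]
    exact Real.sinh_le_sinh.mpr this
  have h4 : F t2 ≤ sinh T := max_le ((hnR t2 ⟨ht2.1, le_refl _⟩).trans h3) h3
  have h5 : r1 ≤ F t2 := ht2F
  linarith




lemma psd_iff {ι : Type*} [Fintype ι] (Z : Matrix ι ι ℝ) :
    Z.PosSemidef ↔ (∀ k l, Z k l = Z l k) ∧ ∀ x : ι → ℝ, 0 ≤ ∑ k, ∑ l, x k * Z k l * x l := by
  rw [Matrix.posSemidef_iff_dotProduct_mulVec]
  have h1 : Z.IsHermitian ↔ ∀ k l, Z k l = Z l k := by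
    rw [Matrix.IsHermitian.ext_iff]
    simp only [star_trivial]
    exact ⟨fun h k l => h l k, fun h k l => h l k⟩
  rw [h1]
  refine and_congr Iff.rfl (forall_congr' fun x => ?_)
  have : star x ⬝ᵥ Z.mulVec x = ∑ k, ∑ l, x k * Z k l * x l := by
    simp only [dotProduct, Matrix.mulVec, Finset.mul_sum, star_trivial, mul_assoc]
  rw [this]

lemma psd_scale {ι : Type*} [Fintype ι] {Z : Matrix ι ι ℝ} (hZ : Z.PosSemidef) (σ : ι → ℝ) :
    (Matrix.of fun k l => σ k * σ l * Z k l).PosSemidef := by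
  rw [psd_iff] at hZ ⊢
  refine ⟨fun k l => by simp [hZ.1 k l, mul_comm (σ k)], fun x => ?_⟩
  have := hZ.2 (fun k => σ k * x k)
  refine this.trans_eq ?_
  refine Finset.sum_congr rfl fun k _ => Finset.sum_congr rfl fun l _ => ?_
  simp; ring

def KK (m n : ℕ) : Set (Fin m → Fin n → ℝ) :=
  {M | ∃ Z : Matrix (Fin m ⊕ Fin n) (Fin m ⊕ Fin n) ℝ, Z.PosSemidef ∧ (∀ k, Z k k = 1) ∧
    ∀ i j, Z (Sum.inl i) (Sum.inr j) = M i j}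

lemma KK_convex (m n : ℕ) : Convex ℝ (KK m n) := by
  rintro M ⟨Z, hZ, hZd, hZM⟩ M' ⟨Z', hZ', hZd', hZM'⟩ s t hs ht hst
  refine ⟨s • Z + t • Z', (hZ.smul hs).add (hZ'.smul ht), ?_, ?_⟩
  · intro k; simp [hZd, hZd', hst]
  · intro i j; simp [hZM, hZM']

lemma KK_mul {m n : ℕ} {M M' : Fin m → Fin n → ℝ} (h : M ∈ KK m n) (h' : M' ∈ KK m n) :
    M * M' ∈ KK m n := by
  obtain ⟨Z, hZ, hZd, hZM⟩ := h
  obtain ⟨Z', hZ', hZd', hZM'⟩ := h'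
  refine ⟨Matrix.hadamard Z Z', hZ.hadamard hZ', ?_, ?_⟩
  · intro k; simp [hZd, hZd']
  · intro i j; simp [hZM, hZM']

lemma KK_neg {m n : ℕ} (M : Fin m → Fin n → ℝ) (h : M ∈ KK m n) : -M ∈ KK m n := by
  obtain ⟨Z, hZ, hZd, hZM⟩ := h
  refine ⟨_, psd_scale hZ (Sum.elim (fun _ => 1) (fun _ => -1)), ?_, ?_⟩
  · rintro (k | k) <;> simp [hZd]
  · intro i j; simp [hZM]

lemma KK_small {m n : ℕ} (M : Fin m → Fin n → ℝ) (h : ∀ i j, |M i j| ≤ 1/((m:ℝ)+n+1)) :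
    M ∈ KK m n := by
  set ε : ℝ := 1/((m:ℝ)+n+1) with hε
  have hε0 : 0 < ε := by positivity
  have hε1 : ε * (m+n+1) = 1 := by rw [hε]; field_simp
  refine ⟨Matrix.fromBlocks 1 (Matrix.of M) (Matrix.of M).transpose 1, ?_, ?_, ?_⟩
  · rw [psd_iff]
    constructor
    · rintro (k | k) (l | l) <;> simp [Matrix.one_apply, eq_comm]
    · intro x
      have e : ∑ k, ∑ l, x k * (Matrix.fromBlocks 1 (Matrix.of M) (Matrix.of M).transpose 1 :
          Matrix (Fin m ⊕ Fin n) (Fin m ⊕ Fin n) ℝ) k l * x l =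
          ∑ i, x (Sum.inl i)^2 + ∑ j, x (Sum.inr j)^2 +
          2 * ∑ i, ∑ j, x (Sum.inl i) * M i j * x (Sum.inr j) := by
        simp only [Fintype.sum_sum_type, Matrix.fromBlocks_apply₁₁, Matrix.fromBlocks_apply₁₂,
          Matrix.fromBlocks_apply₂₁, Matrix.fromBlocks_apply₂₂, Matrix.one_apply, Matrix.of_apply,
          Matrix.transpose_apply, Finset.sum_add_distrib]
        have e1 : ∑ x_1, ∑ x_2, x (Sum.inr x_1) * M x_2 x_1 * x (Sum.inl x_2) =
          ∑ i, ∑ j, x (Sum.inl i) * M i j * x (Sum.inr j) := by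
          rw [Finset.sum_comm]
          refine Finset.sum_congr rfl fun k _ => Finset.sum_congr rfl fun l _ => ?_
          ring
        rw [e1]
        simp [pow_two]
        ring
      rw [e]
      have hb : -∑ i : Fin m, ∑ j : Fin n, ε * (x (Sum.inl i)^2 + x (Sum.inr j)^2) ≤
          2 * ∑ i, ∑ j, x (Sum.inl i) * M i j * x (Sum.inr j) := by
        rw [Finset.mul_sum, ← Finset.sum_neg_distrib]
        apply Finset.sum_le_sum
        intro i _
        rw [Finset.mul_sum, ← Finset.sum_neg_distrib]
        apply Finset.sum_le_sum
        intro j _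
        have h1 := abs_le.mp (h i j)
        set u := x (Sum.inl i)
        set v := x (Sum.inr j)
        nlinarith [mul_nonneg (by linarith : 0 ≤ ε + M i j) (sq_nonneg (u+v)),
          mul_nonneg (by linarith : 0 ≤ ε - M i j) (sq_nonneg (u-v))]
      have hc : ∑ i : Fin m, ∑ j : Fin n, ε * (x (Sum.inl i)^2 + x (Sum.inr j)^2) =
          ε * n * ∑ i, x (Sum.inl i)^2 + ε * m * ∑ j, x (Sum.inr j)^2 := by
        simp only [← Finset.mul_sum, Finset.sum_add_distrib]
        simp [← Finset.mul_sum]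
        ring
      have s1 : 0 ≤ ∑ i, x (Sum.inl i)^2 := Finset.sum_nonneg fun i _ => sq_nonneg _
      have s2 : 0 ≤ ∑ j, x (Sum.inr j)^2 := Finset.sum_nonneg fun i _ => sq_nonneg _
      have t1 : ε * n ≤ 1 := by rw [← hε1]; gcongr; linarith [(Nat.cast_nonneg m : (0:ℝ) ≤ m)]
      have t2 : ε * m ≤ 1 := by rw [← hε1]; gcongr; linarith [(Nat.cast_nonneg n : (0:ℝ) ≤ n)]
      nlinarith
  · rintro (k | k) <;> simp
  · intro i j; simp

lemma KK_nhds (m n : ℕ) : KK m n ∈ nhds (0 : Fin m → Fin n → ℝ) := by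
  rw [Metric.mem_nhds_iff]
  refine ⟨1/((m:ℝ)+n+1), by positivity, ?_⟩
  intro M hM
  apply KK_small
  intro i j
  rw [mem_ball_zero_iff] at hM
  calc |M i j| ≤ ‖M i‖ := norm_le_pi_norm (M i) j
    _ ≤ ‖M‖ := norm_le_pi_norm M i
    _ ≤ _ := hM.le

lemma KK_abs {m n : ℕ} {M : Fin m → Fin n → ℝ} (h : M ∈ KK m n) (i : Fin m) (j : Fin n) :
    |M i j| ≤ 1 := by
  obtain ⟨Z, hZ, hZd, hZM⟩ := h
  rw [psd_iff] at hZ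
  have key : ∀ s : ℝ, 0 ≤ 1 + s^2 + 2 * s * M i j := by
    intro s
    have := hZ.2 (fun k => (if k = Sum.inl i then 1 else 0) + s * (if k = Sum.inr j then 1 else 0))
    simp only [add_mul, mul_add, Finset.sum_add_distrib, ite_mul, mul_ite, one_mul, mul_one,
      zero_mul, mul_zero, Finset.sum_ite_eq', Finset.mem_univ, if_true, hZd] at this
    rw [hZ.1 (Sum.inr j) (Sum.inl i), hZM] at this
    nlinarith
  have h1 := key 1
  have h2 := key (-1)
  rw [abs_le]; constructor <;> linarith

/-- gauge -/
def NN {m n : ℕ} (M : Fin m → Fin n → ℝ) : ℝ := gauge (KK m n) M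

lemma KK_abs' (m n : ℕ) : Absorbent ℝ (KK m n) := absorbent_nhds_zero (KK_nhds m n)

lemma KK_zero (m n : ℕ) : 0 ∈ KK m n := mem_of_mem_nhds (KK_nhds m n)

lemma NN_nonneg {m n : ℕ} (M : Fin m → Fin n → ℝ) : 0 ≤ NN M := gauge_nonneg M

lemma NN_lt_one {m n : ℕ} {M : Fin m → Fin n → ℝ} (h : NN M < 1) : M ∈ KK m n :=
  setOfPred_gauge_lt_one_subset_self (KK_convex m n) (KK_zero m n) (KK_abs' m n) h

lemma NN_mul {m n : ℕ} (X Y : Fin m → Fin n → ℝ) : NN (X * Y) ≤ NN X * NN Y := by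
  have h : ∀ r s, NN X < r → NN Y < s → NN (X*Y) ≤ r * s := by
    intro r s hr hs
    obtain ⟨r', hr'0, hr', x, hx, hxe⟩ := exists_lt_of_gauge_lt (KK_abs' m n) hr
    obtain ⟨s', hs'0, hs', y, hy, hye⟩ := exists_lt_of_gauge_lt (KK_abs' m n) hs
    have : NN (X*Y) ≤ r' * s' := by
      apply gauge_le_of_mem (by positivity)
      refine ⟨x * y, KK_mul hx hy, ?_⟩
      rw [← hxe, ← hye]
      ext i j
      simp; ring
    exact this.trans (mul_le_mul hr'.le hs'.le hs'0.le (hr'0.trans hr').le)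
  have ht : Filter.Tendsto (fun ε : ℝ => (NN X + ε) * (NN Y + ε)) (nhdsWithin 0 (Ioi 0)) (nhds (NN X * NN Y)) := by
    have : Continuous (fun ε : ℝ => (NN X + ε) * (NN Y + ε)) := by fun_prop
    have := (this.tendsto 0).mono_left (nhdsWithin_le_nhds (s := Ioi (0:ℝ)))
    simpa using this
  apply ge_of_tendsto ht
  filter_upwards [self_mem_nhdsWithin] with ε hε
  have hε : 0 < ε := hε
  exact h _ _ (by linarith) (by linarith)

lemma NN_one_le {m n : ℕ} : NN (1 : Fin m → Fin n → ℝ) ≤ 1 := by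
  apply gauge_le_one_of_mem
  have := Matrix.posSemidef_vecMulVec_self_star (fun _ : Fin m ⊕ Fin n => (1:ℝ))
  refine ⟨_, this, ?_, ?_⟩
  · intro k; simp [Matrix.vecMulVec]
  · intro i j; simp [Matrix.vecMulVec]

lemma NN_pow {m n : ℕ} (X : Fin m → Fin n → ℝ) (k : ℕ) : NN (X^k) ≤ NN X^k := by
  induction k with
  | zero => simpa using NN_one_le
  | succ k ih =>
    rw [pow_succ, pow_succ]
    exact (NN_mul _ _).trans (mul_le_mul_of_nonneg_right ih (NN_nonneg _))

lemma NN_neg {m n : ℕ} (X : Fin m → Fin n → ℝ) : NN (-X) = NN X := gauge_neg KK_neg X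

lemma NN_abs {m n : ℕ} (X : Fin m → Fin n → ℝ) (i : Fin m) (j : Fin n) : |X i j| ≤ NN X := by
  apply le_of_forall_gt
  intro r hr
  obtain ⟨r', hr'0, hr', x, hx, hxe⟩ := exists_lt_of_gauge_lt (KK_abs' m n) hr
  have := KK_abs hx i j
  rw [← hxe]
  simp [abs_mul, abs_of_pos hr'0]
  nlinarith

lemma NN_dual {m n : ℕ} (X : Fin m → Fin n → ℝ) : ∃ L : Fin m → Fin n → ℝ,
    ∑ i, ∑ j, L i j * X i j = NN X ∧ ∀ Y : Fin m → Fin n → ℝ, ∑ i, ∑ j, L i j * Y i j ≤ NN Y := by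
  have hhom : ∀ c : ℝ, 0 ≤ c → ∀ x : Fin m → Fin n → ℝ, NN (c • x) = c * NN x := by
    intro c hc x
    exact gauge_smul_of_nonneg hc x
  suffices h : ∃ g : (Fin m → Fin n → ℝ) →ₗ[ℝ] ℝ, g X = NN X ∧ ∀ Y, g Y ≤ NN Y by
    obtain ⟨g, h1, h2⟩ := h
    have hrep : ∀ Y : Fin m → Fin n → ℝ, ∑ i, ∑ j, g (Pi.single i (Pi.single j 1)) * Y i j = g Y := by
      intro Y
      have : Y = ∑ i, ∑ j, Y i j • (Pi.single i (Pi.single j (1:ℝ)) : Fin m → Fin n → ℝ) := by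
        ext i j
        simp [Finset.sum_apply, Pi.single_apply, apply_ite, ite_apply]
      conv_rhs => rw [this]
      simp only [map_sum, map_smul, smul_eq_mul]
      refine Finset.sum_congr rfl fun k _ => Finset.sum_congr rfl fun l _ => mul_comm _ _
    refine ⟨fun i j => g (Pi.single i (Pi.single j 1)), ?_, ?_⟩
    · rw [hrep, h1]
    · intro Y; rw [hrep]; exact h2 Y
  by_cases hX : X = 0
  · refine ⟨0, ?_, ?_⟩
    · rw [hX]; simp [NN]
    · intro Y; simpa using NN_nonneg Y
  obtain ⟨g, hg1, hg2⟩ := exists_extension_of_le_sublinear (LinearPMap.mkSpanSingleton X (NN X) hX) NN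
    (fun c hc x => hhom c hc.le x) (gauge_add_le (KK_convex m n) (KK_abs' m n)) (by
      rintro ⟨y, hy⟩
      obtain ⟨c, rfl⟩ := Submodule.mem_span_singleton.mp hy
      have he : LinearPMap.mkSpanSingleton X (NN X) hX ⟨c • X, hy⟩ = c * NN X :=
        LinearPMap.mkSpanSingleton'_apply X (NN X) _ c hy
      rw [he]
      rcases le_total 0 c with hc | hc
      · exact (hhom c hc X).ge
      · exact (mul_nonpos_of_nonpos_of_nonneg hc (NN_nonneg X)).trans (NN_nonneg _))
  refine ⟨g, ?_, hg2⟩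
  have := hg1 ⟨X, Submodule.mem_span_singleton_self X⟩
  simp only at this
  rw [this]
  exact LinearPMap.mkSpanSingleton'_apply_self X (NN X) _ _




lemma schur_step {c : ℕ → ℝ} (hc0 : ∀ k, 0 ≤ c k) (hc1 : ∀ N, ∑ k ∈ Finset.range N, c k ≤ 1)
    {m n : ℕ} (T H L : Fin m → Fin n → ℝ) (hT : T ∈ KK m n) (hH : NN H < 1)
    (hL : ∀ Y : Fin m → Fin n → ℝ, ∑ i, ∑ j, L i j * Y i j ≤ NN Y) :
    ∑ i, ∑ j, L i j * T i j * (T i j * (- Psi c (H i j))) ≤ Psi c (NN H) := by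
  have h1 : HasSum (fun k : ℕ => ∑ i, ∑ j, -(L i j * T i j * T i j) * (((k:ℝ)+1) * c k * (H i j)^(2*k+1)))
      (∑ i, ∑ j, -(L i j * T i j * T i j) * Psi c (H i j)) := by
    apply hasSum_sum
    intro i _
    apply hasSum_sum
    intro j _
    apply HasSum.mul_left
    exact (Psi_summable hc0 hc1 _ ((NN_abs H i j).trans_lt hH)).hasSum
  have h2 := (Psi_summable hc0 hc1 (NN H) (by rw [abs_of_nonneg (NN_nonneg H)]; exact hH)).hasSum
  have e : ∑ i, ∑ j, L i j * T i j * (T i j * (- Psi c (H i j))) =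
     ∑ i, ∑ j, -(L i j * T i j * T i j) * Psi c (H i j) := by
    refine Finset.sum_congr rfl fun k _ => Finset.sum_congr rfl fun l _ => ?_
    ring
  rw [e]
  refine hasSum_le ?_ h1 h2
  intro k
  have hT1 : NN T ≤ 1 := gauge_le_one_of_mem hT
  have hb : NN (-(T * T * H^(2*k+1))) ≤ NN H^(2*k+1) := by
    rw [NN_neg]
    calc NN (T * T * H^(2*k+1)) ≤ NN (T*T) * NN (H^(2*k+1)) := NN_mul _ _
      _ ≤ 1 * NN H^(2*k+1) := by
        apply mul_le_mul _ (NN_pow _ _) (NN_nonneg _) (by norm_num)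
        refine (NN_mul _ _).trans ?_
        have := NN_nonneg T
        nlinarith
      _ = _ := one_mul _
  have hl := (hL (-(T * T * H^(2*k+1)))).trans hb
  have hk : 0 ≤ ((k:ℝ)+1) * c k := mul_nonneg (by positivity) (hc0 k)
  have := mul_le_mul_of_nonneg_left hl hk
  refine le_trans (le_of_eq ?_) this
  rw [Finset.mul_sum]
  refine Finset.sum_congr rfl fun i _ => ?_
  rw [Finset.mul_sum]
  refine Finset.sum_congr rfl fun j _ => ?_
  simp
  ring

lemma schur_main {a b : ℝ} {c : ℕ → ℝ} (hc0 : ∀ k, 0 ≤ c k) (hc1 : ∀ N, ∑ k ∈ Finset.range N, c k ≤ 1)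
    (h d : ℝ → ℝ) (h0 : h 0 = 0) (d0 : d 0 = 1) (hh : ∀ x, |x| < 1 → |h x| ≤ |x| ∧ ff a b (h x) = x ∧
     HasDerivAt h (d x) x ∧ HasDerivAt d (- Psi c (h x)) x)
    (C : ℝ) (hC0 : 0 ≤ C) (hC : sinh C < 1) {m n : ℕ} (T : Fin m → Fin n → ℝ) (hT : T ∈ KK m n) :
    NN (fun i j => h (C * T i j)) < 1 := by
  have hC1 : C < 1 := (Real.self_le_sinh_iff.mpr hC0).trans_lt hC
  set τ : ℝ → ℝ := fun t => max 0 (min t C) with hτ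
  have hτ0 : ∀ t, 0 ≤ τ t := fun t => le_max_left _ _
  have hτC : ∀ t, τ t ≤ C := fun t => max_le hC0 (min_le_right _ _)
  have hτid : ∀ t ∈ Icc 0 C, τ t = t := fun t ht => by
    simp only [hτ]; rw [min_eq_left ht.2, max_eq_right ht.1]
  have hτc : Continuous τ := by fun_prop
  have hsT : ∀ s, 0 ≤ s → s ≤ C → ∀ i j, |s * T i j| < 1 := by
    intro s hs0 hs i j
    rw [abs_mul, abs_of_nonneg hs0]
    have := KK_abs hT i j
    have := abs_nonneg (T i j)
    nlinarith
  set nn : ℝ → ℝ := fun t => NN (fun i j => h (τ t * T i j)) with hnn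
  have hcont : Continuous nn := by
    have hg : Continuous (gauge (KK m n)) := continuous_gauge (KK_convex m n) (KK_nhds m n)
    apply hg.comp
    apply continuous_pi; intro i
    apply continuous_pi; intro j
    rw [continuous_iff_continuousAt]
    intro t
    have h1 : ContinuousAt h (τ t * T i j) := (hh _ (hsT _ (hτ0 t) (hτC t) i j)).2.2.1.continuousAt
    have h2 : ContinuousAt (fun t => τ t * T i j) t := (hτc.mul continuous_const).continuousAt
    exact ContinuousAt.comp (f := fun t => τ t * T i j) h1 h2
  have hn00 : nn 0 = 0 := by
    simp only [hnn, hτid 0 ⟨le_refl _, hC0⟩, zero_mul, h0]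
    exact gauge_zero
  have key := scalar_bound hc0 hc1 C hC nn hcont (fun t => NN_nonneg _) hn00 ?_ C ⟨hC0, le_refl _⟩
  · simp only [hnn, hτid C ⟨hC0, le_refl _⟩] at key
    exact key
  intro t ht R R1 hlt hR0 hR10 hR
  obtain ⟨L, hL1, hL2⟩ := NN_dual (fun i j => h (τ t * T i j))
  have hud : ∀ s ∈ Icc 0 t, HasDerivAt (fun s => R s - ∑ i, ∑ j, L i j * h (s * T i j))
      (R1 s - ∑ i, ∑ j, L i j * T i j * d (s * T i j)) s := by
    intro s hs
    apply (hR s hs).1.sub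
    apply HasDerivAt.fun_sum; intro i _
    apply HasDerivAt.fun_sum; intro j _
    have hb := hsT s hs.1 (hs.2.trans ht.2) i j
    have h1 := (hh _ hb).2.2.1
    have h2 : HasDerivAt (fun s => s * T i j) (T i j) s := by
      simpa using (hasDerivAt_id s).mul_const (T i j)
    have := (HasDerivAt.comp s (h := fun s => s * T i j) h1 h2).const_mul (L i j)
    refine HasDerivAt.congr_deriv (f := (fun s => L i j * h (s * T i j))) this ?_
    ring
  have hu1d : ∀ s ∈ Icc 0 t, HasDerivAt (fun s => R1 s - ∑ i, ∑ j, L i j * T i j * d (s * T i j))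
      (Psi c (nn s) - ∑ i, ∑ j, L i j * T i j * (T i j * (- Psi c (h (s * T i j))))) s := by
    intro s hs
    apply (hR s hs).2.sub
    apply HasDerivAt.fun_sum; intro i _
    apply HasDerivAt.fun_sum; intro j _
    have hb := hsT s hs.1 (hs.2.trans ht.2) i j
    have h1 := (hh _ hb).2.2.2
    have h2 : HasDerivAt (fun s => s * T i j) (T i j) s := by
      simpa using (hasDerivAt_id s).mul_const (T i j)
    have := (HasDerivAt.comp s (h := fun s => s * T i j) h1 h2).const_mul (L i j * T i j)
    refine HasDerivAt.congr_deriv (f := (fun s => L i j * T i j * d (s * T i j))) this ?_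
    ring
  have hm1 : MonotoneOn (fun s => R1 s - ∑ i, ∑ j, L i j * T i j * d (s * T i j)) (Icc 0 t) := by
    apply monotoneOn_of_deriv_nonneg (convex_Icc 0 t)
    · exact fun s hs => (hu1d s hs).continuousAt.continuousWithinAt
    · exact fun s hs => (hu1d s (interior_subset hs)).differentiableAt.differentiableWithinAt
    · intro s hs
      have hs := interior_subset hs
      rw [(hu1d s hs).deriv]
      have hlt' := hlt s hs
      have e : nn s = NN (fun i j => h (s * T i j)) := by
        simp only [hnn, hτid s ⟨hs.1, hs.2.trans ht.2⟩]
      rw [e] at hlt' ⊢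
      have := schur_step hc0 hc1 T (fun i j => h (s * T i j)) L hT hlt' hL2
      linarith
  have hw1 : ∀ s ∈ Icc 0 t, 0 ≤ R1 s - ∑ i, ∑ j, L i j * T i j * d (s * T i j) := by
    intro s hs
    have := hm1 (a := 0) ⟨le_refl _, ht.1⟩ hs hs.1
    refine le_trans ?_ this
    simp only [zero_mul, d0, mul_one, hR10]
    have h1 := hL2 T
    have h2 : NN T ≤ 1 := gauge_le_one_of_mem hT
    linarith
  have hm : MonotoneOn (fun s => R s - ∑ i, ∑ j, L i j * h (s * T i j)) (Icc 0 t) := by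
    apply monotoneOn_of_deriv_nonneg (convex_Icc 0 t)
    · exact fun s hs => (hud s hs).continuousAt.continuousWithinAt
    · exact fun s hs => (hud s (interior_subset hs)).differentiableAt.differentiableWithinAt
    · intro s hs
      have hs := interior_subset hs
      rw [(hud s hs).deriv]
      exact hw1 s hs
  have hfin := hm (a := 0) ⟨le_refl _, ht.1⟩ (b := t) ⟨ht.1, le_refl _⟩ ht.1
  simp only [zero_mul, h0, mul_zero, Finset.sum_const_zero, hR0, sub_zero] at hfin
  simp only [hnn]
  rw [← hL1]
  simp only [hτid t ht]
  linarith

/-- Output of parts 1-3. -/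
lemma schur_final {a b : ℝ} (ha0 : 0 ≤ a) (ha1 : a ≤ 1) (hb0 : 0 ≤ b) (hb1 : b ≤ 1)
    (C : ℝ) (hC0 : 0 ≤ C) (hC : sinh C < 1) {m n : ℕ} (T : Fin m → Fin n → ℝ) (hT : T ∈ KK m n) :
    ∃ H ∈ KK m n, ∀ i j, |H i j| < 1 ∧ ff a b (H i j) = C * T i j := by
  obtain ⟨c, hc0, hc1, hc⟩ := kaluza ha0 ha1 hb0 hb1
  obtain ⟨h, d, h0, d0, hh⟩ := scalar_inverse ha0 ha1 hb0 hb1 hc0 hc1 hc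
  have := schur_main hc0 hc1 h d h0 d0 hh C hC0 hC T hT
  have hC1 : C < 1 := (Real.self_le_sinh_iff.mpr hC0).trans_lt hC
  refine ⟨_, NN_lt_one this, fun i j => ?_⟩
  refine ⟨(NN_abs (fun i j => h (C * T i j)) i j).trans_lt this, (hh _ ?_).2.1⟩
  rw [abs_mul, abs_of_nonneg hC0]
  have := KK_abs hT i j
  have := abs_nonneg (T i j)
  nlinarith




lemma summable_poly_geom2 (C r : ℝ) (hr0 : 0 ≤ r) (hr1 : r < 1) :
    Summable (fun k : ℕ => C * (k+1)^2 * (2*k+2) * r^k) := by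
  have hn : ‖r‖ < 1 := by rw [Real.norm_eq_abs, abs_of_nonneg hr0]; exact hr1
  have h0 := summable_pow_mul_geometric_of_norm_lt_one 0 hn
  have h1 := summable_pow_mul_geometric_of_norm_lt_one 1 hn
  have h2 := summable_pow_mul_geometric_of_norm_lt_one 2 hn
  have h3 := summable_pow_mul_geometric_of_norm_lt_one 3 hn
  have := (((h3.mul_left (2*C)).add (h2.mul_left (6*C))).add (h1.mul_left (6*C))).add (h0.mul_left (2*C))
  refine this.congr ?_
  intro k; ring

lemma series2_bound (c : ℕ → ℝ) (C : ℝ) (e : ℕ → ℕ) (he1 : ∀ k, k ≤ e k)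
    (he2 : ∀ k, e k ≤ 2*k+2) (hc : ∀ k, |c k| ≤ C*(k+1)^2) (r : ℝ) (hr0 : 0 < r) (hr2 : r < 1)
    (k : ℕ) (y : ℝ) (hy' : |y| ≤ r) :
    ‖c k * ((e k : ℝ) * y^(e k - 1))‖ ≤ (C * (k+1)^2 * (2*k+2) * r^k) / r := by
  have hC0 : 0 ≤ C := by have := (abs_nonneg _).trans (hc 0); simpa using this
  rw [norm_mul, norm_mul, norm_pow, Real.norm_eq_abs, Real.norm_eq_abs, Real.norm_eq_abs]
  rcases Nat.eq_zero_or_pos (e k) with h0 | hpos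
  · rw [h0]; simp; positivity
  · have h1 : |y|^(e k - 1) ≤ r^k / r := by
      calc |y|^(e k - 1) ≤ r^(e k - 1) := pow_le_pow_left₀ (abs_nonneg y) hy' _
        _ = r^(e k) / r := by
          obtain ⟨j, hj⟩ : ∃ j, e k = j+1 := ⟨e k - 1, by omega⟩
          rw [hj]; simp [pow_succ]; field_simp
        _ ≤ r^k / r := by
          gcongr ?_ / r
          exact pow_le_pow_of_le_one hr0.le hr2.le (he1 k)
    have h2 : |(e k : ℝ)| ≤ 2*k+2 := by
      rw [abs_of_nonneg (Nat.cast_nonneg _)]; exact_mod_cast he2 k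
    calc |c k| * (|(e k : ℝ)| * |y|^(e k - 1)) ≤ (C*(k+1)^2) * ((2*k+2) * (r^k/r)) := by
          apply mul_le_mul (hc k) _ (by positivity) (by positivity)
          apply mul_le_mul h2 h1 (by positivity) (by positivity)
      _ = _ := by ring

lemma hasDerivAt_series2 (c : ℕ → ℝ) (C : ℝ) (e : ℕ → ℕ) (he1 : ∀ k, k ≤ e k)
    (he2 : ∀ k, e k ≤ 2*k+2) (hc : ∀ k, |c k| ≤ C*(k+1)^2) (x : ℝ) (hx : |x| < 1) :
    Summable (fun k => c k * x^(e k)) ∧ Summable (fun k => c k * ((e k : ℝ) * x^(e k - 1))) ∧ 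
    HasDerivAt (fun x => ∑' k, c k * x^(e k)) (∑' k, c k * ((e k : ℝ) * x^(e k - 1))) x := by
  obtain ⟨r, hr1, hr2⟩ := exists_between hx
  have hr0 : 0 < r := (abs_nonneg x).trans_lt hr1
  have hC0 : 0 ≤ C := by have := (abs_nonneg _).trans (hc 0); simpa using this
  have hxr : x ∈ Metric.ball (0:ℝ) r := by simpa using hr1
  have hs : Summable (fun k : ℕ => (C * (k+1)^2 * (2*k+2) * r^k) / r) :=
    (summable_poly_geom2 C r hr0.le hr2).div_const r
  have hsum : ∀ x : ℝ, |x| < 1 → Summable (fun k => c k * x^(e k)) := by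
    intro x hx
    apply summable_series c C e he1 _ x hx
    intro k
    have h1 := hc k
    have : (0:ℝ) ≤ k := Nat.cast_nonneg k
    refine h1.trans ?_
    rw [mul_assoc]
    apply mul_le_mul_of_nonneg_left _ hC0
    nlinarith
  refine ⟨hsum x hx, ?_, ?_⟩
  · apply Summable.of_norm_bounded hs
    intro k
    exact series2_bound c C e he1 he2 hc r hr0 hr2 k x hr1.le
  refine hasDerivAt_tsum_of_isPreconnected (g := fun k x => c k * x^(e k))
    (g' := fun k x => c k * ((e k : ℝ) * x^(e k - 1))) hs Metric.isOpen_ball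
    (convex_ball (0:ℝ) r).isPreconnected ?_ ?_ (Metric.mem_ball_self hr0) (hsum 0 (by simp)) hxr
  · intro k y hy
    exact (hasDerivAt_pow (e k) y).const_mul (c k)
  · intro k y hy
    have hy' : |y| ≤ r := by simpa using (Metric.mem_ball.mp hy).le
    exact series2_bound c C e he1 he2 hc r hr0 hr2 k y hy'

lemma hasSum_unique_of_eq {f g : ℕ → ℝ} {u v : ℝ} (h1 : HasSum f u) (h2 : HasSum g v) (h : ∀ k, f k = g k) : u = v := by
  have : f = g := funext h
  subst this
  exact h1.unique h2

def sc (a b : ℝ) : ℕ → ℝ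
  | 0 => 1
  | (k+1) => sc a b k * ((a+2*(k:ℝ)+2)*(b+2*(k:ℝ)+2)/((2*(k:ℝ)+2)*(2*(k:ℝ)+3)))

lemma sc_bound {a b : ℝ} (ha0 : 0 ≤ a) (ha1 : a ≤ 1) (hb0 : 0 ≤ b) (hb1 : b ≤ 1) (k : ℕ) :
    0 ≤ sc a b k ∧ sc a b k ≤ k+1 := by
  induction k with
  | zero => simp [sc]
  | succ k ih =>
    rw [sc]
    have hk : (0:ℝ) ≤ k := Nat.cast_nonneg k
    obtain ⟨h0, h1⟩ := ih
    refine ⟨by positivity, ?_⟩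
    rw [← mul_div_assoc, div_le_iff₀ (by positivity)]
    push_cast
    have h2 : (a+2*(k:ℝ)+2)*(b+2*(k:ℝ)+2) ≤ (2*k+3)*(2*k+3) := by
      apply mul_le_mul <;> linarith
    calc sc a b k * ((a+2*(k:ℝ)+2)*(b+2*(k:ℝ)+2)) ≤ (k+1) * ((2*k+3)*(2*k+3)) := by
          apply mul_le_mul h1 h2 (by positivity) (by positivity)
      _ ≤ (k+1+1)*((2*k+2)*(2*k+3)) := by nlinarith

/-- S -/
def SS (a b x : ℝ) : ℝ := ∑' k, sc a b k * x^(2*k+1)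
def SS1 (a b x : ℝ) : ℝ := ∑' k : ℕ, ((2*(k:ℝ)+1) * sc a b k) * x^(2*k)
def SS2 (a b x : ℝ) : ℝ := ∑' k : ℕ, ((2*(k:ℝ)+1) * sc a b k) * ((2*k:ℕ) * x^(2*k-1))
def PP (a b x : ℝ) : ℝ := ∑' k : ℕ, pc a b k * x^(2*k)
def PP1 (a b x : ℝ) : ℝ := ∑' k : ℕ, pc a b k * ((2*k:ℕ) * x^(2*k-1))

lemma SS_deriv {a b : ℝ} (ha0 : 0 ≤ a) (ha1 : a ≤ 1) (hb0 : 0 ≤ b) (hb1 : b ≤ 1) (x : ℝ) (hx : |x| < 1) :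
    HasDerivAt (SS a b) (SS1 a b x) x ∧ HasDerivAt (SS1 a b) (SS2 a b x) x ∧
    (1 - x^2) * SS2 a b x = (3+(a+b)) * x * SS1 a b x + (1+(a+b)+a*b) * SS a b x := by
  have hb := fun k => sc_bound ha0 ha1 hb0 hb1 k
  obtain ⟨s0, s1, d1⟩ := hasDerivAt_series2 (sc a b) 1 (fun k => 2*k+1) (fun k => by omega)
    (fun k => by omega) (fun k => by
      rw [abs_of_nonneg (hb k).1]
      have hk : (0:ℝ) ≤ k := Nat.cast_nonneg k
      nlinarith [(hb k).2]) x hx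
  obtain ⟨s2, s3, d2⟩ := hasDerivAt_series2 (fun k => (2*(k:ℝ)+1) * sc a b k) 2 (fun k => 2*k) (fun k => by omega)
    (fun k => by omega) (fun k => by
      have hk : (0:ℝ) ≤ k := Nat.cast_nonneg k
      rw [abs_of_nonneg (mul_nonneg (by positivity) (hb k).1)]
      nlinarith [(hb k).2, (hb k).1]) x hx
  refine ⟨HasDerivAt.congr_deriv (f := SS a b) d1 ?_, d2, ?_⟩
  · refine tsum_congr fun k => ?_
    simp; ring
  · have t0 : HasSum (fun k => sc a b k * x^(2*k+1)) (SS a b x) := s0.hasSum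
    have t1 : HasSum (fun k : ℕ => ((2*(k:ℝ)+1) * sc a b k) * x^(2*k)) (SS1 a b x) := s2.hasSum
    have t2 : HasSum (fun k : ℕ => ((2*(k:ℝ)+1) * sc a b k) * ((2*k:ℕ) * x^(2*k-1))) (SS2 a b x) := s3.hasSum
    have t3 : HasSum (fun k : ℕ => ((2*((k+1:ℕ):ℝ)+1) * sc a b (k+1)) * ((2*(k+1):ℕ) * x^(2*(k+1)-1))) (SS2 a b x) := by
      rw [hasSum_nat_add_iff (f := fun k : ℕ => ((2*(k:ℝ)+1) * sc a b k) * ((2*k:ℕ) * x^(2*k-1)))]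
      simpa using t2
    have t4 := ((t2.mul_left (x^2)).add (t1.mul_left ((3+(a+b)) * x))).add (t0.mul_left (1+(a+b)+a*b))
    have : SS2 a b x = x^2 * SS2 a b x + (3+(a+b)) * x * SS1 a b x + (1+(a+b)+a*b) * SS a b x := by
      refine hasSum_unique_of_eq t3 t4 (fun k => ?_)
      beta_reduce
      have hk : (0:ℝ) ≤ k := Nat.cast_nonneg k
      have e1 : 2*(k+1)-1 = 2*k+1 := by omega
      have e2 : (2*k:ℕ) * x^(2*k-1) * x^2 = (2*k) * x^(2*k+1) := by
        rcases k with _ | k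
        · simp
        · have : 2*(k+1)-1 = 2*k+1 := by omega
          rw [this]; push_cast; ring
      rw [e1, sc]
      have e3 : x^2 * ((2*(k:ℝ)+1) * sc a b k * (((2*k:ℕ):ℝ) * x^(2*k-1))) =
        (2*(k:ℝ)+1) * sc a b k * ((2*k) * x^(2*k+1)) := by rw [← e2]; ring
      rw [e3]
      push_cast
      field_simp
      ring
    linarith

lemma PP_deriv {a b : ℝ} (ha0 : 0 ≤ a) (ha1 : a ≤ 1) (hb0 : 0 ≤ b) (hb1 : b ≤ 1) (x : ℝ) (hx : |x| < 1) :
    HasDerivAt (PP a b) (PP1 a b x) x ∧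
    (1 - x^2) * PP1 a b x = (1-(a+b)) * x * PP a b x + a*b * ff a b x := by
  have s0 := (ff_summable ha0 ha1 hb0 hb1 x hx)
  obtain ⟨s2, s3, d2⟩ := hasDerivAt_series2 (pc a b) 1 (fun k => 2*k) (fun k => by omega)
    (fun k => by omega) (fun k => by
      have hk : (0:ℝ) ≤ k := Nat.cast_nonneg k
      have := pc_coef_bound ha0 ha1 hb0 hb1 k
      nlinarith) x hx
  refine ⟨d2, ?_⟩
  have t0 : HasSum (fun k : ℕ => pc a b k / (2*k+1) * x^(2*k+1)) (ff a b x) := s0.hasSum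
  have t1 : HasSum (fun k : ℕ => pc a b k * x^(2*k)) (PP a b x) := s2.hasSum
  have t2 : HasSum (fun k : ℕ => pc a b k * ((2*k:ℕ) * x^(2*k-1))) (PP1 a b x) := s3.hasSum
  have t3 : HasSum (fun k : ℕ => pc a b (k+1) * ((2*(k+1):ℕ) * x^(2*(k+1)-1))) (PP1 a b x) := by
    rw [hasSum_nat_add_iff (f := fun k : ℕ => pc a b k * ((2*k:ℕ) * x^(2*k-1)))]
    simpa using t2
  have t4 := ((t2.mul_left (x^2)).add (t1.mul_left ((1-(a+b)) * x))).add (t0.mul_left (a*b))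
  have : PP1 a b x = x^2 * PP1 a b x + (1-(a+b)) * x * PP a b x + a*b * ff a b x := by
    refine hasSum_unique_of_eq t3 t4 (fun k => ?_)
    beta_reduce
    have hk : (0:ℝ) ≤ k := Nat.cast_nonneg k
    have e1 : 2*(k+1)-1 = 2*k+1 := by omega
    have e2 : (2*k:ℕ) * x^(2*k-1) * x^2 = (2*k) * x^(2*k+1) := by
      rcases k with _ | k
      · simp
      · have : 2*(k+1)-1 = 2*k+1 := by omega
        rw [this]; push_cast; ring
    rw [e1, pc]
    have e3 : x^2 * (pc a b k * (((2*k:ℕ):ℝ) * x^(2*k-1))) =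
      pc a b k * ((2*k) * x^(2*k+1)) := by rw [← e2]; ring
    rw [e3]
    push_cast
    field_simp
    ring
  linarith

lemma euler_nonneg {a b : ℝ} (ha0 : 0 ≤ a) (ha1 : a ≤ 1) (hb0 : 0 ≤ b) (hb1 : b ≤ 1) (x : ℝ)
    (hx0 : 0 ≤ x) (hx : x < 1) :
    (1-x^2)^((a+b+1)/2) * SS a b x = ff a b x := by
  set ν := (a+b+1)/2 with hν
  have habs : ∀ y ∈ Icc 0 x, |y| < 1 := fun y hy => by rw [abs_of_nonneg hy.1]; linarith [hy.2]
  have hpos : ∀ y ∈ Icc 0 x, 0 < 1 - y^2 := fun y hy => by nlinarith [hy.1, hy.2]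
  set f1 : ℝ → ℝ := fun x => (1-x^2)^ν * SS a b x with hf1
  set p1 : ℝ → ℝ := fun x => (1-x^2)^(ν-1) * ((1-x^2) * SS1 a b x - 2*ν*x*SS a b x) with hp1
  have hsq : ∀ y : ℝ, HasDerivAt (fun y : ℝ => 1 - y^2) (-(2*y)) y := by
    intro y
    have := (hasDerivAt_pow 2 y).const_sub 1
    refine this.congr_deriv (by simp)
  have hsplit : ∀ y ∈ Icc 0 x, ∀ s : ℝ, (1-y^2)^s = (1-y^2)^(s-1) * (1-y^2) := by
    intro y hy s
    rw [Real.rpow_sub_one (hpos y hy).ne']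
    field_simp [(hpos y hy).ne']
  have hf1d : ∀ y ∈ Icc 0 x, HasDerivAt f1 (p1 y) y := by
    intro y hy
    obtain ⟨d1, d2, hS⟩ := SS_deriv ha0 ha1 hb0 hb1 y (habs y hy)
    have := ((hsq y).rpow_const (p := ν) (Or.inl (hpos y hy).ne')).mul d1
    refine HasDerivAt.congr_deriv (f := f1) this ?_
    simp only [hp1]
    rw [hsplit y hy ν]
    ring
  have hp1d : ∀ y ∈ Icc 0 x, HasDerivAt p1 (((1-(a+b)) * y * p1 y + a*b*f1 y)/(1-y^2)) y := by
    intro y hy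
    obtain ⟨d1, d2, hS⟩ := SS_deriv ha0 ha1 hb0 hb1 y (habs y hy)
    have h2 := ((hsq y).mul d2).sub (((hasDerivAt_id y).const_mul (2*ν)).mul d1)
    have := ((hsq y).rpow_const (p := ν-1) (Or.inl (hpos y hy).ne')).mul h2
    refine HasDerivAt.congr_deriv (f := p1) this ?_
    simp only [hp1, hf1]
    have hp := (hpos y hy).ne'
    rw [hsplit y hy ν, hsplit y hy (ν-1)]
    set A := (1-y^2)^(ν-1-1) with hA
    simp only [Pi.sub_apply, Pi.mul_apply, id, mul_one]
    rw [eq_div_iff hp, hS, hν]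
    ring
  set w : ℝ → ℝ × ℝ := fun y => (f1 y - ff a b y, p1 y - PP a b y) with hw
  set w' : ℝ → ℝ × ℝ := fun y => (p1 y - PP a b y,
    ((1-(a+b)) * y * p1 y + a*b*f1 y)/(1-y^2) - PP1 a b y) with hw'
  have hwd : ∀ y ∈ Icc 0 x, HasDerivAt w (w' y) y := by
    intro y hy
    exact ((hf1d y hy).sub (ff_hasDerivAt ha0 ha1 hb0 hb1 y (habs y hy))).prodMk
      ((hp1d y hy).sub (PP_deriv ha0 ha1 hb0 hb1 y (habs y hy)).1)
  have hx2 : 0 < 1 - x^2 := hpos x ⟨hx0, le_refl _⟩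
  have := eq_zero_of_abs_deriv_le_mul_abs_self_of_eq_zero_right (f := w) (f' := w') (K := max 1 (3/(1-x^2))) (a := 0) (b := x)
    (fun y hy => (hwd y hy).continuousAt.continuousWithinAt)
    (fun y hy => (hwd y ⟨hy.1, hy.2.le⟩).hasDerivWithinAt) (by
      simp [hw, hf1, hp1, SS, SS1, ff, PP]
      rw [tsum_eq_single 0 (by intro k hk; simp [hk]), tsum_eq_single 0 (by intro k hk; simp [hk])]
      simp [sc, pc]) (by
      intro y hy
      have hy : y ∈ Icc 0 x := ⟨hy.1, hy.2.le⟩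
      have hp := hpos y hy
      have e : w' y = ((w y).2, ((1-(a+b)) * y * (w y).2 + a*b*(w y).1)/(1-y^2)) := by
        have h2 := (PP_deriv ha0 ha1 hb0 hb1 y (habs y hy)).2
        have : PP1 a b y = ((1-(a+b)) * y * PP a b y + a*b * ff a b y)/(1-y^2) := by
          rw [eq_div_iff hp.ne', ← h2]; ring
        simp only [hw, hw', this]
        congr 1
        ring
      rw [e]
      have n1 : |(w y).1| ≤ ‖w y‖ := norm_fst_le (w y)
      have n2 : |(w y).2| ≤ ‖w y‖ := norm_snd_le (w y)
      rw [Prod.norm_def]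
      apply max_le
      · calc ‖(w y).2‖ ≤ 1 * ‖w y‖ := by rw [one_mul]; exact n2
          _ ≤ _ := by gcongr; exact le_max_left _ _
      · refine le_trans ?_ (mul_le_mul_of_nonneg_right (le_max_right 1 _) (norm_nonneg _))
        simp only [Real.norm_eq_abs]
        rw [abs_div, abs_of_pos hp, div_mul_eq_mul_div]
        have c1 : |(1-(a+b)) * y| ≤ 1 := by
          rw [abs_mul]
          have : |1-(a+b)| ≤ 1 := by rw [abs_le]; constructor <;> linarith
          nlinarith [habs y hy, abs_nonneg y, abs_nonneg (1-(a+b))]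
        have c2 : |a*b| ≤ 1 := by
          rw [abs_of_nonneg (by positivity)]; nlinarith
        apply div_le_div₀ (by positivity) _ hx2 (by nlinarith [hy.1, hy.2])
        calc |(1-(a+b)) * y * (w y).2 + a*b*(w y).1| ≤ |(1-(a+b)) * y| * |(w y).2| + |a*b| * |(w y).1| := by
              rw [← abs_mul, ← abs_mul]; exact abs_add_le _ _
          _ ≤ 1 * ‖w y‖ + 1 * ‖w y‖ := by gcongr
          _ ≤ 3 * ‖w y‖ := by linarith [norm_nonneg (w y)])
  have h3 := congrArg Prod.fst (this x ⟨hx0, le_refl _⟩)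
  simp only [hw, Prod.fst_zero] at h3
  linarith

lemma euler_identity {a b : ℝ} (ha0 : 0 ≤ a) (ha1 : a ≤ 1) (hb0 : 0 ≤ b) (hb1 : b ≤ 1) (x : ℝ)
    (hx : |x| < 1) :
    (1-x^2)^((a+b+1)/2) * SS a b x = ff a b x := by
  rcases le_total 0 x with h0 | h0
  · exact euler_nonneg ha0 ha1 hb0 hb1 x h0 (by rwa [abs_of_nonneg h0] at hx)
  · have := euler_nonneg ha0 ha1 hb0 hb1 (-x) (by linarith) (by rwa [abs_of_nonpos h0] at hx)
    have e1 : SS a b (-x) = - SS a b x := by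
      rw [SS, SS, ← tsum_neg]
      refine tsum_congr fun k => ?_
      rw [Odd.neg_pow ⟨k, rfl⟩]; ring
    have e2 : ff a b (-x) = - ff a b x := by
      rw [ff, ff, ← tsum_neg]
      refine tsum_congr fun k => ?_
      rw [Odd.neg_pow ⟨k, rfl⟩]; ring
    rw [e1, e2, neg_sq] at this
    linarith


def gw (x : ℝ) : ℝ := (Real.sqrt (2 * Real.pi))⁻¹ * Real.exp (-x ^ 2 / 2)
def MM (r : ℝ) : ℝ := ∫ x : ℝ, |x| ^ r * gw x
def sg (a x : ℝ) : ℝ := x / |x| * |x| ^ a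

lemma gw_pos (x : ℝ) : 0 < gw x := by unfold gw; positivity
lemma gw_neg (x : ℝ) : gw (-x) = gw x := by unfold gw; simp
lemma sg_neg (a x : ℝ) : sg a (-x) = - sg a x := by unfold sg; simp [neg_div]
lemma gw_measurable : Measurable gw := by unfold gw; fun_prop
lemma sg_measurable (a : ℝ) : Measurable (sg a) := by unfold sg; fun_prop
lemma sg_abs_le (a x : ℝ) : |sg a x| ≤ |x| ^ a := by
  unfold sg
  rw [abs_mul, abs_div, abs_abs, abs_of_nonneg (Real.rpow_nonneg (abs_nonneg x) a)]
  apply mul_le_of_le_one_left (Real.rpow_nonneg (abs_nonneg x) a)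
  exact div_self_le_one _
lemma sg_mul_self (a x : ℝ) (ha : 0 ≤ a) : sg a x * x = |x| ^ (a+1) := by
  unfold sg
  by_cases hx : x = 0
  · subst hx; simp; rw [Real.zero_rpow (by linarith)]
  have hx' : 0 < |x| := abs_pos.mpr hx
  rw [Real.rpow_add_one hx'.ne']
  field_simp
  rw [sq_abs]
lemma sg_scale (a s x : ℝ) (hs : 0 < s) : sg a (s*x) = s^a * sg a x := by
  unfold sg
  rw [abs_mul, abs_of_pos hs, Real.mul_rpow hs.le (abs_nonneg x), mul_div_mul_left _ _ hs.ne']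
  ring

lemma int_rpow_exp (r c : ℝ) (hr : 0 ≤ r) (hc : 0 < c) :
    Integrable (fun x : ℝ => |x| ^ r * Real.exp (-c * x^2)) := by
  have h := (integrable_rpow_mul_exp_neg_mul_sq hc (s := r) (by linarith))
  have h1 : IntegrableOn (fun x : ℝ => |x| ^ r * Real.exp (-c * x^2)) (Ioi 0) := by
    refine h.integrableOn.congr_fun (fun x hx => ?_) measurableSet_Ioi
    simp only
    rw [abs_of_pos hx]
  have h2 : IntegrableOn (fun x : ℝ => |x| ^ r * Real.exp (-c * x^2)) (Iio 0) := by
    have h3 := h1.comp_neg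
    simpa using h3
  rw [← integrableOn_univ, ← Iio_union_Ici (a := (0:ℝ)), integrableOn_union,
    integrableOn_Ici_iff_integrableOn_Ioi]
  exact ⟨h2, h1⟩

lemma MM_integrable (r : ℝ) (hr : 0 ≤ r) : Integrable (fun x : ℝ => |x| ^ r * gw x) := by
  have := (int_rpow_exp r (1/2) hr (by norm_num)).const_mul (Real.sqrt (2 * Real.pi))⁻¹
  refine this.congr (Filter.Eventually.of_forall fun x => ?_)
  simp only [gw]
  rw [show -(1/2:ℝ) * x^2 = -x^2/2 by ring]; ring

lemma MM_formula (r : ℝ) (hr : 0 ≤ r) :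
    MM r = (Real.sqrt (2 * Real.pi))⁻¹ * (2 * ((1/2:ℝ) ^ (-(r + 1) / 2) * (1 / 2) * Gamma ((r + 1) / 2))) := by
  have h1 := integral_rpow_mul_exp_neg_mul_rpow (p := 2) (q := r) (b := 1/2) (by norm_num) (by linarith) (by norm_num)
  have h2 := integral_comp_abs (f := fun x : ℝ => x ^ r * Real.exp (-(1/2) * x^(2:ℝ)))
  rw [← h1, ← h2, ← integral_const_mul]
  unfold MM
  congr 1
  ext x
  unfold gw
  rw [show |x| ^ (2:ℝ) = x^2 by norm_cast; exact sq_abs x]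
  rw [show -(1/2:ℝ) * x^2 = -x^2/2 by ring]; ring

lemma MM_pos (r : ℝ) (hr : 0 ≤ r) : 0 < MM r := by
  rw [MM_formula r hr]
  have := Real.Gamma_pos_of_pos (s := (r+1)/2) (by linarith)
  positivity

lemma MM_rec (r : ℝ) (hr : 0 ≤ r) : MM (r+2) = (r+1) * MM r := by
  rw [MM_formula r hr, MM_formula (r+2) (by linarith)]
  rw [show (r+2+1)/2 = (r+1)/2 + 1 by ring, Real.Gamma_add_one (by positivity)]
  rw [show -(r+2+1)/2 = -(r+1)/2 - 1 by ring, Real.rpow_sub_one (by norm_num)]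
  ring

lemma MM_zero : MM 0 = 1 := by
  rw [MM_formula 0 le_rfl]
  simp only [zero_add]
  rw [Real.Gamma_one_half_eq]
  rw [show (-1/2:ℝ) = -(1/2) by ring, Real.rpow_neg (by norm_num), ← Real.sqrt_eq_rpow]
  rw [Real.sqrt_mul (by norm_num)]
  have h2 : Real.sqrt (1/2) = (Real.sqrt 2)⁻¹ := by simp
  rw [h2]
  have : Real.sqrt 2 ≠ 0 := by positivity
  have : Real.sqrt Real.pi ≠ 0 := by positivity
  field_simp

/-- odd/even moment integrals -/
lemma sg_pow_odd (a : ℝ) (ha : 0 ≤ a) (j : ℕ) (x : ℝ) : sg a x * x^(2*j+1) = |x|^(a + ((2*j+1 : ℕ):ℝ)) := by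
  rw [pow_succ, pow_mul, ← sq_abs, ← pow_mul, mul_comm (|x|^(2*j)), ← mul_assoc, sg_mul_self a x ha]
  rw [← Real.rpow_natCast, ← Real.rpow_add_of_nonneg (abs_nonneg x) (by linarith) (by positivity)]
  congr 1
  push_cast
  ring

lemma abs_sg_pow (a : ℝ) (ha : 0 ≤ a) (k : ℕ) (x : ℝ) : |sg a x * x^k| ≤ |x|^(a + (k:ℝ)) := by
  rw [abs_mul, abs_pow, Real.rpow_add_of_nonneg (abs_nonneg x) ha (by positivity), Real.rpow_natCast]
  exact mul_le_mul_of_nonneg_right (sg_abs_le a x) (by positivity)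

def GG (a : ℝ) (k : ℕ) (x : ℝ) : ℝ := sg a x * x^k * gw x

lemma GG_measurable (a : ℝ) (k : ℕ) : Measurable (GG a k) := by
  unfold GG
  exact ((sg_measurable a).mul (by fun_prop)).mul gw_measurable

lemma GG_abs (a : ℝ) (ha : 0 ≤ a) (k : ℕ) (x : ℝ) : |GG a k x| ≤ |x|^(a + (k:ℝ)) * gw x := by
  unfold GG
  rw [abs_mul, abs_of_pos (gw_pos x)]
  exact mul_le_mul_of_nonneg_right (abs_sg_pow a ha k x) (gw_pos x).le

lemma GG_integrable (a : ℝ) (ha : 0 ≤ a) (k : ℕ) : Integrable (GG a k) :=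
  (MM_integrable (a + k) (by positivity)).mono' (GG_measurable a k).aestronglyMeasurable
    (Filter.Eventually.of_forall fun x => GG_abs a ha k x)

lemma GG_norm (a : ℝ) (ha : 0 ≤ a) (k : ℕ) : ∫ x, |GG a k x| ≤ MM (a+k) :=
  integral_mono (GG_integrable a ha k).abs (MM_integrable (a+k) (by positivity)) (fun x => GG_abs a ha k x)

lemma GG_odd (a : ℝ) (ha : 0 ≤ a) (j : ℕ) : ∫ x, GG a (2*j+1) x = MM (a+(2*j+1:ℕ)) := by
  unfold MM
  congr 1; ext x
  unfold GG
  rw [sg_pow_odd a ha]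

lemma GG_even (a : ℝ) (j : ℕ) : ∫ x, GG a (2*j) x = 0 := by
  have h := integral_neg_eq_self (GG a (2*j)) volume
  have h2 : ∀ x, GG a (2*j) (-x) = - GG a (2*j) x := by
    intro x
    unfold GG
    rw [sg_neg, gw_neg, pow_mul, neg_sq, ← pow_mul]; ring
  simp_rw [h2] at h
  rw [integral_neg] at h
  linarith

lemma vk_bound (a b : ℝ) (ha0 : 0 ≤ a) (ha1 : a ≤ 1) (hb0 : 0 ≤ b) (hb1 : b ≤ 1) :
    ∃ C, 0 ≤ C ∧ ∀ k : ℕ, MM (a+k) * MM (b+k) / (k.factorial) ≤ C * (k+1) := by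
  refine ⟨MM a * MM b + MM (a+1) * MM (b+1), ?_, ?_⟩
  · have := MM_pos a ha0
    have := MM_pos b hb0
    have := MM_pos (a+1) (by linarith)
    have := MM_pos (b+1) (by linarith)
    positivity
  set C := MM a * MM b + MM (a+1) * MM (b+1) with hC
  have p1 := mul_pos (MM_pos a ha0) (MM_pos b hb0)
  have p2 := mul_pos (MM_pos (a+1) (by linarith)) (MM_pos (b+1) (by linarith))
  intro k
  induction k using Nat.twoStepInduction with
  | zero => simp; linarith
  | one => simp; nlinarith
  | more k ih _ =>
    have hk : (0:ℝ) ≤ k := Nat.cast_nonneg k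
    have e1 : MM (a + ((k+2:ℕ):ℝ)) = (a+k+1) * MM (a+k) := by
      rw [← MM_rec _ (by positivity)]; congr 1; push_cast; ring
    have e2 : MM (b + ((k+2:ℕ):ℝ)) = (b+k+1) * MM (b+k) := by
      rw [← MM_rec _ (by positivity)]; congr 1; push_cast; ring
    rw [e1, e2, Nat.factorial_succ, Nat.factorial_succ]
    have hf : (0:ℝ) < k.factorial := by positivity
    have q1 := MM_pos (a+k) (by positivity)
    have q2 := MM_pos (b+k) (by positivity)
    have : (a+k+1) * MM (a+k) * ((b+k+1) * MM (b+k)) / (((k+1+1) * ((k+1) * k.factorial) : ℕ):ℝ)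
      = (MM (a+k) * MM (b+k) / k.factorial) * (((a+k+1)*(b+k+1))/((k+2)*(k+1))) := by
      push_cast
      field_simp
      ring
    rw [this]
    push_cast
    have h3 : ((a+k+1)*(b+k+1))/(((k:ℝ)+2)*(k+1)) ≤ (k+2)/(k+1) := by
      rw [div_le_div_iff₀ (by positivity) (by positivity)]
      have : (a+k+1)*(b+k+1) ≤ (k+2)*(k+2) := by apply mul_le_mul <;> linarith
      nlinarith [mul_le_mul_of_nonneg_right this (by linarith : (0:ℝ) ≤ k+1)]
    calc _ ≤ (C * (k+1)) * ((k+2)/(k+1)) := by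
          apply mul_le_mul ih h3 (by positivity)
          have : 0 ≤ C := by rw [hC]; linarith
          positivity
      _ = C * (k+2) := by field_simp
      _ ≤ _ := by
        have : 0 ≤ C := by rw [hC]; linarith
        nlinarith

lemma vk_sc (a b : ℝ) (ha0 : 0 ≤ a) (hb0 : 0 ≤ b) (k : ℕ) :
    MM (a+(2*k+1:ℕ)) * MM (b+(2*k+1:ℕ)) / ((2*k+1).factorial) = MM (a+1) * MM (b+1) * sc a b k := by
  induction k with
  | zero => simp [sc]
  | succ k ih =>
    have e1 : MM (a + ((2*(k+1)+1:ℕ):ℝ)) = (a+2*k+2) * MM (a+(2*k+1:ℕ)) := by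
      rw [show a+2*(k:ℝ)+2 = a + (2*k+1:ℕ) + 1 by push_cast; ring, ← MM_rec _ (by positivity)]; congr 1; push_cast; ring
    have e2 : MM (b + ((2*(k+1)+1:ℕ):ℝ)) = (b+2*k+2) * MM (b+(2*k+1:ℕ)) := by
      rw [show b+2*(k:ℝ)+2 = b + (2*k+1:ℕ) + 1 by push_cast; ring, ← MM_rec _ (by positivity)]; congr 1; push_cast; ring
    rw [e1, e2, show 2*(k+1)+1 = (2*k+1)+1+1 by ring, Nat.factorial_succ, Nat.factorial_succ, sc, ← mul_assoc (MM (a+1) * MM (b+1)), ← ih]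
    have hf : (0:ℝ) < (2*k+1).factorial := by positivity
    generalize MM (a+(2*k+1:ℕ)) = u
    generalize MM (b+(2*k+1:ℕ)) = v
    push_cast
    field_simp
    ring

lemma double_series {a b : ℝ} (ha0 : 0 ≤ a) (ha1 : a ≤ 1) (hb0 : 0 ≤ b) (hb1 : b ≤ 1) (ρ : ℝ) (hρ : |ρ| < 1) :
    ∫ z : ℝ × ℝ, (sg a z.1 * gw z.1) * (sg b z.2 * gw z.2) * Real.exp (ρ * z.1 * z.2)
      = MM (a+1) * MM (b+1) * SS a b ρ := by
  set F : ℕ → ℝ × ℝ → ℝ := fun k z => (GG a k z.1 * GG b k z.2) * (ρ^k / k.factorial) with hF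
  obtain ⟨C, hC0, hC⟩ := vk_bound a b ha0 ha1 hb0 hb1
  have hFi : ∀ k, Integrable (F k) := by
    intro k
    exact ((GG_integrable a ha0 k).mul_prod (GG_integrable b hb0 k)).mul_const _
  have hFn : ∀ k, ∫ z, ‖F k z‖ ≤ C * (((k:ℝ)+1) * |ρ|^k) := by
    intro k
    have e : ∀ z, ‖F k z‖ = (|GG a k z.1| * |GG b k z.2|) * (|ρ|^k / k.factorial) := by
      intro z
      simp only [hF, Real.norm_eq_abs, abs_mul, abs_div, abs_pow, Nat.abs_cast]
    simp_rw [e]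
    rw [integral_mul_const]
    have e2 : ∫ z : ℝ × ℝ, |GG a k z.1| * |GG b k z.2| = (∫ x, |GG a k x|) * ∫ y, |GG b k y| :=
      integral_prod_mul (μ := (volume : Measure ℝ)) (ν := (volume : Measure ℝ)) (fun x => |GG a k x|) (fun x => |GG b k x|)
    rw [e2]
    calc _ ≤ (MM (a+k) * MM (b+k)) * (|ρ|^k / k.factorial) := by
          apply mul_le_mul_of_nonneg_right _ (by positivity)
          apply mul_le_mul (GG_norm a ha0 k) (GG_norm b hb0 k) (integral_nonneg fun x => abs_nonneg _)
          exact (MM_pos _ (by positivity)).le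
      _ = (MM (a+k) * MM (b+k)/ k.factorial) * |ρ|^k := by ring
      _ ≤ (C * (k+1)) * |ρ|^k := by
          apply mul_le_mul_of_nonneg_right (hC k) (by positivity)
      _ = _ := by ring
  have hs : Summable (fun k => ∫ z, ‖F k z‖) := by
    refine Summable.of_nonneg_of_le (fun k => integral_nonneg fun z => norm_nonneg _) hFn ?_
    apply Summable.mul_left
    have h1 : Summable (fun k : ℕ => (k:ℝ)^1 * |ρ|^k) :=
      summable_pow_mul_geometric_of_norm_lt_one 1 (by simpa using hρ)
    have h2 : Summable (fun k : ℕ => |ρ|^k) := summable_geometric_of_lt_one (abs_nonneg _) hρ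
    refine (h1.add h2).congr (fun k => by ring)
  have key := hasSum_integral_of_summable_integral_norm hFi hs
  have eF : ∀ k, ∫ z, F k z = ((∫ x, GG a k x) * ∫ y, GG b k y) * (ρ^k / k.factorial) := by
    intro k
    simp only [hF]
    rw [integral_mul_const]
    congr 1
    exact integral_prod_mul (μ := (volume : Measure ℝ)) (ν := (volume : Measure ℝ)) (GG a k) (GG b k)
  have eS : ∀ z : ℝ × ℝ, ∑' k, F k z = (sg a z.1 * gw z.1) * (sg b z.2 * gw z.2) * Real.exp (ρ * z.1 * z.2) := by
    intro z
    rw [Real.exp_eq_exp_ℝ, NormedSpace.exp_eq_tsum_div, ← tsum_mul_left]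
    refine tsum_congr fun k => ?_
    simp only [hF, GG]
    rw [mul_pow, mul_pow]
    ring
  simp_rw [eS] at key
  have hinj : Function.Injective (fun k : ℕ => 2*k+1) := fun x y h => by simpa using h
  have h3 := (hinj.hasSum_iff (f := fun k => ∫ z, F k z) (a := ∫ z : ℝ × ℝ, (sg a z.1 * gw z.1) * (sg b z.2 * gw z.2) * Real.exp (ρ * z.1 * z.2)) (by
    intro k hk
    have : Even k := by
      by_contra h
      rw [Nat.not_even_iff_odd] at h
      obtain ⟨j, hj⟩ := h
      exact hk ⟨j, hj.symm⟩
    obtain ⟨j, hj⟩ := this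
    rw [eF, show k = 2*j by omega, GG_even]
    simp)).mpr key
  have h4 : Summable (fun k => sc a b k * ρ^(2*k+1)) := by
    have := h3.summable.mul_left (MM (a+1) * MM (b+1))⁻¹
    refine this.congr fun k => ?_
    simp only [Function.comp]
    rw [eF, GG_odd a ha0, GG_odd b hb0, mul_div_assoc', mul_div_right_comm, vk_sc a b ha0 hb0]
    have := MM_pos (a+1) (by linarith)
    have := MM_pos (b+1) (by linarith)
    field_simp
  have h5 := h4.hasSum.mul_left (MM (a+1) * MM (b+1))
  refine hasSum_unique_of_eq h3 h5 fun k => ?_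
  simp only [Function.comp]
  rw [eF, GG_odd a ha0, GG_odd b hb0, mul_div_assoc', mul_div_right_comm, vk_sc a b ha0 hb0]
  ring


lemma total_integrable {a b : ℝ} (ha0 : 0 ≤ a) (hb0 : 0 ≤ b) (ρ : ℝ) (hρ : |ρ| < 1) :
    Integrable (fun z : ℝ × ℝ => (sg a z.1 * gw z.1) * (sg b z.2 * gw z.2) * Real.exp (ρ * z.1 * z.2)) := by
  set c := (1-|ρ|)/2 with hc
  have hc0 : 0 < c := by rw [hc]; linarith
  have h1 := ((int_rpow_exp a c ha0 hc0).mul_prod (int_rpow_exp b c hb0 hc0)).const_mul ((Real.sqrt (2 * Real.pi))⁻¹ * (Real.sqrt (2 * Real.pi))⁻¹)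
  refine Integrable.mono' h1 ?_ (Filter.Eventually.of_forall fun z => ?_)
  · apply Measurable.aestronglyMeasurable
    have m1 := sg_measurable a
    have m2 := sg_measurable b
    have m3 := gw_measurable
    fun_prop
  · rw [Real.norm_eq_abs, abs_mul, abs_mul, abs_mul, abs_mul, abs_of_pos (gw_pos _), abs_of_pos (gw_pos _), abs_of_pos (Real.exp_pos _)]
    have e1 := sg_abs_le a z.1
    have e2 := sg_abs_le b z.2
    have e3 : gw z.1 * gw z.2 * Real.exp (ρ * z.1 * z.2) ≤ ((Real.sqrt (2 * Real.pi))⁻¹ * (Real.sqrt (2 * Real.pi))⁻¹) * (Real.exp (-c * z.1^2) * Real.exp (-c * z.2^2)) := by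
      unfold gw
      have : (√(2 * π))⁻¹ * rexp (-z.1 ^ 2 / 2) * ((√(2 * π))⁻¹ * rexp (-z.2 ^ 2 / 2)) * rexp (ρ * z.1 * z.2)
       = ((√(2 * π))⁻¹ * (√(2 * π))⁻¹) * rexp (-z.1 ^ 2 / 2 + -z.2 ^ 2 / 2 + ρ * z.1 * z.2) := by
        rw [Real.exp_add, Real.exp_add]; ring
      rw [this, ← Real.exp_add]
      apply mul_le_mul_of_nonneg_left _ (by positivity)
      apply Real.exp_le_exp.mpr
      have h5 : ρ * z.1 * z.2 ≤ |ρ| * ((z.1^2 + z.2^2)/2) := by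
        calc ρ * z.1 * z.2 ≤ |ρ * (z.1 * z.2)| := by rw [mul_assoc]; exact le_abs_self _
          _ = |ρ| * |z.1 * z.2| := abs_mul _ _
          _ ≤ _ := by
            apply mul_le_mul_of_nonneg_left _ (abs_nonneg _)
            rw [abs_le]; constructor <;> nlinarith [sq_nonneg (z.1+z.2), sq_nonneg (z.1-z.2)]
      rw [hc]; nlinarith
    have g1 := (gw_pos z.1).le
    have g2 := (gw_pos z.2).le
    calc |sg a z.1| * gw z.1 * (|sg b z.2| * gw z.2) * Real.exp (ρ * z.1 * z.2)
        = (|sg a z.1| * |sg b z.2|) * (gw z.1 * gw z.2 * Real.exp (ρ * z.1 * z.2)) := by ring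
      _ ≤ (|z.1|^a * |z.2|^b) * (((Real.sqrt (2 * Real.pi))⁻¹ * (Real.sqrt (2 * Real.pi))⁻¹) * (Real.exp (-c * z.1^2) * Real.exp (-c * z.2^2))) := by
        apply mul_le_mul _ e3 (by positivity) (by positivity)
        apply mul_le_mul e1 e2 (by positivity) (by positivity)
      _ = _ := by ring

open ProbabilityTheory in
lemma gauss_iter {a b : ℝ} (ha0 : 0 ≤ a) (ha1 : a ≤ 1) (hb0 : 0 ≤ b) (hb1 : b ≤ 1) (ρ : ℝ) (hρ : |ρ| < 1)
    (v : NNReal) (hv : (v:ℝ) = 1 - ρ^2) :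
    ∫ x, (∫ y, sg a x * sg b (ρ * x + y) ∂(gaussianReal 0 v)) ∂(gaussianReal 0 1)
      = MM (a+1) * MM (b+1) * ff a b ρ := by
  have hρ2 : ρ^2 < 1 := by rw [← sq_abs]; nlinarith [abs_nonneg ρ]
  have hvpos : (0:ℝ) < v := by rw [hv]; linarith
  have hv0 : v ≠ 0 := by intro h; rw [h] at hvpos; simp at hvpos
  set σ := Real.sqrt (1-ρ^2) with hσ
  have hσ2 : σ^2 = 1 - ρ^2 := Real.sq_sqrt (by linarith)
  have hσ0 : 0 < σ := Real.sqrt_pos.mpr (by linarith)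
  have inner : ∀ x, ∫ y, sg a x * sg b (ρ * x + y) ∂(gaussianReal 0 v)
      = sg a x * ∫ y, gaussianPDFReal (ρ * x) v y * sg b y := by
    intro x
    rw [integral_const_mul]
    congr 1
    have := integral_map (μ := gaussianReal 0 v) (φ := fun y => ρ * x + y) (f := sg b) (by fun_prop) (sg_measurable b).aestronglyMeasurable
    rw [← this, gaussianReal_map_const_add, integral_gaussianReal_eq_integral_smul hv0]
    simp
  simp_rw [inner]
  rw [integral_gaussianReal_eq_integral_smul one_ne_zero]
  -- scaling
  have sc1 : ∀ f : ℝ → ℝ, ∫ x, f x = σ * ∫ x, f (σ * x) := by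
    intro f
    rw [Measure.integral_comp_mul_left, abs_of_pos (by positivity), smul_eq_mul]
    field_simp
  rw [sc1]
  have : ∀ x, ∫ y, gaussianPDFReal (ρ * (σ * x)) v y * sg b y = σ * ∫ y, gaussianPDFReal (ρ * (σ * x)) v (σ*y) * sg b (σ*y) :=
    fun x => sc1 _
  simp_rw [this]
  have pt : ∀ x, gaussianPDFReal 0 1 (σ * x) • (sg a (σ * x) * (σ * ∫ y, gaussianPDFReal (ρ * (σ * x)) v (σ*y) * sg b (σ*y)))
     = (σ^a * σ^b) * ∫ y, (sg a x * gw x) * (sg b y * gw y) * Real.exp (ρ * x * y) := by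
    intro x
    rw [← integral_const_mul, ← integral_const_mul, smul_eq_mul, ← integral_const_mul, ← integral_const_mul]
    congr 1
    ext y
    rw [sg_scale a σ x hσ0, sg_scale b σ y hσ0]
    unfold gaussianPDFReal gw
    rw [hv, ← hσ2]
    have r1 : Real.sqrt (2 * π * σ^2) = Real.sqrt (2*π) * σ := by
      rw [Real.sqrt_mul (by positivity), Real.sqrt_sq hσ0.le]
    rw [r1]
    have r2 : rexp (-(σ * x - 0) ^ 2 / (2 * ((1:NNReal):ℝ))) * rexp (-(σ * y - ρ * (σ * x)) ^ 2 / (2 * σ ^ 2))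
      = rexp (-x^2/2) * rexp (-y^2/2) * rexp (ρ * x * y) := by
      rw [← Real.exp_add, ← Real.exp_add, ← Real.exp_add]
      congr 1
      have : -(σ * y - ρ * (σ * x)) ^ 2 / (2 * σ ^ 2) = -(y-ρ*x)^2/2 := by
        field_simp
      rw [this]
      have : -(σ * x - 0) ^ 2 / (2 * ((1:NNReal):ℝ)) = - (σ^2 * x^2)/2 := by simp; ring
      rw [this, hσ2]; ring
    simp only [NNReal.coe_one, mul_one] at r2 ⊢
    have : (√(2 * π))⁻¹ * rexp (-(σ * x - 0) ^ 2 / 2) * (σ ^ a * sg a x * (σ * ((√(2 * π) * σ)⁻¹ * rexp (-(σ * y - ρ * (σ * x)) ^ 2 / (2 * σ ^ 2)) * (σ ^ b * sg b y))))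
      = (√(2 * π))⁻¹ * (√(2 * π))⁻¹ * σ^a * σ^b * sg a x * sg b y * (rexp (-(σ * x - 0) ^ 2 / 2) * rexp (-(σ * y - ρ * (σ * x)) ^ 2 / (2 * σ ^ 2))) := by
      field_simp
    rw [this, r2]; ring
  simp_rw [pt]
  rw [integral_const_mul]
  have hI := total_integrable ha0 hb0 ρ hρ
  have hp := integral_prod _ hI
  simp only at hp
  rw [← hp]
  have ds := double_series ha0 ha1 hb0 hb1 ρ hρ
  rw [show (volume : Measure ℝ).prod volume = (volume : Measure (ℝ×ℝ)) from rfl, ds, ← euler_identity ha0 ha1 hb0 hb1 ρ hρ]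
  have : σ * (σ^a * σ^b) = (1-ρ^2)^((a+b+1)/2) := by
    rw [hσ, Real.sqrt_eq_rpow]
    have h0 : 0 < 1 - ρ^2 := by linarith
    rw [← Real.rpow_mul h0.le, ← Real.rpow_mul h0.le, ← Real.rpow_add h0, ← Real.rpow_add h0]
    congr 1; ring
  rw [← this]; ring


open ProbabilityTheory in
lemma gaussianReal_moment (r : ℝ) : ∫ x, |x|^r ∂(gaussianReal 0 1) = MM r := by
  rw [integral_gaussianReal_eq_integral_smul one_ne_zero]
  unfold MM
  congr 1; ext x
  simp [gaussianPDFReal, gw]; ring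

open ProbabilityTheory in
lemma gaussianReal_int (r : ℝ) (hr0 : 0 ≤ r) : Integrable (fun x : ℝ => |x|^r) (gaussianReal 0 1) := by
  apply Integrable.of_integral_ne_zero
  rw [gaussianReal_moment]
  exact (MM_pos r hr0).ne'

open ProbabilityTheory in
lemma gauss_exp {ι : Type} [Fintype ι] [DecidableEq ι] {a b : ℝ} (ha0 : 0 ≤ a) (ha1 : a ≤ 1) (hb0 : 0 ≤ b) (hb1 : b ≤ 1)
    (Z : Matrix ι ι ℝ) (hZ : Z.PosSemidef) (hd : ∀ i, Z i i = 1) (k l : ι) (hρ : |Z k l| < 1) :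
    Integrable (fun x : EuclideanSpace ℝ ι => sg a (x k) * sg b (x l)) (multivariateGaussian 0 Z) ∧
    ∫ x, sg a (x k) * sg b (x l) ∂(multivariateGaussian 0 Z) = MM (a+1) * MM (b+1) * ff a b (Z k l) := by
  set P := multivariateGaussian (0 : EuclideanSpace ℝ ι) Z with hP
  set ρ := Z k l with hρd
  have hev : ∀ i, MeasurePreserving (fun x : EuclideanSpace ℝ ι => x i) P (gaussianReal 0 1) := by
    intro i
    have := measurePreserving_eval_multivariateGaussian (μ := (0 : EuclideanSpace ℝ ι)) hZ (i := i)
    rw [hd i] at this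
    simpa using this
  -- square integrability
  have hL2 : ∀ i (r : ℝ), 0 ≤ r → MemLp (fun x : EuclideanSpace ℝ ι => sg r (x i)) 2 P := by
    intro i r hr
    have hm : AEStronglyMeasurable (sg r) (gaussianReal 0 1) := (sg_measurable r).aestronglyMeasurable
    have : MemLp (sg r) 2 (gaussianReal 0 1) := by
      rw [memLp_two_iff_integrable_sq hm]
      refine (gaussianReal_int (2*r) (by linarith)).mono' (hm.pow 2) (Filter.Eventually.of_forall fun x => ?_)
      simp only [Pi.pow_apply, norm_pow, Real.norm_eq_abs]
      rw [mul_comm, Real.rpow_mul (abs_nonneg x)]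
      norm_cast
      exact pow_le_pow_left₀ (abs_nonneg _) (sg_abs_le r x) 2
    exact this.comp_measurePreserving (hev i)
  have hInt : Integrable (fun x : EuclideanSpace ℝ ι => sg a (x k) * sg b (x l)) P :=
    (hL2 k a ha0).integrable_mul (hL2 l b hb0)
  refine ⟨hInt, ?_⟩
  let X : EuclideanSpace ℝ ι →L[ℝ] ℝ := EuclideanSpace.proj k
  let Y : EuclideanSpace ℝ ι →L[ℝ] ℝ := EuclideanSpace.proj l
  let W : EuclideanSpace ℝ ι →L[ℝ] ℝ := Y - ρ • X
  have hXe : ∀ x, X x = x k := fun x => rfl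
  have hYe : ∀ x, Y x = x l := fun x => rfl
  have hWe : ∀ x, W x = x l - ρ * x k := fun x => rfl
  have hid : HasGaussianLaw (id : EuclideanSpace ℝ ι → _) P := IsGaussian.hasGaussianLaw_id
  have hXW : HasGaussianLaw (fun x => (X x, W x)) P := hid.map (X.prod W)
  have hX : HasGaussianLaw (X : EuclideanSpace ℝ ι → ℝ) P := hid.map X
  have hY : HasGaussianLaw (Y : EuclideanSpace ℝ ι → ℝ) P := hid.map Y
  have hW : HasGaussianLaw (W : EuclideanSpace ℝ ι → ℝ) P := hid.map W
  have cXY : cov[X, Y; P] = ρ := covariance_eval_multivariateGaussian hZ k l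
  have cXX : cov[X, X; P] = 1 := by rw [← hd k]; exact covariance_eval_multivariateGaussian hZ k k
  have cYY : cov[Y, Y; P] = 1 := by rw [← hd l]; exact covariance_eval_multivariateGaussian hZ l l
  have hWf : (W : EuclideanSpace ℝ ι → ℝ) = (Y : EuclideanSpace ℝ ι → ℝ) - ρ • (X : EuclideanSpace ℝ ι → ℝ) := rfl
  have hsX : MemLp (ρ • (X : EuclideanSpace ℝ ι → ℝ)) 2 P := hX.memLp_two.const_smul ρ
  have cXW : cov[X, W; P] = 0 := by
    rw [hWf, covariance_sub_right hX.memLp_two hY.memLp_two hsX, covariance_smul_right, cXY, cXX]; simp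
  have cWW : Var[W; P] = 1 - ρ^2 := by
    rw [← covariance_self hW.aemeasurable]
    nth_rewrite 1 [hWf]
    rw [covariance_sub_left hY.memLp_two hsX hW.memLp_two, covariance_smul_left, cXW]
    rw [hWf, covariance_sub_right hY.memLp_two hY.memLp_two hsX, covariance_smul_right, covariance_comm, cYY, covariance_comm, cXY]
    simp; ring
  have mW : P[W] = 0 := by
    have := W.integral_comp_id_comm (μ := P) IsGaussian.integrable_id
    rw [hP, integral_id_multivariateGaussian] at this
    simpa using this
  have hind : IndepFun X W P := hXW.indepFun_of_covariance_eq_zero cXW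
  have hmapW : P.map W = gaussianReal 0 (1-ρ^2).toNNReal := by
    rw [hW.map_eq_gaussianReal, mW, cWW]
  have hmapX : P.map X = gaussianReal 0 1 := (hev k).map_eq
  rw [indepFun_iff_map_prod_eq_prod_map_map hX.aemeasurable hW.aemeasurable, hmapX, hmapW] at hind
  have hmeas : Measurable (fun z : ℝ × ℝ => sg a z.1 * sg b (ρ * z.1 + z.2)) := by
    have m1 := sg_measurable a
    have m2 := sg_measurable b
    fun_prop
  have heq : ∀ x : EuclideanSpace ℝ ι, sg a (x k) * sg b (x l) = (fun z : ℝ × ℝ => sg a z.1 * sg b (ρ * z.1 + z.2)) (X x, W x) := by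
    intro x
    simp only [hXe, hWe]
    congr 2; ring
  simp_rw [heq] at hInt ⊢
  rw [← integral_map (f := fun z : ℝ × ℝ => sg a z.1 * sg b (ρ * z.1 + z.2)) (φ := fun x => (X x, W x)) hXW.aemeasurable hmeas.aestronglyMeasurable, hind]
  have hI2 := (integrable_map_measure (f := fun x => (X x, W x)) (g := fun z : ℝ × ℝ => sg a z.1 * sg b (ρ * z.1 + z.2)) hmeas.aestronglyMeasurable hXW.aemeasurable).mpr hInt
  rw [hind] at hI2
  rw [integral_prod _ hI2]
  have hρ2 : ρ^2 < 1 := by rw [← sq_abs]; nlinarith [abs_nonneg ρ]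
  exact gauss_iter ha0 ha1 hb0 hb1 ρ hρ _ (Real.coe_toNNReal _ (by linarith))


lemma gaussNorm_eq (r : ℝ) : gaussNorm r = (MM r)^(1/r) := rfl

lemma lpnorm_nonneg (r : ℝ) {d : ℕ} (x : Fin d → ℝ) : 0 ≤ lpnorm r x := by
  unfold lpnorm; positivity

lemma abs_le_lpnorm (r : ℝ) (hr : 1 ≤ r) {d : ℕ} (x : Fin d → ℝ) (i : Fin d) : |x i| ≤ lpnorm r x := by
  unfold lpnorm
  have hr0 : 0 < r := by linarith
  calc |x i| = (|x i|^r)^(1/r) := by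
        rw [← Real.rpow_mul (abs_nonneg _), mul_one_div_cancel hr0.ne', Real.rpow_one]
    _ ≤ _ := by
        apply Real.rpow_le_rpow (by positivity) _ (by positivity)
        exact Finset.single_le_sum (f := fun i => |x i|^r) (fun j _ => by positivity) (Finset.mem_univ i)

lemma lpnorm_pos (r : ℝ) (hr : 1 ≤ r) {d : ℕ} (x : Fin d → ℝ) (hx : x ≠ 0) : 0 < lpnorm r x := by
  obtain ⟨i, hi⟩ := Function.ne_iff.mp hx
  exact lt_of_lt_of_le (abs_pos.mpr hi) (abs_le_lpnorm r hr x i)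

lemma lpnorm_mono (r : ℝ) (hr : 1 ≤ r) {d : ℕ} (x y : Fin d → ℝ) (h : ∀ i, |x i| ≤ |y i|) :
    lpnorm r x ≤ lpnorm r y := by
  unfold lpnorm
  apply Real.rpow_le_rpow (by positivity) _ (by positivity)
  exact Finset.sum_le_sum fun i _ => Real.rpow_le_rpow (abs_nonneg _) (h i) (by linarith)

lemma lpnorm_smul (r : ℝ) (hr : 1 ≤ r) {d : ℕ} (c : ℝ) (x : Fin d → ℝ) :
    lpnorm r (fun i => c * x i) = |c| * lpnorm r x := by
  unfold lpnorm
  simp_rw [abs_mul, Real.mul_rpow (abs_nonneg c) (abs_nonneg _)]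
  rw [← Finset.mul_sum, Real.mul_rpow (by positivity) (by positivity), ← Real.rpow_mul (abs_nonneg _), mul_one_div_cancel (by linarith), Real.rpow_one]

lemma opNorm_bdd (p q : ℝ) (hp : 1 ≤ p) (hq : 1 ≤ q) {m n : ℕ} (A : Matrix (Fin m) (Fin n) ℝ) :
    BddAbove {t : ℝ | ∃ x : Fin n → ℝ, x ≠ 0 ∧ t = lpnorm q (A.mulVec x) / lpnorm p x} := by
  refine ⟨lpnorm q (fun i => ∑ j, |A i j|), ?_⟩
  rintro t ⟨x, hx, rfl⟩
  rw [div_le_iff₀ (lpnorm_pos p hp x hx), mul_comm]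
  have e := lpnorm_smul q hq (lpnorm p x) (fun i => ∑ j, |A i j|)
  rw [abs_of_nonneg (lpnorm_nonneg p x)] at e
  rw [← e]
  apply lpnorm_mono q hq
  intro i
  rw [abs_of_nonneg (mul_nonneg (lpnorm_nonneg p x) (Finset.sum_nonneg fun j _ => abs_nonneg _))]
  rw [Finset.mul_sum]
  simp only [Matrix.mulVec, dotProduct]
  refine (Finset.abs_sum_le_sum_abs _ _).trans (Finset.sum_le_sum fun j _ => ?_)
  rw [abs_mul, mul_comm]
  exact mul_le_mul_of_nonneg_right (abs_le_lpnorm p hp x j) (abs_nonneg _)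

lemma opNorm_nonneg (p q : ℝ) {m n : ℕ} (A : Matrix (Fin m) (Fin n) ℝ) : 0 ≤ opNorm p q A := by
  apply Real.sSup_nonneg
  rintro t ⟨x, hx, rfl⟩
  exact div_nonneg (lpnorm_nonneg _ _) (lpnorm_nonneg _ _)

lemma le_opNorm (p q : ℝ) (hp : 1 ≤ p) (hq : 1 ≤ q) {m n : ℕ} (A : Matrix (Fin m) (Fin n) ℝ) (x : Fin n → ℝ) :
    lpnorm q (A.mulVec x) ≤ opNorm p q A * lpnorm p x := by
  by_cases hx : x = 0
  · subst hx
    have : lpnorm q (A.mulVec 0) = 0 := by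
      unfold lpnorm
      simp [Real.zero_rpow (by linarith : q ≠ 0)]
      rw [Real.zero_rpow]
      have : 0 < q := by linarith
      positivity
    rw [this]
    exact mul_nonneg (opNorm_nonneg _ _ _) (lpnorm_nonneg _ _)
  · rw [← div_le_iff₀ (lpnorm_pos p hp x hx)]
    exact le_csSup (opNorm_bdd p q hp hq A) ⟨x, hx, rfl⟩

lemma opNorm_le (p q C : ℝ) (hp : 1 ≤ p) (hC : 0 ≤ C) {m n : ℕ} (A : Matrix (Fin m) (Fin n) ℝ)
    (h : ∀ x, lpnorm q (A.mulVec x) ≤ C * lpnorm p x) : opNorm p q A ≤ C := by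
  apply Real.sSup_le _ hC
  rintro t ⟨x, hx, rfl⟩
  rw [div_le_iff₀ (lpnorm_pos p hp x hx)]
  exact h x

/-- weights -/
lemma weight_exists {n : ℕ} (hn : 0 < n) (P : ℝ) (hP : 2 ≤ P) (t : Fin n → ℝ) (ht : ∀ j, 0 ≤ t j) :
    ∃ l : Fin n → ℝ, (∀ j, 0 ≤ l j) ∧ ∑ j, l j = 1 ∧
      (∑ j, t j ^ P)^(2/P) = ∑ j, l j ^ (1-2/P) * t j^2 := by
  have hP0 : 0 < P := by linarith
  by_cases hS : ∑ j, t j ^ P = 0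
  · have h0 : ∀ j, t j = 0 := by
      intro j
      have := (Finset.sum_eq_zero_iff_of_nonneg (fun j _ => Real.rpow_nonneg (ht j) P)).mp hS j (Finset.mem_univ j)
      exact (Real.rpow_eq_zero (ht j) hP0.ne').mp this
    refine ⟨fun j => if j = ⟨0, hn⟩ then 1 else 0, fun j => by dsimp only; split_ifs <;> norm_num, by simp, ?_⟩
    rw [hS, Real.zero_rpow (by positivity)]
    simp [h0]
  set S := ∑ j, t j ^ P with hSd
  have hS0 : 0 < S := lt_of_le_of_ne (Finset.sum_nonneg fun j _ => Real.rpow_nonneg (ht j) P) (Ne.symm hS)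
  refine ⟨fun j => t j ^ P / S, fun j => div_nonneg (Real.rpow_nonneg (ht j) P) hS0.le, ?_, ?_⟩
  · rw [← Finset.sum_div, ← hSd, div_self hS0.ne']
  · have e : ∀ j, (t j ^ P / S)^(1-2/P) * t j^2 = t j^P * (S^(1-2/P))⁻¹ := by
      intro j
      rw [Real.div_rpow (Real.rpow_nonneg (ht j) P) hS0.le, ← Real.rpow_mul (ht j)]
      rcases (ht j).eq_or_lt with h | h
      · rw [← h]; simp [Real.zero_rpow hP0.ne']
      · rw [show P * (1-2/P) = P - (2:ℕ) by field_simp; norm_num, Real.rpow_sub_natCast h.ne']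
        field_simp
    simp_rw [e]
    rw [← Finset.sum_mul, ← hSd, Real.rpow_sub hS0, Real.rpow_one]
    field_simp

lemma half_lemma {Ω : Type*} [MeasurableSpace Ω] (μ : Measure Ω) [IsProbabilityMeasure μ] {n : ℕ} (P r : ℝ)
    (hP : 2 ≤ P) (hr : r = P/(P-1)) (t : Fin n → ℝ) (ht : ∀ j, 0 ≤ t j) (h : Fin n → Ω → ℝ)
    (hh : ∀ j, MeasurePreserving (h j) μ (ProbabilityTheory.gaussianReal 0 1)) :
    ∃ X : Ω → ℝ, (∀ ω, 0 ≤ X ω) ∧ Integrable (fun ω => X ω^2) μ ∧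
      (∫ ω, X ω^2 ∂μ) ≤ (MM r)^(2/P) * (∑ j, t j ^ P)^(2/P) ∧
      ∀ ω, lpnorm P (fun j => t j * sg (r-1) (h j ω)) ≤ X ω := by
  have hP0 : 0 < P := by linarith
  have hr0 : 0 ≤ r := by rw [hr]; apply div_nonneg <;> linarith
  set S : Ω → ℝ := fun ω => ∑ j, t j ^ P * |h j ω|^r with hS
  have hSnn : ∀ ω, 0 ≤ S ω := fun ω => Finset.sum_nonneg fun j _ => mul_nonneg (Real.rpow_nonneg (ht j) P) (by positivity)
  have hji : ∀ j, Integrable (fun ω => |h j ω|^r) μ := fun j =>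
    (hh j).integrable_comp_of_integrable (gaussianReal_int r hr0)
  have hSi : Integrable S μ := integrable_finsetSum _ fun j _ => (hji j).const_mul _
  have hSe : ∫ ω, S ω ∂μ = MM r * ∑ j, t j ^ P := by
    simp only [hS]
    rw [integral_finsetSum _ fun j _ => (hji j).const_mul _, Finset.mul_sum]
    refine Finset.sum_congr rfl fun j _ => ?_
    rw [integral_const_mul, mul_comm]
    congr 1
    rw [← gaussianReal_moment, ← (hh j).map_eq, integral_map (hh j).measurable.aemeasurable]
    exact (by fun_prop : Measurable fun x : ℝ => |x|^r).aestronglyMeasurable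
  have hsq : ∀ ω, (S ω ^ (1/P))^2 = S ω ^ (2/P) := by
    intro ω
    rw [← Real.rpow_natCast, ← Real.rpow_mul (hSnn ω)]; congr 1; push_cast; ring
  have h2P : 2/P ≤ 1 := by rw [div_le_one hP0]; exact hP
  have hi : Integrable (fun ω => S ω ^ (2/P)) μ := by
    refine Integrable.mono' ((integrable_const (1:ℝ)).add hSi) ?_ (Filter.Eventually.of_forall fun ω => ?_)
    · exact (hSi.aemeasurable.pow_const _).aestronglyMeasurable
    · rw [Real.norm_of_nonneg (Real.rpow_nonneg (hSnn ω) _)]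
      simp only [Pi.add_apply]
      rcases le_total (S ω) 1 with h1 | h1
      · have := Real.rpow_le_one (hSnn ω) h1 (by positivity : 0 ≤ 2/P)
        linarith [hSnn ω]
      · have := Real.rpow_le_rpow_of_exponent_le h1 h2P
        rw [Real.rpow_one] at this
        linarith
  refine ⟨fun ω => S ω ^ (1/P), fun ω => Real.rpow_nonneg (hSnn ω) _, ?_, ?_, ?_⟩
  · simp_rw [hsq]; exact hi
  · simp_rw [hsq]
    rw [← Real.mul_rpow (MM_pos r hr0).le (Finset.sum_nonneg fun j _ => Real.rpow_nonneg (ht j) P), ← hSe]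
    exact (Real.concaveOn_rpow (by positivity : 0 ≤ 2/P) h2P).le_map_integral
      (fun x _ => (Real.continuousAt_rpow_const x _ (Or.inr (by positivity))).continuousWithinAt) isClosed_Ici (Filter.Eventually.of_forall hSnn) hSi hi
  · intro ω
    unfold lpnorm
    apply Real.rpow_le_rpow (by positivity) _ (by positivity)
    refine Finset.sum_le_sum fun j _ => ?_
    rw [abs_mul, abs_of_nonneg (ht j), Real.mul_rpow (ht j) (abs_nonneg _)]
    apply mul_le_mul_of_nonneg_left _ (Real.rpow_nonneg (ht j) P)
    have e : r = (r-1)*P := by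
      rw [hr]; have : P - 1 ≠ 0 := by linarith
      field_simp; ring
    conv_rhs => rw [e]
    rw [Real.rpow_mul (abs_nonneg _)]
    exact Real.rpow_le_rpow (abs_nonneg _) (sg_abs_le _ _) hP0.le


lemma q_side {Ω : Type*} [MeasurableSpace Ω] (μ : Measure Ω) [IsProbabilityMeasure μ] {m : ℕ} (hm : 0 < m) (q : ℝ)
    (hq1 : 1 ≤ q) (hq2 : q ≤ 2) (s : Fin m → ℝ) (hs : ∀ j, 0 ≤ s j) (g : Fin m → Ω → ℝ)
    (hg : ∀ j, MeasurePreserving (g j) μ (ProbabilityTheory.gaussianReal 0 1)) :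
    ∃ l : Fin m → ℝ, (∀ j, 0 ≤ l j) ∧ ∑ j, l j = 1 ∧ ∃ Y : Ω → ℝ, (∀ ω, 0 ≤ Y ω) ∧ Integrable (fun ω => Y ω^2) μ ∧
      (∫ ω, Y ω^2 ∂μ) ≤ (MM q)^(2*((q-1)/q)) * (∑ j, l j ^ (2/q-1) * s j^2) ∧
      ∀ ω (z : Fin m → ℝ), ∑ i, (s i * sg (q-1) (g i ω)) * z i ≤ Y ω * lpnorm q z := by
  rcases hq1.eq_or_lt with h1 | h1
  · subst h1
    have : Nonempty (Fin m) := ⟨⟨0, hm⟩⟩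
    obtain ⟨i0, hi0⟩ := Finite.exists_max s
    refine ⟨fun j => if j = i0 then 1 else 0, fun j => by dsimp only; split_ifs <;> norm_num, by simp, fun _ => s i0, fun _ => hs i0, integrable_const _, ?_, ?_⟩
    · have : ∑ j, (if j = i0 then (1:ℝ) else 0) ^ ((2:ℝ)/1-1) * s j^2 = s i0^2 := by
        rw [Finset.sum_eq_single i0]
        · simp
        · intro j _ hj
          simp [hj]; left; norm_num
        · simp
      rw [this]
      simp
    · intro ω z
      have e : lpnorm 1 z = ∑ i, |z i| := by unfold lpnorm; simp
      rw [e, Finset.mul_sum]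
      refine Finset.sum_le_sum fun i _ => ?_
      have h2 := sg_abs_le (1-1) (g i ω)
      rw [sub_self, Real.rpow_zero] at h2
      rw [sub_self]
      calc s i * sg 0 (g i ω) * z i ≤ |s i * sg 0 (g i ω) * z i| := le_abs_self _
        _ = s i * |sg 0 (g i ω)| * |z i| := by rw [abs_mul, abs_mul, abs_of_nonneg (hs i)]
        _ ≤ s i0 * |z i| := by
          apply mul_le_mul_of_nonneg_right _ (abs_nonneg _)
          calc s i * |sg 0 (g i ω)| ≤ s i * 1 := mul_le_mul_of_nonneg_left h2 (hs i)
            _ ≤ s i0 := by rw [mul_one]; exact hi0 i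
  · set P := q/(q-1) with hP
    have hq0 : 0 < q := by linarith
    have hq10 : 0 < q - 1 := by linarith
    have hP2 : 2 ≤ P := by rw [hP, le_div_iff₀ hq10]; linarith
    have hr : q = P/(P-1) := by
      have : P - 1 = 1/(q-1) := by rw [hP]; field_simp; ring
      rw [this, hP]; field_simp
    obtain ⟨l, l0, l1, hl⟩ := weight_exists hm P hP2 s hs
    obtain ⟨Y, Y0, Yi, Ye, Yb⟩ := half_lemma μ P q hP2 hr s hs g hg
    have e1 : 2/P = 2*((q-1)/q) := by rw [hP]; field_simp
    have e2 : 1 - 2/P = 2/q-1 := by rw [e1]; field_simp; ring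
    rw [hl, e2, e1] at Ye
    refine ⟨l, l0, l1, Y, Y0, Yi, Ye, fun ω z => ?_⟩
    have hc : P.HolderConjugate q := by
      rw [Real.holderConjugate_comm, hP]
      exact Real.HolderConjugate.conjExponent h1
    refine (Real.inner_le_Lp_mul_Lq Finset.univ _ _ hc).trans ?_
    exact mul_le_mul_of_nonneg_right (Yb ω) (lpnorm_nonneg q z)

open scoped MatrixOrder Matrix.Norms.L2Operator in
lemma psd_zero {ι : Type} [Fintype ι] [DecidableEq ι] (Z : Matrix ι ι ℝ) (hZ : Z.PosSemidef) (k l : ι) (h : Z k k = 0) :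
    Z k l = 0 := by
  obtain ⟨B, rfl⟩ := CStarAlgebra.nonneg_iff_eq_star_mul_self.mp hZ.nonneg
  simp only [Matrix.star_eq_conjTranspose, Matrix.mul_apply, Matrix.conjTranspose_apply, star_trivial] at h ⊢
  have := (Finset.sum_eq_zero_iff_of_nonneg (fun j _ => mul_self_nonneg (B j k))).mp h
  refine Finset.sum_eq_zero fun j hj => ?_
  have h2 := mul_self_eq_zero.mp (this j hj)
  rw [h2, zero_mul]

lemma normalize_psd {ι : Type} [Fintype ι] [DecidableEq ι] (Z : Matrix ι ι ℝ) (hZ : Z.PosSemidef) :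
    ∃ T : Matrix ι ι ℝ, T.PosSemidef ∧ (∀ i, T i i = 1) ∧ ∀ k l, k ≠ l → Z k l = √(Z k k) * √(Z l l) * T k l := by
  have hd : ∀ k, 0 ≤ Z k k := fun k => hZ.diag_nonneg
  refine ⟨Matrix.of (fun k l => (√(Z k k))⁻¹ * (√(Z l l))⁻¹ * Z k l) + Matrix.diagonal (fun k => if Z k k = 0 then 1 else 0), ?_, ?_, ?_⟩
  · apply Matrix.PosSemidef.add
    · exact psd_scale hZ _
    · apply Matrix.PosSemidef.diagonal
      intro k
      dsimp only
      split_ifs <;> simp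
  · intro i
    simp only [Matrix.add_apply, Matrix.of_apply, Matrix.diagonal_apply_eq]
    split_ifs with h
    · simp [h]
    · have : 0 < Z i i := lt_of_le_of_ne (hd i) (Ne.symm h)
      rw [← mul_inv, Real.mul_self_sqrt (hd i)]
      field_simp
      ring
  · intro k l hkl
    simp only [Matrix.add_apply, Matrix.of_apply, Matrix.diagonal_apply_ne _ hkl, add_zero]
    by_cases h : Z k k = 0
    · rw [psd_zero Z hZ k l h]; simp
    by_cases h' : Z l l = 0
    · have : Z k l = 0 := by
        rw [((psd_iff Z).mp hZ).1 k l, psd_zero Z hZ l k h']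
      rw [this]; simp
    have h1 : 0 < Z k k := lt_of_le_of_ne (hd k) (Ne.symm h)
    have h2 : 0 < Z l l := lt_of_le_of_ne (hd l) (Ne.symm h')
    have := Real.sqrt_pos.mpr h1
    have := Real.sqrt_pos.mpr h2
    field_simp

open ProbabilityTheory in
lemma rounding (p q : ℝ) (hq1 : 1 ≤ q) (hq2 : q ≤ 2) (hp : 2 ≤ p) {m n : ℕ} (hm : 0 < m) (hn : 0 < n)
    (A : Matrix (Fin m) (Fin n) ℝ) (C : ℝ) (hC0 : 0 < C) (hC : Real.sinh C < 1)
    (Z : Matrix (Fin m ⊕ Fin n) (Fin m ⊕ Fin n) ℝ) (hZ : Z.PosSemidef) :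
    ∃ (l : Fin m → ℝ) (k : Fin n → ℝ), (∀ i, 0 ≤ l i) ∧ ∑ i, l i = 1 ∧ (∀ j, 0 ≤ k j) ∧ ∑ j, k j = 1 ∧
      2 * ∑ i, ∑ j, A i j * Z (.inl i) (.inr j) ≤
       (1/(C * (gaussNorm (p/(p-1)) * gaussNorm q)) * opNorm p q A) *
        (∑ i, l i ^ (2/q-1) * Z (.inl i) (.inl i) + ∑ j, k j ^ (1-2/p) * Z (.inr j) (.inr j)) := by
  have hp1 : 0 < p - 1 := by linarith
  have hp0 : 0 < p := by linarith
  have hq0 : 0 < q := by linarith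
  set p' := p/(p-1) with hp'
  have hp'1 : p' - 1 = 1/(p-1) := by rw [hp']; field_simp; ring
  have hb0 : 0 ≤ p' - 1 := by rw [hp'1]; positivity
  have hb1 : p' - 1 ≤ 1 := by rw [hp'1, div_le_one hp1]; linarith
  have ha0 : 0 ≤ q - 1 := by linarith
  have ha1 : q - 1 ≤ 1 := by linarith
  have hp'0 : 0 < p' := by linarith
  have hd : ∀ k, 0 ≤ Z k k := fun k => hZ.diag_nonneg
  obtain ⟨T, hT, hT1, hTZ⟩ := normalize_psd Z hZ
  obtain ⟨H, ⟨G, hG, hG1, hGH⟩, hH⟩ := schur_final (m := m) (n := n) ha0 ha1 hb0 hb1 C hC0.le hC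
    (fun i j => T (.inl i) (.inr j)) ⟨T, hT, hT1, fun i j => rfl⟩
  set μ := multivariateGaussian (0 : EuclideanSpace ℝ (Fin m ⊕ Fin n)) G with hμ
  have hev : ∀ i, MeasurePreserving (fun x : EuclideanSpace ℝ (Fin m ⊕ Fin n) => x i) μ (gaussianReal 0 1) := by
    intro i
    have := measurePreserving_eval_multivariateGaussian (μ := (0 : EuclideanSpace ℝ (Fin m ⊕ Fin n))) hG (i := i)
    rw [hG1 i] at this
    simpa using this
  set s : Fin m → ℝ := fun i => √(Z (.inl i) (.inl i)) with hs
  set t : Fin n → ℝ := fun j => √(Z (.inr j) (.inr j)) with ht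
  obtain ⟨l, l0, l1, Y, Y0, Yi, Ye, Yb⟩ := q_side μ hm q hq1 hq2 s (fun i => Real.sqrt_nonneg _) (fun i x => x (.inl i)) (fun i => hev _)
  obtain ⟨k, k0, k1, hk⟩ := weight_exists hn p hp t (fun i => Real.sqrt_nonneg _)
  obtain ⟨X, X0, Xi, Xe, Xb⟩ := half_lemma μ p p' hp hp' t (fun i => Real.sqrt_nonneg _) (fun i x => x (.inr i)) (fun i => hev _)
  rw [hk] at Xe
  refine ⟨l, k, l0, l1, k0, k1, ?_⟩
  have es : ∀ i, s i ^ 2 = Z (.inl i) (.inl i) := fun i => Real.sq_sqrt (hd _)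
  have et : ∀ i, t i ^ 2 = Z (.inr i) (.inr i) := fun i => Real.sq_sqrt (hd _)
  simp_rw [es] at Ye
  simp_rw [et] at Xe
  set N1 := ∑ i, l i ^ (2/q-1) * Z (.inl i) (.inl i) with hN1
  set N2 := ∑ j, k j ^ (1-2/p) * Z (.inr j) (.inr j) with hN2
  set α := opNorm p q A with hα
  have hα0 : 0 ≤ α := opNorm_nonneg _ _ _
  set Q := MM q with hQ
  set R := MM p' with hR
  have hQ0 : 0 < Q := MM_pos q hq0.le
  have hR0 : 0 < R := MM_pos p' hp'0.le
  set u := Q^((q-1)/q) with hu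
  set v := R^(1/p) with hv
  have hu0 : 0 < u := by positivity
  have hv0 : 0 < v := by positivity
  have hu2 : Q^(2*((q-1)/q)) = u^2 := by
    rw [hu, ← Real.rpow_natCast, ← Real.rpow_mul hQ0.le]; congr 1; push_cast; ring
  have hv2 : R^(2/p) = v^2 := by
    rw [hv, ← Real.rpow_natCast, ← Real.rpow_mul hR0.le]; congr 1; push_cast; ring
  rw [hu2] at Ye
  rw [hv2] at Xe
  have hQu : Q = u * gaussNorm q := by
    rw [gaussNorm_eq, ← hQ, hu, ← Real.rpow_add hQ0]
    conv_lhs => rw [← Real.rpow_one Q]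
    congr 1; field_simp; ring
  have hRv : R = v * gaussNorm p' := by
    rw [gaussNorm_eq, ← hR, hv, ← Real.rpow_add hR0]
    conv_lhs => rw [← Real.rpow_one R]
    congr 1; rw [hp']; field_simp; ring
  -- the integral
  set F : EuclideanSpace ℝ (Fin m ⊕ Fin n) → ℝ := fun x => ∑ i, ∑ j, A i j * s i * t j * (sg (q-1) (x (.inl i)) * sg (p'-1) (x (.inr j))) with hF
  have hg := fun i j => gauss_exp ha0 ha1 hb0 hb1 G hG hG1 (.inl i) (.inr j) (by rw [hGH]; exact (hH i j).1)
  have hFint : Integrable F μ := integrable_finsetSum _ fun i _ => integrable_finsetSum _ fun j _ => ((hg i j).1).const_mul _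
  have hFe : ∫ x, F x ∂μ = Q * R * C * ∑ i, ∑ j, A i j * Z (.inl i) (.inr j) := by
    simp only [hF]
    rw [integral_finsetSum _ fun i _ => integrable_finsetSum _ fun j _ => ((hg i j).1).const_mul _, Finset.mul_sum]
    refine Finset.sum_congr rfl fun i _ => ?_
    rw [integral_finsetSum _ fun j _ => ((hg i j).1).const_mul _, Finset.mul_sum]
    refine Finset.sum_congr rfl fun j _ => ?_
    rw [integral_const_mul, (hg i j).2, hGH, (hH i j).2, hTZ (.inl i) (.inr j) (by simp)]
    rw [sub_add_cancel, sub_add_cancel, ← hQ, ← hR]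
    simp only [hs, ht]
    ring
  have hFb : ∀ x, 2 * F x ≤ α * ((v/u) * Y x^2 + (u/v) * X x^2) := by
    intro x
    set y : Fin m → ℝ := fun i => s i * sg (q-1) (x (.inl i)) with hy
    set w : Fin n → ℝ := fun j => t j * sg (p'-1) (x (.inr j)) with hw
    have e : F x = ∑ i, y i * (A.mulVec w) i := by
      simp only [hF, Matrix.mulVec, dotProduct]
      refine Finset.sum_congr rfl fun i _ => ?_
      rw [Finset.mul_sum]
      refine Finset.sum_congr rfl fun j _ => ?_
      simp only [hy, hw]; ring
    have b1 : F x ≤ Y x * (α * X x) := by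
      rw [e]
      refine (Yb x _).trans (mul_le_mul_of_nonneg_left ?_ (Y0 x))
      exact (le_opNorm p q (by linarith) hq1 A w).trans (mul_le_mul_of_nonneg_left (Xb x) hα0)
    have b2 : 2 * (Y x * X x) ≤ (v/u) * Y x^2 + (u/v) * X x^2 := by
      have : (v/u) * Y x^2 + (u/v) * X x^2 - 2 * (Y x * X x) = (v * Y x - u * X x)^2/(u*v) := by
        field_simp; ring
      have h2 : 0 ≤ (v * Y x - u * X x)^2/(u*v) := by positivity
      linarith
    nlinarith [mul_le_mul_of_nonneg_left b2 hα0]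
  have hI := integral_mono (hFint.const_mul 2) (((Yi.const_mul (v/u)).add (Xi.const_mul (u/v))).const_mul α) hFb
  simp only [Pi.add_apply] at hI
  rw [integral_const_mul, integral_const_mul, integral_add (Yi.const_mul (v/u)) (Xi.const_mul (u/v)), integral_const_mul, integral_const_mul, hFe] at hI
  have hI2 : 2 * (Q * R * C * ∑ i, ∑ j, A i j * Z (.inl i) (.inr j)) ≤ α * (u * v * (N1 + N2)) := by
    refine hI.trans (mul_le_mul_of_nonneg_left ?_ hα0)
    have c1 := mul_le_mul_of_nonneg_left Ye (by positivity : 0 ≤ v/u)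
    have c2 := mul_le_mul_of_nonneg_left Xe (by positivity : 0 ≤ u/v)
    have c3 : v/u * (u^2 * N1) = u*v*N1 := by field_simp
    have c4 : u/v * (v^2 * N2) = u*v*N2 := by field_simp
    linarith
  have hgq : 0 < gaussNorm q := by rw [gaussNorm_eq]; positivity
  have hgp : 0 < gaussNorm p' := by rw [gaussNorm_eq]; positivity
  rw [hQu, hRv] at hI2
  have : 1 / (C * (gaussNorm p' * gaussNorm q)) * α * (N1 + N2) = α * (N1+N2) / (C * (gaussNorm p' * gaussNorm q)) := by ring
  rw [this, le_div_iff₀ (by positivity)]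
  have huv : 0 < u * v := by positivity
  refine le_of_mul_le_mul_left ?_ huv
  linarith


lemma wset_compact_convex (N : ℕ) (θ : ℝ) (h0 : 0 ≤ θ) (h1 : θ ≤ 1) :
    Convex ℝ {z : (Fin N → ℝ) × (Fin N → ℝ) | z.2 ∈ stdSimplex ℝ (Fin N) ∧ ∀ i, 0 ≤ z.1 i ∧ z.1 i ≤ z.2 i ^ θ} ∧
    IsCompact {z : (Fin N → ℝ) × (Fin N → ℝ) | z.2 ∈ stdSimplex ℝ (Fin N) ∧ ∀ i, 0 ≤ z.1 i ∧ z.1 i ≤ z.2 i ^ θ} := by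
  constructor
  · intro z hz z' hz' a b ha hb hab
    refine ⟨convex_stdSimplex ℝ (Fin N) hz.1 hz'.1 ha hb hab, fun i => ⟨?_, ?_⟩⟩
    · have := (hz.2 i).1
      have := (hz'.2 i).1
      simp; positivity
    · have c := (Real.concaveOn_rpow h0 h1).2 (x := z.2 i) (y := z'.2 i) (hz.1.1 i) (hz'.1.1 i) ha hb hab
      simp only [smul_eq_mul] at c
      simp only [Prod.fst_add, Prod.smul_fst, Prod.snd_add, Prod.smul_snd, Pi.add_apply, Pi.smul_apply, smul_eq_mul]
      refine le_trans ?_ c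
      have := mul_le_mul_of_nonneg_left (hz.2 i).2 ha
      have := mul_le_mul_of_nonneg_left (hz'.2 i).2 hb
      linarith
  · have hK : IsCompact ((Icc (0 : Fin N → ℝ) 1) ×ˢ stdSimplex ℝ (Fin N)) := isCompact_Icc.prod (isCompact_stdSimplex ℝ (Fin N))
    refine hK.of_isClosed_subset ?_ ?_
    · have : {z : (Fin N → ℝ) × (Fin N → ℝ) | z.2 ∈ stdSimplex ℝ (Fin N) ∧ ∀ i, 0 ≤ z.1 i ∧ z.1 i ≤ z.2 i ^ θ}
        = (Prod.snd ⁻¹' stdSimplex ℝ (Fin N)) ∩ ⋂ i, ({z : (Fin N → ℝ) × (Fin N → ℝ) | 0 ≤ z.1 i} ∩ {z | z.1 i ≤ z.2 i ^ θ}) := by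
        ext z; simp
      rw [this]
      refine ((isClosed_stdSimplex ℝ (Fin N)).preimage continuous_snd).inter (isClosed_iInter fun i => ?_)
      refine (isClosed_le continuous_const (by fun_prop)).inter (isClosed_le (by fun_prop) ?_)
      exact Continuous.rpow_const (by fun_prop) (fun _ => Or.inr h0)
    · rintro ⟨w, l⟩ ⟨hl, hw⟩
      refine ⟨⟨fun i => (hw i).1, fun i => (hw i).2.trans ?_⟩, hl⟩
      refine Real.rpow_le_one (hl.1 i) ?_ h0
      rw [← hl.2]
      exact Finset.single_le_sum (fun j _ => hl.1 j) (Finset.mem_univ i)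

def bigM {m n : ℕ} (A : Matrix (Fin m) (Fin n) ℝ) (κ : ℝ) (w1 : Fin m → ℝ) (w2 : Fin n → ℝ) :
    (Fin m ⊕ Fin n) → (Fin m ⊕ Fin n) → ℝ :=
  Matrix.fromBlocks (Matrix.diagonal (fun i => κ * w1 i)) (-A) (-A.transpose) (Matrix.diagonal (fun i => κ * w2 i))

lemma psd_closed {ι : Type} [Fintype ι] [DecidableEq ι] : IsClosed {M : ι → ι → ℝ | (Matrix.of M).PosSemidef} := by
  have : {M : ι → ι → ℝ | (Matrix.of M).PosSemidef} = {M : ι → ι → ℝ | ∀ k l, M k l = M l k} ∩ ⋂ x : ι → ℝ, {M | 0 ≤ ∑ k, ∑ l, x k * M k l * x l} := by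
    ext M
    simp only [mem_ofPred_eq, psd_iff, mem_inter_iff, mem_iInter, Matrix.of_apply]
  rw [this]
  refine IsClosed.inter ?_ (isClosed_iInter fun x => isClosed_le continuous_const (by fun_prop))
  simp only [ofPred_forall]
  exact isClosed_iInter fun k => isClosed_iInter fun l => isClosed_eq (by fun_prop) (by fun_prop)

lemma psd_convex {ι : Type} [Fintype ι] [DecidableEq ι] : Convex ℝ {M : ι → ι → ℝ | (Matrix.of M).PosSemidef} := by
  intro M hM M' hM' a b ha hb _
  exact (Matrix.PosSemidef.smul hM ha).add (Matrix.PosSemidef.smul hM' hb)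

lemma dual_repr {ι : Type} [Fintype ι] [DecidableEq ι] (f : (ι → ι → ℝ) →ₗ[ℝ] ℝ) (M : ι → ι → ℝ) :
    f M = ∑ k, ∑ l, f (Pi.single k (Pi.single l 1)) * M k l := by
  have : M = ∑ k, ∑ l, M k l • (Pi.single k (Pi.single l 1) : ι → ι → ℝ) := by
    ext a b
    simp only [Finset.sum_apply, Pi.smul_apply, smul_eq_mul]
    rw [Finset.sum_eq_single a, Finset.sum_eq_single b]
    · simp
    · intro l _ hl; simp [hl.symm]
    · simp
    · intro k _ hk; simp [Pi.single_eq_of_ne (Ne.symm hk)]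
    · simp
  conv_lhs => rw [this]
  simp only [map_sum, map_smul, smul_eq_mul]
  exact Finset.sum_congr rfl fun k _ => Finset.sum_congr rfl fun l _ => mul_comm _ _

lemma separation {m n : ℕ} (A : Matrix (Fin m) (Fin n) ℝ) (κ : ℝ) (hκ : 0 ≤ κ) (θ1 θ2 : ℝ) (h10 : 0 ≤ θ1) (h11 : θ1 ≤ 1)
    (h20 : 0 ≤ θ2) (h21 : θ2 ≤ 1)
    (h : ∀ Z : Matrix (Fin m ⊕ Fin n) (Fin m ⊕ Fin n) ℝ, Z.PosSemidef →
      ∃ (l : Fin m → ℝ) (k : Fin n → ℝ), (∀ i, 0 ≤ l i) ∧ ∑ i, l i = 1 ∧ (∀ j, 0 ≤ k j) ∧ ∑ j, k j = 1 ∧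
      2 * ∑ i, ∑ j, A i j * Z (.inl i) (.inr j) ≤
       κ * (∑ i, l i ^ θ1 * Z (.inl i) (.inl i) + ∑ j, k j ^ θ2 * Z (.inr j) (.inr j))) :
    ∃ (l : Fin m → ℝ) (k : Fin n → ℝ), (∀ i, 0 ≤ l i) ∧ ∑ i, l i = 1 ∧ (∀ j, 0 ≤ k j) ∧ ∑ j, k j = 1 ∧
      ∀ (y : Fin m → ℝ) (x : Fin n → ℝ), 2 * ∑ i, ∑ j, A i j * (y i * x j) ≤
       κ * (∑ i, l i ^ θ1 * y i^2 + ∑ j, k j ^ θ2 * x j^2) := by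
  obtain ⟨cv1, cp1⟩ := wset_compact_convex m θ1 h10 h11
  obtain ⟨cv2, cp2⟩ := wset_compact_convex n θ2 h20 h21
  set S1 := {z : (Fin m → ℝ) × (Fin m → ℝ) | z.2 ∈ stdSimplex ℝ (Fin m) ∧ ∀ i, 0 ≤ z.1 i ∧ z.1 i ≤ z.2 i ^ θ1} with hS1
  set S2 := {z : (Fin n → ℝ) × (Fin n → ℝ) | z.2 ∈ stdSimplex ℝ (Fin n) ∧ ∀ i, 0 ≤ z.1 i ∧ z.1 i ≤ z.2 i ^ θ2} with hS2
  set Φ : (((Fin m → ℝ) × (Fin m → ℝ)) × ((Fin n → ℝ) × (Fin n → ℝ))) → ((Fin m ⊕ Fin n) → (Fin m ⊕ Fin n) → ℝ) :=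
    fun z => bigM A κ z.1.1 z.2.1 with hΦ
  have hΦc : Continuous Φ := by
    refine continuous_pi fun k => continuous_pi fun l => ?_
    rcases k with i | i <;> rcases l with j | j
    · simp only [hΦ, bigM, Matrix.fromBlocks_apply₁₁, Matrix.diagonal_apply]
      split_ifs <;> fun_prop
    · simp only [hΦ, bigM, Matrix.fromBlocks_apply₁₂]; fun_prop
    · simp only [hΦ, bigM, Matrix.fromBlocks_apply₂₁]; fun_prop
    · simp only [hΦ, bigM, Matrix.fromBlocks_apply₂₂, Matrix.diagonal_apply]
      split_ifs <;> fun_prop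
  have hΦa : ∀ z z' (a b : ℝ), a + b = 1 → Φ (a • z + b • z') = a • Φ z + b • Φ z' := by
    intro z z' a b hab
    ext k l
    change Φ (a • z + b • z') k l = a * Φ z k l + b * Φ z' k l
    rcases k with i | i <;> rcases l with j | j
    · simp only [hΦ, bigM, Matrix.fromBlocks_apply₁₁, Matrix.diagonal_apply, Pi.add_apply, Pi.smul_apply, Prod.fst_add, Prod.smul_fst, smul_eq_mul]
      split_ifs
      · ring
      · ring
    · simp only [hΦ, bigM, Matrix.fromBlocks_apply₁₂, Pi.add_apply, Pi.smul_apply, smul_eq_mul, Matrix.neg_apply]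
      linear_combination (A i j) * hab
    · simp only [hΦ, bigM, Matrix.fromBlocks_apply₂₁, Pi.add_apply, Pi.smul_apply, smul_eq_mul, Matrix.neg_apply, Matrix.transpose_apply]
      linear_combination (A j i) * hab
    · simp only [hΦ, bigM, Matrix.fromBlocks_apply₂₂, Matrix.diagonal_apply, Pi.add_apply, Pi.smul_apply, Prod.fst_add, Prod.smul_fst, Prod.snd_add, Prod.smul_snd, smul_eq_mul]
      split_ifs
      · ring
      · ring
  have hKc : IsCompact (Φ '' (S1 ×ˢ S2)) := (cp1.prod cp2).image hΦc
  have hKv : Convex ℝ (Φ '' (S1 ×ˢ S2)) := by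
    rintro _ ⟨z, hz, rfl⟩ _ ⟨z', hz', rfl⟩ a b ha hb hab
    exact ⟨a • z + b • z', (cv1.prod cv2) hz hz' ha hb hab, hΦa z z' a b hab⟩
  by_cases hdis : Disjoint (Φ '' (S1 ×ˢ S2)) {M | (Matrix.of M).PosSemidef}
  · exfalso
    obtain ⟨f, u, v, hu, huv, hv⟩ := geometric_hahn_banach_compact_closed hKv hKc psd_convex psd_closed hdis
    have hv0 : v < 0 := by
      have := hv 0 (by simpa using Matrix.PosSemidef.zero)
      simpa using this
    have hpos : ∀ M : (Fin m ⊕ Fin n) → (Fin m ⊕ Fin n) → ℝ, (Matrix.of M).PosSemidef → 0 ≤ f M := by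
      intro M hM
      by_contra hneg
      push Not at hneg
      have hc : 0 ≤ v / f M := div_nonneg_of_nonpos hv0.le hneg.le
      have := hv ((v / f M) • M) (Matrix.PosSemidef.smul hM hc)
      rw [map_smul, smul_eq_mul, div_mul_cancel₀ _ hneg.ne] at this
      exact lt_irrefl _ this
    set F : (Fin m ⊕ Fin n) → (Fin m ⊕ Fin n) → ℝ := fun k l => f (Pi.single k (Pi.single l 1)) with hF
    have hrep : ∀ M, f M = ∑ k, ∑ l, F k l * M k l := fun M => dual_repr f.toLinearMap M
    set Z : Matrix (Fin m ⊕ Fin n) (Fin m ⊕ Fin n) ℝ := Matrix.of fun k l => (F k l + F l k)/2 with hZ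
    have hsymm : ∀ M : (Fin m ⊕ Fin n) → (Fin m ⊕ Fin n) → ℝ, (∀ k l, M k l = M l k) → f M = ∑ k, ∑ l, Z k l * M k l := by
      intro M hM
      have e2 : f M = ∑ k, ∑ l, F l k * M k l := by
        rw [hrep, Finset.sum_comm]
        exact Finset.sum_congr rfl fun k _ => Finset.sum_congr rfl fun l _ => by rw [hM]
      have e1 := hrep M
      have : ∑ k, ∑ l, Z k l * M k l = (∑ k, ∑ l, F k l * M k l + ∑ k, ∑ l, F l k * M k l)/2 := by
        rw [← Finset.sum_add_distrib, Finset.sum_div]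
        refine Finset.sum_congr rfl fun k _ => ?_
        rw [← Finset.sum_add_distrib, Finset.sum_div]
        refine Finset.sum_congr rfl fun l _ => ?_
        simp only [hZ, Matrix.of_apply]; ring
      rw [this, ← e1, ← e2]; ring
    have hZpsd : Z.PosSemidef := by
      rw [psd_iff]
      refine ⟨fun k l => by simp only [hZ, Matrix.of_apply]; ring, fun x => ?_⟩
      have h1 : (Matrix.of fun k l => x k * x l).PosSemidef := by
        rw [psd_iff]
        refine ⟨fun k l => by simp only [Matrix.of_apply]; ring, fun y => ?_⟩
        have : ∑ k, ∑ l, y k * (Matrix.of fun k l => x k * x l) k l * y l = (∑ k, y k * x k)^2 := by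
          rw [sq, Finset.sum_mul_sum]
          exact Finset.sum_congr rfl fun k _ => Finset.sum_congr rfl fun l _ => by simp only [Matrix.of_apply]; ring
        rw [this]; positivity
      have h2 := hpos (fun k l => x k * x l) h1
      rw [hsymm _ (fun k l => mul_comm _ _)] at h2
      refine h2.trans_eq ?_
      exact Finset.sum_congr rfl fun k _ => Finset.sum_congr rfl fun l _ => by ring
    obtain ⟨l, k, l0, l1, k0, k1, hlk⟩ := h Z hZpsd
    have hmem := hu (Φ ((fun i => l i ^ θ1, l), (fun i => k i ^ θ2, k))) ⟨_, ⟨⟨⟨l0, l1⟩, fun i => ⟨Real.rpow_nonneg (l0 i) _, le_rfl⟩⟩, ⟨⟨k0, k1⟩, fun i => ⟨Real.rpow_nonneg (k0 i) _, le_rfl⟩⟩⟩, rfl⟩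
    have hneg : f (Φ ((fun i => l i ^ θ1, l), (fun i => k i ^ θ2, k))) < 0 := by linarith
    rw [hsymm] at hneg
    · have e : ∑ a, ∑ b, Z a b * Φ ((fun i => l i ^ θ1, l), (fun i => k i ^ θ2, k)) a b
        = κ * (∑ i, l i ^ θ1 * Z (.inl i) (.inl i) + ∑ j, k j ^ θ2 * Z (.inr j) (.inr j)) - 2 * ∑ i, ∑ j, A i j * Z (.inl i) (.inr j) := by
        simp only [hΦ, bigM, Fintype.sum_sum_type, Matrix.fromBlocks_apply₁₁, Matrix.fromBlocks_apply₁₂, Matrix.fromBlocks_apply₂₁, Matrix.fromBlocks_apply₂₂, Matrix.diagonal_apply, Matrix.neg_apply, Matrix.transpose_apply, Finset.sum_add_distrib, mul_ite, mul_zero, Finset.sum_ite_eq, Finset.mem_univ, if_true]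
        have e3 : ∑ x : Fin n, ∑ y : Fin m, Z (.inr x) (.inl y) * -A y x = - ∑ i, ∑ j, A i j * Z (.inl i) (.inr j) := by
          rw [Finset.sum_comm, ← Finset.sum_neg_distrib]
          refine Finset.sum_congr rfl fun i _ => ?_
          rw [← Finset.sum_neg_distrib]
          refine Finset.sum_congr rfl fun j _ => ?_
          rw [((psd_iff Z).mp hZpsd).1]; ring
        have e4 : ∑ x : Fin m, ∑ y : Fin n, Z (.inl x) (.inr y) * -A x y = - ∑ i, ∑ j, A i j * Z (.inl i) (.inr j) := by
          rw [← Finset.sum_neg_distrib]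
          refine Finset.sum_congr rfl fun i _ => ?_
          rw [← Finset.sum_neg_distrib]
          refine Finset.sum_congr rfl fun j _ => ?_
          ring
        rw [e3, e4, mul_add, Finset.mul_sum, Finset.mul_sum]
        have e5 : ∑ x, Z (.inl x) (.inl x) * (κ * l x ^ θ1) = ∑ i, κ * (l i ^ θ1 * Z (.inl i) (.inl i)) :=
          Finset.sum_congr rfl fun i _ => by ring
        have e6 : ∑ x, Z (.inr x) (.inr x) * (κ * k x ^ θ2) = ∑ i, κ * (k i ^ θ2 * Z (.inr i) (.inr i)) :=
          Finset.sum_congr rfl fun i _ => by ring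
        rw [e5, e6]; ring
      rw [e] at hneg
      linarith
    · intro a b
      rcases a with i | i <;> rcases b with j | j <;> simp only [hΦ, bigM, Matrix.fromBlocks_apply₁₁, Matrix.fromBlocks_apply₁₂, Matrix.fromBlocks_apply₂₁, Matrix.fromBlocks_apply₂₂, Matrix.diagonal_apply, Matrix.neg_apply, Matrix.transpose_apply]
      · by_cases hij : i = j
        · subst hij; rfl
        · simp [hij, Ne.symm hij]
      · by_cases hij : i = j
        · subst hij; rfl
        · simp [hij, Ne.symm hij]
  · rw [Set.not_disjoint_iff] at hdis
    obtain ⟨_, ⟨⟨⟨w1, l⟩, ⟨w2, k⟩⟩, ⟨⟨hl, hw1⟩, ⟨hk, hw2⟩⟩, rfl⟩, hpsd⟩ := hdis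
    refine ⟨l, k, hl.1, hl.2, hk.1, hk.2, fun y x => ?_⟩
    have hpsd2 : Matrix.PosSemidef (Matrix.fromBlocks (Matrix.diagonal fun i => κ * w1 i) (-A) (-A.transpose) (Matrix.diagonal fun i => κ * w2 i)) := hpsd
    have := ((psd_iff _).mp hpsd2).2 (Sum.elim y x)
    simp only [Fintype.sum_sum_type, Sum.elim_inl, Sum.elim_inr, Matrix.fromBlocks_apply₁₁, Matrix.fromBlocks_apply₁₂, Matrix.fromBlocks_apply₂₁, Matrix.fromBlocks_apply₂₂, Matrix.diagonal_apply, Matrix.neg_apply, Matrix.transpose_apply, Finset.sum_add_distrib, mul_ite, ite_mul, zero_mul, mul_zero, Finset.sum_ite_eq, Finset.mem_univ, if_true] at this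
    have e3 : ∑ j : Fin n, ∑ i : Fin m, x j * -A i j * y i = - ∑ i, ∑ j, A i j * (y i * x j) := by
      rw [Finset.sum_comm, ← Finset.sum_neg_distrib]
      refine Finset.sum_congr rfl fun i _ => ?_
      rw [← Finset.sum_neg_distrib]
      exact Finset.sum_congr rfl fun j _ => by ring
    have e4 : ∑ i : Fin m, ∑ j : Fin n, y i * -A i j * x j = - ∑ i, ∑ j, A i j * (y i * x j) := by
      rw [← Finset.sum_neg_distrib]
      refine Finset.sum_congr rfl fun i _ => ?_
      rw [← Finset.sum_neg_distrib]
      exact Finset.sum_congr rfl fun j _ => by ring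
    rw [e3, e4] at this
    have e5 : ∑ i, y i * (κ * w1 i) * y i ≤ κ * ∑ i, l i ^ θ1 * y i^2 := by
      rw [Finset.mul_sum]
      refine Finset.sum_le_sum fun i _ => ?_
      have := mul_le_mul_of_nonneg_left (mul_le_mul_of_nonneg_right (hw1 i).2 (sq_nonneg (y i))) hκ
      simp only at this
      linarith
    have e6 : ∑ i, x i * (κ * w2 i) * x i ≤ κ * ∑ i, k i ^ θ2 * x i^2 := by
      rw [Finset.mul_sum]
      refine Finset.sum_le_sum fun i _ => ?_
      have := mul_le_mul_of_nonneg_left (mul_le_mul_of_nonneg_right (hw2 i).2 (sq_nonneg (x i))) hκ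
      simp only at this
      linarith
    linarith


lemma weighted_holder {d : ℕ} (l x : Fin d → ℝ) (hl : ∀ i, 0 ≤ l i) (hl1 : ∑ i, l i = 1) (r s : ℝ) (hr : 0 < r) (hrs : r ≤ s) :
    ∑ i, l i ^ (1 - r/s) * |x i| ^ r ≤ (∑ i, |x i| ^ s) ^ (r/s) := by
  have hs : 0 < s := hr.trans_le hrs
  rcases eq_or_lt_of_le hrs with h | h
  · subst h
    rw [div_self hr.ne']; simp
  · have hθ : 0 < 1 - r/s := by rw [sub_pos, div_lt_one hs]; exact h
    have hrs0 : 0 < r/s := by positivity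
    have hc : Real.HolderConjugate (1/(1-r/s)) (s/r) := by
      rw [Real.holderConjugate_iff]
      constructor
      · rw [lt_div_iff₀ hθ]; linarith
      · rw [one_div, inv_inv, inv_div]; ring
    have := Real.inner_le_Lp_mul_Lq_of_nonneg Finset.univ hc (f := fun i => l i ^ (1 - r/s)) (g := fun i => |x i| ^ r)
      (fun i _ => Real.rpow_nonneg (hl i) _) (fun i _ => Real.rpow_nonneg (abs_nonneg _) _)
    refine this.trans_eq ?_
    have e1 : ∀ i, (l i ^ (1 - r/s)) ^ (1/(1-r/s)) = l i := fun i => by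
      rw [← Real.rpow_mul (hl i), mul_one_div_cancel hθ.ne', Real.rpow_one]
    have e2 : ∀ i, (|x i| ^ r) ^ (s/r) = |x i| ^ s := fun i => by
      rw [← Real.rpow_mul (abs_nonneg _), mul_div_cancel₀ _ hr.ne']
    simp only [e1, e2, hl1, Real.one_rpow, one_mul, one_div_div]

lemma opNorm_diag {d : ℕ} (l : Fin d → ℝ) (hl : ∀ i, 0 ≤ l i) (hl1 : ∑ i, l i = 1) (r s : ℝ) (hr : 0 < r) (hs1 : 1 ≤ s) (hrs : r ≤ s) :
    opNorm s r (Matrix.diagonal fun i => l i ^ (1/r - 1/s)) ≤ 1 := by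
  have hs : 0 < s := hr.trans_le hrs
  refine opNorm_le s r 1 hs1 zero_le_one _ fun x => ?_
  rw [one_mul]
  unfold lpnorm
  have h := weighted_holder l x hl hl1 r s hr hrs
  have e : ∀ i, |(Matrix.diagonal fun i => l i ^ (1/r - 1/s)).mulVec x i| ^ r = l i ^ (1 - r/s) * |x i| ^ r := fun i => by
    rw [Matrix.mulVec_diagonal, abs_mul, abs_of_nonneg (Real.rpow_nonneg (hl i) _), Real.mul_rpow (Real.rpow_nonneg (hl i) _) (abs_nonneg _),
      ← Real.rpow_mul (hl i)]
    congr 2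
    field_simp
  simp only [e]
  have hN : 0 ≤ ∑ i, |x i| ^ s := Finset.sum_nonneg fun i _ => Real.rpow_nonneg (abs_nonneg _) _
  calc _ ≤ ((∑ i, |x i| ^ s) ^ (r/s)) ^ (1/r) := by
        apply Real.rpow_le_rpow _ h (by positivity)
        exact Finset.sum_nonneg fun i _ => mul_nonneg (Real.rpow_nonneg (hl i) _) (Real.rpow_nonneg (abs_nonneg _) _)
    _ = _ := by
        rw [← Real.rpow_mul hN]; congr 1; field_simp

lemma opNorm_zero' {m n : ℕ} (p q : ℝ) (hp : 1 ≤ p) (hq : 1 ≤ q) : opNorm p q (0 : Matrix (Fin m) (Fin n) ℝ) = 0 := by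
  refine le_antisymm (opNorm_le p q 0 hp le_rfl _ fun x => ?_) (opNorm_nonneg _ _ _)
  rw [Matrix.zero_mulVec, zero_mul]
  unfold lpnorm
  simp only [Pi.zero_apply, abs_zero]
  rw [Real.zero_rpow (by linarith)]
  simp only [Finset.sum_const_zero]
  rw [Real.zero_rpow (by positivity)]

/-- scaling lemma -/
lemma amgm_scale (a b c κ : ℝ) (hκ : 0 ≤ κ) (ha : 0 ≤ a) (hb : 0 ≤ b)
    (h : ∀ s t : ℝ, 2 * (s * t * c) ≤ κ * (s^2 * a^2 + t^2 * b^2)) : c ≤ κ * (a * b) := by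
  rcases eq_or_lt_of_le ha with ha' | ha'
  · subst ha'
    rcases le_or_gt c 0 with hc | hc
    · simpa using hc
    exfalso
    have := h ((κ * b^2 + 1)/c) 1
    have e : (κ * b^2 + 1)/c * 1 * c = κ * b^2 + 1 := by field_simp
    rw [e] at this
    nlinarith [mul_nonneg hκ (sq_nonneg b)]
  rcases eq_or_lt_of_le hb with hb' | hb'
  · subst hb'
    rcases le_or_gt c 0 with hc | hc
    · simpa using hc
    exfalso
    have := h 1 ((κ * a^2 + 1)/c)
    have e : 1 * ((κ * a^2 + 1)/c) * c = κ * a^2 + 1 := by field_simp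
    rw [e] at this
    nlinarith [mul_nonneg hκ (sq_nonneg a)]
  have := h b a
  have hab : 0 < a * b := by positivity
  have h2 : (a * b) * c ≤ (a*b) * (κ * (a*b)) := by nlinarith
  exact le_of_mul_le_mul_left h2 hab

lemma opNorm_two_le {m n : ℕ} (B : Matrix (Fin m) (Fin n) ℝ) (κ : ℝ) (hκ : 0 ≤ κ)
    (h : ∀ (y : Fin m → ℝ) (x : Fin n → ℝ), 2 * ∑ i, ∑ j, B i j * (y i * x j) ≤ κ * (∑ i, y i^2 + ∑ j, x j^2)) :
    opNorm 2 2 B ≤ κ := by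
  refine opNorm_le 2 2 κ (by norm_num) hκ _ fun x => ?_
  have hl : ∀ {d : ℕ} (z : Fin d → ℝ), lpnorm 2 z ^ 2 = ∑ i, z i ^ 2 := fun z => by
    unfold lpnorm
    have h0 : 0 ≤ ∑ i, |z i| ^ (2:ℝ) := Finset.sum_nonneg fun i _ => Real.rpow_nonneg (abs_nonneg _) _
    rw [← Real.rpow_natCast, ← Real.rpow_mul h0]
    norm_num
  set w := B.mulVec x with hw
  have key := amgm_scale (lpnorm 2 w) (lpnorm 2 x) (∑ i, w i^2) κ hκ (lpnorm_nonneg _ _) (lpnorm_nonneg _ _) (fun s t => by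
    have := h (fun i => s * w i) (fun j => t * x j)
    rw [hl, hl]
    have e : ∑ i, ∑ j, B i j * ((s * w i) * (t * x j)) = s * t * ∑ i, w i^2 := by
      rw [Finset.mul_sum]
      refine Finset.sum_congr rfl fun i _ => ?_
      have : w i = ∑ j, B i j * x j := rfl
      rw [sq]
      nth_rewrite 3 [this]
      rw [Finset.mul_sum, Finset.mul_sum]
      exact Finset.sum_congr rfl fun j _ => by ring
    rw [e] at this
    simpa only [mul_pow, ← Finset.mul_sum] using this)
  rw [← hl w] at key
  rcases eq_or_lt_of_le (lpnorm_nonneg 2 w) with h0 | h0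
  · rw [← h0]; exact mul_nonneg hκ (lpnorm_nonneg _ _)
  · have : lpnorm 2 w * lpnorm 2 w ≤ lpnorm 2 w * (κ * lpnorm 2 x) := by nlinarith
    exact le_of_mul_le_mul_left this h0

lemma factor_aux {m n : ℕ} (A : Matrix (Fin m) (Fin n) ℝ) (κ : ℝ) (hκ : 0 ≤ κ) (d : Fin m → ℝ) (e : Fin n → ℝ)
    (hd : ∀ i, 0 ≤ d i) (he : ∀ j, 0 ≤ e j)
    (h : ∀ (y : Fin m → ℝ) (x : Fin n → ℝ), 2 * ∑ i, ∑ j, A i j * (y i * x j) ≤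
       κ * (∑ i, d i ^ 2 * y i^2 + ∑ j, e j ^ 2 * x j^2)) :
    ∃ B : Matrix (Fin m) (Fin n) ℝ, A = Matrix.diagonal d * B * Matrix.diagonal e ∧ opNorm 2 2 B ≤ κ := by
  have hA : ∀ i j, |A i j| ≤ κ * (d i * e j) := by
    have gen : ∀ i j s t, 2 * (s * t * A i j) ≤ κ * (s^2 * d i^2 + t^2 * e j^2) := by
      intro i j s t
      have := h (Pi.single i s) (Pi.single j t)
      have e1 : ∑ i', ∑ j', A i' j' * ((Pi.single i s : Fin m → ℝ) i' * (Pi.single j t : Fin n → ℝ) j') = s * t * A i j := by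
        rw [Finset.sum_eq_single i, Finset.sum_eq_single j]
        · simp; ring
        · intro b _ hb; simp [hb]
        · simp
        · intro b _ hb; simp [hb]
        · simp
      have e2 : ∑ i', d i' ^ 2 * (Pi.single i s : Fin m → ℝ) i' ^ 2 = s^2 * d i^2 := by
        rw [Finset.sum_eq_single i]
        · simp; ring
        · intro b _ hb; simp [hb]
        · simp
      have e3 : ∑ i', e i' ^ 2 * (Pi.single j t : Fin n → ℝ) i' ^ 2 = t^2 * e j^2 := by
        rw [Finset.sum_eq_single j]
        · simp; ring
        · intro b _ hb; simp [hb]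
        · simp
      rwa [e1, e2, e3] at this
    intro i j
    rw [abs_le']
    refine ⟨amgm_scale _ _ _ _ hκ (hd i) (he j) (gen i j), amgm_scale _ _ _ _ hκ (hd i) (he j) fun s t => ?_⟩
    have := gen i j (-s) t
    nlinarith
  refine ⟨Matrix.of fun i j => A i j / (d i * e j), ?_, ?_⟩
  · ext i j
    rw [Matrix.mul_diagonal, Matrix.diagonal_mul, Matrix.of_apply]
    by_cases hz : d i * e j = 0
    · have := hA i j
      rw [hz, mul_zero] at this
      have h0 : A i j = 0 := abs_nonpos_iff.mp this
      rw [h0]; simp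
    · have h1 : d i ≠ 0 := left_ne_zero_of_mul hz
      have h2 : e j ≠ 0 := right_ne_zero_of_mul hz
      field_simp
  · refine opNorm_two_le _ κ hκ fun y x => ?_
    have := h (fun i => y i / d i) (fun j => x j / e j)
    have e1 : ∑ i, ∑ j, A i j * ((y i / d i) * (x j / e j)) = ∑ i, ∑ j, (Matrix.of fun i j => A i j / (d i * e j)) i j * (y i * x j) :=
      Finset.sum_congr rfl fun i _ => Finset.sum_congr rfl fun j _ => by
        rw [Matrix.of_apply, div_mul_div_comm]; ring
    rw [e1] at this
    refine this.trans (mul_le_mul_of_nonneg_left (add_le_add ?_ ?_) hκ)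
    · refine Finset.sum_le_sum fun i _ => ?_
      by_cases hz : d i = 0
      · simp [hz]; positivity
      · apply le_of_eq; field_simp
    · refine Finset.sum_le_sum fun i _ => ?_
      by_cases hz : e i = 0
      · simp [hz]; positivity
      · apply le_of_eq; field_simp

/-- Every operator from `ℓ_p^n` to `ℓ_q^m` factorizes through a Hilbert space with
factorization constant at most `(1+ε₀)/(arsinh(1)·γ_{p*}·γ_q)`. -/
theorem factorization_through_hilbert_space (p q : ℝ) (hq1 : 1 ≤ q) (hq2 : q ≤ 2)
    (hp : 2 ≤ p) (m n : ℕ) (A : Matrix (Fin m) (Fin n) ℝ) :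
    ∃ (D₁ : Matrix (Fin m) (Fin m) ℝ) (B : Matrix (Fin m) (Fin n) ℝ)
      (D₂ : Matrix (Fin n) (Fin n) ℝ),
      D₁.IsDiag ∧ D₂.IsDiag ∧ A = D₁ * B * D₂ ∧
      opNorm p 2 D₂ * opNorm 2 2 B * opNorm 2 q D₁ ≤
        ((1 + 0.00863) / Real.arsinh 1) *
          (1 / (gaussNorm (p / (p - 1)) * gaussNorm q)) * opNorm p q A := by
  have has : 0 < Real.arsinh 1 := Real.arsinh_pos_iff.mpr one_pos
  have hg : ∀ r, 1 ≤ r → 0 < gaussNorm r := fun r hr => by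
    rw [gaussNorm_eq]; exact Real.rpow_pos_of_pos (MM_pos r (by linarith)) _
  have hps : 1 ≤ p / (p-1) := by rw [le_div_iff₀ (by linarith)]; linarith
  have hg1 := hg _ hps
  have hg2 := hg q hq1
  have hop := opNorm_nonneg p q A
  by_cases hA : A = 0
  · refine ⟨0, 0, 0, Matrix.isDiag_zero, Matrix.isDiag_zero, by simp [hA], ?_⟩
    rw [opNorm_zero' p 2 (by linarith) (by norm_num), zero_mul, zero_mul]
    positivity
  have hm : 0 < m := by
    rcases Nat.eq_zero_or_pos m with h | h
    · subst h; exact absurd (by ext i; exact i.elim0) hA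
    · exact h
  have hn : 0 < n := by
    rcases Nat.eq_zero_or_pos n with h | h
    · subst h; exact absurd (by ext i j; exact j.elim0) hA
    · exact h
  set c : ℝ := Real.arsinh 1 / (1 + 0.00863) with hc
  have hc0 : 0 < c := by positivity
  have hc1 : Real.sinh c < 1 := by
    have : c < Real.arsinh 1 := by rw [hc, div_lt_iff₀ (by norm_num)]; nlinarith
    calc Real.sinh c < Real.sinh (Real.arsinh 1) := Real.sinh_strictMono this
      _ = 1 := Real.sinh_arsinh 1
  set κ := 1/(c*(gaussNorm (p/(p-1)) * gaussNorm q)) * opNorm p q A with hκ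
  have hκ0 : 0 ≤ κ := by positivity
  have hq0 : 0 < q := by linarith
  have hp0 : 0 < p := by linarith
  obtain ⟨l, k, l0, l1, k0, k1, H⟩ := separation A κ hκ0 (2/q-1) (1-2/p)
    (by rw [sub_nonneg, le_div_iff₀ hq0]; linarith) (by rw [sub_le_iff_le_add, div_le_iff₀ hq0]; linarith)
    (by rw [sub_nonneg, div_le_one hp0]; linarith) (by rw [sub_le_self_iff]; positivity)
    (fun Z hZ => rounding p q hq1 hq2 hp hm hn A c hc0 hc1 Z hZ)
  obtain ⟨B, hB, hBn⟩ := factor_aux A κ hκ0 (fun i => l i ^ (1/q-1/2)) (fun j => k j ^ (1/2 - 1/p))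
    (fun i => Real.rpow_nonneg (l0 i) _) (fun i => Real.rpow_nonneg (k0 i) _) (fun y x => by
      refine (H y x).trans_eq ?_
      have e1 : ∀ i, (l i ^ (1/q-1/2)) ^ 2 = l i ^ (2/q-1) := fun i => by
        rw [← Real.rpow_mul_natCast (l0 i)]; congr 1; push_cast; ring
      have e2 : ∀ i, (k i ^ (1/2-1/p)) ^ 2 = k i ^ (1-2/p) := fun i => by
        rw [← Real.rpow_mul_natCast (k0 i)]; congr 1; push_cast; ring
      simp only [e1, e2])
  refine ⟨_, B, _, Matrix.isDiag_diagonal _, Matrix.isDiag_diagonal _, hB, ?_⟩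
  have n1 := opNorm_diag l l0 l1 q 2 hq0 (by norm_num) hq2
  have n2 := opNorm_diag k k0 k1 2 p (by norm_num) (by linarith) hp
  have e : ((1 + 0.00863) / Real.arsinh 1) * (1 / (gaussNorm (p / (p - 1)) * gaussNorm q)) * opNorm p q A = κ := by
    rw [hκ, hc]; congr 1; field_simp
  rw [e]
  calc _ ≤ 1 * κ * 1 := by
        apply mul_le_mul _ n1 (opNorm_nonneg _ _ _) (by linarith)
        exact mul_le_mul n2 hBn (opNorm_nonneg _ _ _) zero_le_one
    _ = κ := by ring
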